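/- arXiv:1602.06906 — 2 statements merged into one kernel-verified Lean document; each statement's English description precedes it below -/
import Mathlib

section
/- Let D be a division ring. The Dieudonné determinant induces an isomorphism from K₁(D) to the abelianization D^×/[D^×, D^×] of the multiplicative group of units of D, whose inverse sends the class of a unit u ∈ D^× to the class in K₁(D) of the 1×1 matrix (u). -/
/-- Generators for `K₁`: square matrices of all sizes. -/
def MatGen (D : Type) [Ring D] : Type := Σ n : ℕ, Matrix (Fin n) (Fin n) D

/-- Stabilization `A ↦ A ⊕ 1`. -/
def stabMat {D : Type} [Ring D] {n : ℕ} (A : Matrix (Fin n) (Fin n) D) :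
    Matrix (Fin (n + 1)) (Fin (n + 1)) D := fun i j =>
  if hi : (i : ℕ) < n then
    (if hj : (j : ℕ) < n then A ⟨i, hi⟩ ⟨j, hj⟩ else 0)
  else (if (j : ℕ) < n then 0 else 1)

/-- Relations presenting `K₁(D) = GL(D)/[GL(D),GL(D)]`: multiplicativity on
invertible matrices of each size, stabilization, and killing of the superfluous
generators given by non-invertible matrices. -/
def K1Rel (D : Type) [Ring D] : AddSubgroup (FreeAbelianGroup (MatGen D)) :=
  AddSubgroup.closure
    ({x | ∃ (n : ℕ) (A B : Matrix (Fin n) (Fin n) D), IsUnit A ∧ IsUnit B ∧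
        x = FreeAbelianGroup.of ⟨n, A * B⟩ - FreeAbelianGroup.of ⟨n, A⟩
          - FreeAbelianGroup.of ⟨n, B⟩} ∪
      {x | ∃ (n : ℕ) (A : Matrix (Fin n) (Fin n) D),
        x = FreeAbelianGroup.of ⟨n + 1, stabMat A⟩ - FreeAbelianGroup.of ⟨n, A⟩} ∪
      {x | ∃ (n : ℕ) (A : Matrix (Fin n) (Fin n) D), ¬ IsUnit A ∧
        x = FreeAbelianGroup.of ⟨n, A⟩})

/-- `K₁` of a ring, via the standard presentation of `GL(D)` abelianized. -/
def K1 (D : Type) [Ring D] : Type := FreeAbelianGroup (MatGen D) ⧸ K1Rel D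

noncomputable instance (D : Type) [Ring D] : AddCommGroup (K1 D) := by
  unfold K1; infer_instance

/-- The class of a square matrix in `K₁`. -/
def K1mk (D : Type) [Ring D] {n : ℕ} (A : Matrix (Fin n) (Fin n) D) : K1 D :=
  QuotientAddGroup.mk (FreeAbelianGroup.of ⟨n, A⟩)

open Matrix

section RowOperations

variable {D : Type} [Ring D] {n : ℕ}

/-- Add `c` times row `j` to row `i`. -/
def addRow (A : Matrix (Fin n) (Fin n) D) (i j : Fin n) (c : D) : Matrix (Fin n) (Fin n) D :=
  A.updateRow i (A i + c • A j)

/-- Multiply row `i` by `u` on the left. -/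
def scaleRow (A : Matrix (Fin n) (Fin n) D) (i : Fin n) (u : D) : Matrix (Fin n) (Fin n) D :=
  A.updateRow i (u • A i)

theorem addRow_self (A : Matrix (Fin n) (Fin n) D) (i j : Fin n) (c : D) :
    addRow A i j c i = A i + c • A j := by
  simp [addRow]

theorem addRow_of_ne (A : Matrix (Fin n) (Fin n) D) {i k : Fin n} (h : k ≠ i) (j : Fin n) (c : D) :
    addRow A i j c k = A k := by
  simp [addRow, h]

theorem scaleRow_self (A : Matrix (Fin n) (Fin n) D) (i : Fin n) (u : D) :
    scaleRow A i u i = u • A i := by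
  simp [scaleRow]

theorem scaleRow_of_ne (A : Matrix (Fin n) (Fin n) D) {i k : Fin n} (h : k ≠ i) (u : D) :
    scaleRow A i u k = A k := by
  simp [scaleRow, h]

theorem addRow_mul (A B : Matrix (Fin n) (Fin n) D) (i j : Fin n) (c : D) :
    addRow A i j c * B = addRow (A * B) i j c := by
  ext k l
  rcases eq_or_ne k i with rfl | h
  · rw [addRow_self]
    simp [mul_apply, addRow_self, add_mul, Finset.sum_add_distrib, Finset.mul_sum, mul_assoc]
  · rw [addRow_of_ne _ h]
    simp [mul_apply, addRow_of_ne _ h]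

theorem scaleRow_mul (A B : Matrix (Fin n) (Fin n) D) (i : Fin n) (u : D) :
    scaleRow A i u * B = scaleRow (A * B) i u := by
  ext k l
  rcases eq_or_ne k i with rfl | h
  · rw [scaleRow_self]
    simp [mul_apply, scaleRow_self, Finset.mul_sum, mul_assoc]
  · rw [scaleRow_of_ne _ h]
    simp [mul_apply, scaleRow_of_ne _ h]

theorem addRow_addRow (A : Matrix (Fin n) (Fin n) D) {i j : Fin n} (h : i ≠ j) (c d : D) :
    addRow (addRow A i j c) i j d = addRow A i j (c + d) := by
  ext k l
  rcases eq_or_ne k i with rfl | hk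
  · simp [addRow_self, addRow_of_ne _ h.symm, add_smul, add_assoc]
  · simp [addRow_of_ne _ hk]

theorem addRow_zero (A : Matrix (Fin n) (Fin n) D) (i j : Fin n) : addRow A i j 0 = A := by
  simp [addRow]

theorem scaleRow_scaleRow (A : Matrix (Fin n) (Fin n) D) (i : Fin n) (u v : D) :
    scaleRow (scaleRow A i u) i v = scaleRow A i (v * u) := by
  ext k l
  rcases eq_or_ne k i with rfl | hk
  · simp [scaleRow_self, mul_assoc]
  · simp [scaleRow_of_ne _ hk]

theorem scaleRow_one (A : Matrix (Fin n) (Fin n) D) (i : Fin n) : scaleRow A i 1 = A := by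
  simp [scaleRow]

theorem addRow_eq_mul (A : Matrix (Fin n) (Fin n) D) (i j : Fin n) (c : D) :
    addRow A i j c = addRow 1 i j c * A := by
  rw [addRow_mul, one_mul]

theorem scaleRow_eq_mul (A : Matrix (Fin n) (Fin n) D) (i : Fin n) (u : D) :
    scaleRow A i u = scaleRow 1 i u * A := by
  rw [scaleRow_mul, one_mul]

theorem isUnit_addRow_one {i j : Fin n} (h : i ≠ j) (c : D) :
    IsUnit (addRow (1 : Matrix (Fin n) (Fin n) D) i j c) :=
  ⟨⟨addRow 1 i j c, addRow 1 i j (-c),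
    by rw [← addRow_eq_mul, addRow_addRow _ h, neg_add_cancel, addRow_zero],
    by rw [← addRow_eq_mul, addRow_addRow _ h, add_neg_cancel, addRow_zero]⟩, rfl⟩

theorem isUnit_scaleRow_one (i : Fin n) (u : Dˣ) :
    IsUnit (scaleRow (1 : Matrix (Fin n) (Fin n) D) i u) :=
  ⟨⟨scaleRow 1 i u, scaleRow 1 i ↑u⁻¹,
    by rw [← scaleRow_eq_mul, scaleRow_scaleRow, Units.mul_inv, scaleRow_one],
    by rw [← scaleRow_eq_mul, scaleRow_scaleRow, Units.inv_mul, scaleRow_one]⟩, rfl⟩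

/-- A function invariant under single row additions is invariant under adding multiples of one row
to all the other rows at once. -/
theorem apply_add_smul_row {α : Type*} {f : Matrix (Fin n) (Fin n) D → α}
    (hf : ∀ A i j c, i ≠ j → f (addRow A i j c) = f A)
    (A : Matrix (Fin n) (Fin n) D) (m : Fin n) (c : Fin n → D) (hc : c m = 0) :
    f (of fun k => A k + c k • A m) = f A := by
  suffices h : ∀ s : Finset (Fin n), f (of fun k => if k ∈ s then A k + c k • A m else A k) = f A by
    simpa using h Finset.univ
  intro s
  induction s using Finset.induction_on with
  | empty => exact congrArg f (by ext; simp)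
  | insert a s ha ih =>
    rw [← ih]
    rcases eq_or_ne a m with rfl | ham
    · congr 1
      ext k l
      by_cases hk : k = a <;> simp [hk, ha, hc]
    · refine Eq.trans (congrArg f ?_) (hf _ a m (c a) ham)
      ext k l
      rcases eq_or_ne k a with rfl | hk
      · rw [addRow_self]
        by_cases hm : m ∈ s <;> simp [ha, hm, hc]
      · rw [addRow_of_ne _ hk]
        simp [hk]

end RowOperations

section Generation

variable {D : Type} [DivisionRing D] {n : ℕ}

theorem isUnit_addRow_iff {A : Matrix (Fin n) (Fin n) D} {i j : Fin n} (h : i ≠ j) (c : D) :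
    IsUnit (addRow A i j c) ↔ IsUnit A := by
  rw [addRow_eq_mul]
  exact (isUnit_addRow_one h c).mul_left_iff

theorem isUnit_scaleRow_iff {A : Matrix (Fin n) (Fin n) D} (i : Fin n) {u : D} (hu : u ≠ 0) :
    IsUnit (scaleRow A i u) ↔ IsUnit A := by
  rw [scaleRow_eq_mul]
  exact (isUnit_scaleRow_one i (Units.mk0 u hu)).mul_left_iff

/-- If the columns of an invertible matrix before column `k` are those of the identity, then
column `k` has a nonzero entry on or below the diagonal. -/
theorem exists_ne_zero_of_columns_eq_one {A : Matrix (Fin n) (Fin n) D} (hA : IsUnit A)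
    (k : Fin n) (hcol : ∀ j < k, ∀ i, A i j = (1 : Matrix (Fin n) (Fin n) D) i j) :
    ∃ i, k ≤ i ∧ A i k ≠ 0 := by
  by_contra! hzero
  obtain ⟨B, hB⟩ := hA.exists_left_inv
  have hBk : ∀ j < k, B k j = 0 := by
    intro j hj
    have h := congrFun (congrFun hB k) j
    rw [mul_apply, one_apply_ne hj.ne'] at h
    simpa [hcol j hj, one_apply] using h
  have h := congrFun (congrFun hB k) k
  rw [mul_apply, one_apply_eq, Finset.sum_eq_zero] at h
  · exact zero_ne_one h
  · intro i _
    rcases lt_or_ge i k with hi | hi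
    · rw [hBk i hi, zero_mul]
    · rw [hzero i hi, mul_zero]

/-- Gaussian elimination: a property of matrices which holds for the identity and is preserved by
row operations holds for all invertible matrices. -/
theorem isUnit_row_induction {Q : Matrix (Fin n) (Fin n) D → Prop} (h_one : Q 1)
    (h_add : ∀ A i j c, i ≠ j → Q A → Q (addRow A i j c))
    (h_scale : ∀ A i u, u ≠ 0 → Q A → Q (scaleRow A i u))
    {A : Matrix (Fin n) (Fin n) D} (hA : IsUnit A) : Q A := by
  have q_add : ∀ A i j c, i ≠ j → Q (addRow A i j c) = Q A := by
    refine fun A i j c h => propext ⟨fun hQ => ?_, h_add A i j c h⟩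
    simpa [addRow_addRow _ h, addRow_zero] using h_add _ i j (-c) h hQ
  have q_scale : ∀ A i u, u ≠ 0 → Q (scaleRow A i u) → Q A := by
    intro A i u hu hQ
    simpa [scaleRow_scaleRow, hu, scaleRow_one] using h_scale _ i u⁻¹ (inv_ne_zero hu) hQ
  suffices main : ∀ m k : ℕ, k + m = n → ∀ A : Matrix (Fin n) (Fin n) D, IsUnit A →
      (∀ j : Fin n, (j : ℕ) < k → ∀ i, A i j = (1 : Matrix (Fin n) (Fin n) D) i j) → Q A from
    main n 0 (by simp) A hA (by simp)
  intro m
  induction m with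
  | zero =>
    intro k hk A _ hcol
    have : A = 1 := by
      ext i j
      exact hcol j (by omega) i
    rwa [this]
  | succ m ih =>
    intro k hk
    let K : Fin n := ⟨k, by omega⟩
    have of_eq_one : ∀ A : Matrix (Fin n) (Fin n) D, IsUnit A →
        (∀ j : Fin n, (j : ℕ) < k → ∀ i, A i j = (1 : Matrix (Fin n) (Fin n) D) i j) →
        A K K = 1 → Q A := by
      intro A hA hcol hK
      let c : Fin n → D := fun i => if i = K then 0 else -A i K
      have hc : c K = 0 := by simp [c]
      rw [← apply_add_smul_row q_add A K c hc]
      refine ih (k + 1) (by omega) _ ?_ ?_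
      · rwa [apply_add_smul_row (f := IsUnit)
          (fun A i j c h => propext (isUnit_addRow_iff h c)) A K c hc]
      · intro j hj i
        rcases Nat.lt_succ_iff_lt_or_eq.mp hj with hj | hj
        · have hKj : K ≠ j := fun h => by simp [← h, K] at hj
          simp [hcol j hj, one_apply_ne hKj]
        · obtain rfl : j = K := Fin.ext hj
          rcases eq_or_ne i K with rfl | hi
          · simp [hc, hK]
          · simp [c, hi, hK, one_apply_ne hi]
    have of_ne_zero : ∀ A : Matrix (Fin n) (Fin n) D, IsUnit A →
        (∀ j : Fin n, (j : ℕ) < k → ∀ i, A i j = (1 : Matrix (Fin n) (Fin n) D) i j) →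
        A K K ≠ 0 → Q A := by
      intro A hA hcol hK
      refine q_scale A K (A K K)⁻¹ (inv_ne_zero hK) (of_eq_one _ ?_ ?_ ?_)
      · rwa [isUnit_scaleRow_iff K (inv_ne_zero hK)]
      · intro j hj i
        rcases eq_or_ne i K with rfl | hi
        · have hKj : K ≠ j := fun h => by simp [← h, K] at hj
          simp [scaleRow_self, hcol j hj, one_apply_ne hKj]
        · simp [scaleRow_of_ne _ hi, hcol j hj]
      · simp [scaleRow_self, hK]
    intro A hA hcol
    by_cases hK : A K K = 0
    · obtain ⟨i, hi, hne⟩ := exists_ne_zero_of_columns_eq_one hA K fun j hj => hcol j hj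
      have hKi : K ≠ i := by
        rintro rfl
        exact hne hK
      rw [← q_add A K i 1 hKi]
      refine of_ne_zero _ ((isUnit_addRow_iff hKi 1).mpr hA) ?_ ?_
      · intro j hj l
        rcases eq_or_ne l K with rfl | hl
        · have hij : i ≠ j := by
            rintro rfl
            exact absurd hi (not_le.mpr hj)
          simp [addRow_self, hcol j hj, one_apply_ne hij]
        · simp [addRow_of_ne _ hl, hcol j hj]
      · simpa [addRow_self, hK] using hne
    · exact of_ne_zero A hA hcol hK

end Generation

section DieudonneDeterminant

variable {D : Type} [DivisionRing D] {n : ℕ}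

open Classical in
/-- The class of an element of `D` in `Dˣ/[Dˣ, Dˣ]` with a zero adjoined. -/
noncomputable def unitClass : D →* WithZero (Abelianization Dˣ) :=
  (WithZero.map' Abelianization.of).toMonoidHom.comp
    (WithZero.withZeroUnitsEquiv (G := D)).symm.toMonoidHom

theorem unitClass_coe (u : Dˣ) : unitClass (u : D) = (Abelianization.of u : Abelianization Dˣ) := by
  simp [unitClass]

theorem unitClass_mul_neg_mul_inv (a : D) {b : D} (hb : b ≠ 0) :
    unitClass (-1 : D) * unitClass b * unitClass (-(a * b⁻¹)) = unitClass a := by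
  rw [mul_right_comm, ← map_mul, ← map_mul]
  simp [hb]

/-- The remainder of the row `x` after clearing its first entry by means of the row `p`. -/
def eliminate (p x : Fin (n + 1) → D) : Fin n → D :=
  fun c => x c.succ - x 0 * (p 0)⁻¹ * p c.succ

theorem eliminate_self {p : Fin (n + 1) → D} (hp : p 0 ≠ 0) : eliminate p p = 0 := by
  ext c
  simp [eliminate, hp]

theorem eliminate_add (p x y : Fin (n + 1) → D) :
    eliminate p (x + y) = eliminate p x + eliminate p y := by
  ext c
  simp only [eliminate, Pi.add_apply, add_mul]
  abel

theorem eliminate_smul (p : Fin (n + 1) → D) (a : D) (x : Fin (n + 1) → D) :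
    eliminate p (a • x) = a • eliminate p x := by
  ext c
  simp [eliminate, mul_sub, mul_assoc]

theorem eliminate_smul_left (p x : Fin (n + 1) → D) {u : D} (hu : u ≠ 0) :
    eliminate (u • p) x = eliminate p x := by
  ext c
  simp [eliminate, mul_assoc, hu]

theorem eliminate_of_zero (p : Fin (n + 1) → D) {x : Fin (n + 1) → D} (hx : x 0 = 0) :
    eliminate p x = fun c => x c.succ := by
  ext c
  simp [eliminate, hx]

theorem eliminate_change_pivot {p q : Fin (n + 1) → D} (hq : q 0 ≠ 0)
    (x : Fin (n + 1) → D) :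
    eliminate q x = eliminate p x + (-(x 0 * (q 0)⁻¹)) • eliminate p q := by
  ext c
  simp only [eliminate, Pi.add_apply, Pi.smul_apply, smul_eq_mul, mul_sub, neg_mul, mul_assoc]
  rw [inv_mul_cancel_left₀ hq]
  abel

theorem eliminate_comm {p q : Fin (n + 1) → D} (hp : p 0 ≠ 0) (hq : q 0 ≠ 0) :
    eliminate q p = (-(p 0 * (q 0)⁻¹)) • eliminate p q := by
  rw [eliminate_change_pivot hq p, eliminate_self hp, zero_add]

/-- The row indices other than `i`, enumerated with `0` in the place of `i`. -/
def otherRow (i : Fin (n + 1)) (k : Fin n) : Fin (n + 1) := Equiv.swap 0 i k.succ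

theorem otherRow_ne (i : Fin (n + 1)) (k : Fin n) : otherRow i k ≠ i := by
  intro h
  rw [otherRow, Equiv.swap_apply_eq_iff, Equiv.swap_apply_right] at h
  exact Fin.succ_ne_zero k h

theorem otherRow_injective (i : Fin (n + 1)) : Function.Injective (otherRow i) :=
  (Equiv.injective _).comp (Fin.succ_injective n)

theorem exists_otherRow_eq {i l : Fin (n + 1)} (h : l ≠ i) : ∃ k, otherRow i k = l := by
  have h0 : Equiv.swap 0 i l ≠ 0 := by
    rw [Ne, Equiv.swap_apply_eq_iff, Equiv.swap_apply_left]
    exact h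
  obtain ⟨k, hk⟩ := Fin.exists_succ_eq.mpr h0
  exact ⟨k, by rw [otherRow, hk, Equiv.swap_apply_self]⟩

/-- The Schur complement of the entry in row `i` of the first column. -/
def pivotComplement (i : Fin (n + 1)) (A : Matrix (Fin (n + 1)) (Fin (n + 1)) D) :
    Matrix (Fin n) (Fin n) D :=
  of fun k => eliminate (A i) (A (otherRow i k))

theorem pivotComplement_row (i : Fin (n + 1)) (A : Matrix (Fin (n + 1)) (Fin (n + 1)) D)
    (k : Fin n) : pivotComplement i A k = eliminate (A i) (A (otherRow i k)) := rfl

theorem pivotComplement_addRow {i : Fin (n + 1)} (A : Matrix (Fin (n + 1)) (Fin (n + 1)) D)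
    (k l : Fin n) (c : D) :
    pivotComplement i (addRow A (otherRow i k) (otherRow i l) c) =
      addRow (pivotComplement i A) k l c := by
  funext m
  rw [pivotComplement_row, addRow_of_ne _ (otherRow_ne i k).symm]
  rcases eq_or_ne m k with rfl | hm
  · rw [addRow_self, addRow_self, eliminate_add, eliminate_smul]
    rfl
  · rw [addRow_of_ne _ hm, addRow_of_ne _ ((otherRow_injective i).ne hm)]
    rfl

theorem pivotComplement_addRow_pivot {i : Fin (n + 1)}
    {A : Matrix (Fin (n + 1)) (Fin (n + 1)) D} (hi : A i 0 ≠ 0) {l : Fin (n + 1)} (hl : l ≠ i)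
    (c : D) : pivotComplement i (addRow A l i c) = pivotComplement i A := by
  funext m
  rw [pivotComplement_row, pivotComplement_row, addRow_of_ne _ hl.symm]
  rcases eq_or_ne (otherRow i m) l with rfl | hm
  · rw [addRow_self, eliminate_add, eliminate_smul, eliminate_self hi, smul_zero, add_zero]
  · rw [addRow_of_ne _ hm]

theorem pivotComplement_scaleRow {i : Fin (n + 1)} (A : Matrix (Fin (n + 1)) (Fin (n + 1)) D)
    (k : Fin n) (u : D) :
    pivotComplement i (scaleRow A (otherRow i k) u) = scaleRow (pivotComplement i A) k u := by
  funext m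
  rw [pivotComplement_row, scaleRow_of_ne _ (otherRow_ne i k).symm]
  rcases eq_or_ne m k with rfl | hm
  · rw [scaleRow_self, scaleRow_self, eliminate_smul]
    rfl
  · rw [scaleRow_of_ne _ hm, scaleRow_of_ne _ ((otherRow_injective i).ne hm)]
    rfl

theorem pivotComplement_scaleRow_pivot {i : Fin (n + 1)}
    (A : Matrix (Fin (n + 1)) (Fin (n + 1)) D) {u : D} (hu : u ≠ 0) :
    pivotComplement i (scaleRow A i u) = pivotComplement i A := by
  funext m
  rw [pivotComplement_row, pivotComplement_row, scaleRow_self, scaleRow_of_ne _ (otherRow_ne i m),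
    eliminate_smul_left _ _ hu]

/-- The behaviour under row operations which characterizes the Dieudonné determinant up to a
constant. -/
structure IsRowDet (F : Matrix (Fin n) (Fin n) D → WithZero (Abelianization Dˣ)) : Prop where
  addRow : ∀ A i j c, i ≠ j → F (addRow A i j c) = F A
  scaleRow : ∀ A i u, u ≠ 0 → F (scaleRow A i u) = unitClass u * F A

/-- Expansion of a determinant along the first column with pivot in row `i`. -/
noncomputable def pivotExpansion (F : Matrix (Fin n) (Fin n) D → WithZero (Abelianization Dˣ))
    (i : Fin (n + 1)) (A : Matrix (Fin (n + 1)) (Fin (n + 1)) D) :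
    WithZero (Abelianization Dˣ) :=
  (if i = 0 then 1 else unitClass (-1 : D)) * unitClass (A i 0) * F (pivotComplement i A)

variable {F : Matrix (Fin n) (Fin n) D → WithZero (Abelianization Dˣ)}

theorem pivotExpansion_addRow (hF : IsRowDet F) {A : Matrix (Fin (n + 1)) (Fin (n + 1)) D}
    {i l k : Fin (n + 1)} (hi : A i 0 ≠ 0) (hl : l ≠ i) (hlk : l ≠ k) (c : D) :
    pivotExpansion F i (addRow A l k c) = pivotExpansion F i A := by
  rw [pivotExpansion, pivotExpansion, addRow_of_ne _ hl.symm]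
  congr 1
  rcases eq_or_ne k i with rfl | hk
  · rw [pivotComplement_addRow_pivot hi hl]
  · obtain ⟨l, rfl⟩ := exists_otherRow_eq hl
    obtain ⟨k, rfl⟩ := exists_otherRow_eq hk
    rw [pivotComplement_addRow, hF.addRow]
    rintro rfl
    exact hlk rfl

theorem pivotExpansion_zero_eq_succ (hF : IsRowDet F) {A : Matrix (Fin (n + 1)) (Fin (n + 1)) D}
    (h0 : A 0 0 ≠ 0) {m : Fin n} (hm : A m.succ 0 ≠ 0) :
    pivotExpansion F 0 A = pivotExpansion F m.succ A := by
  let c : Fin n → D := fun k => if k = m then 0 else -(A k.succ 0 * (A m.succ 0)⁻¹)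
  have hc : c m = 0 := by simp [c]
  have h0row : ∀ k : Fin n, otherRow 0 k = k.succ := fun k => by simp [otherRow]
  let B : Matrix (Fin n) (Fin n) D :=
    of fun k => pivotComplement 0 A k + c k • pivotComplement 0 A m
  have hB : ∀ k, B k = pivotComplement 0 A k + c k • pivotComplement 0 A m := fun _ => rfl
  have hFB : F B = F (pivotComplement 0 A) := apply_add_smul_row hF.addRow _ m c hc
  have key : pivotComplement m.succ A = scaleRow B m (-(A 0 0 * (A m.succ 0)⁻¹)) := by
    funext k
    rcases eq_or_ne k m with rfl | hk
    · rw [scaleRow_self, pivotComplement_row, otherRow, Equiv.swap_apply_right,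
        eliminate_comm h0 hm, hB, hc, zero_smul, add_zero, pivotComplement_row, h0row]
    · rw [scaleRow_of_ne _ hk, pivotComplement_row, otherRow, Equiv.swap_apply_of_ne_of_ne
        (Fin.succ_ne_zero k) ((Fin.succ_injective n).ne hk), hB, pivotComplement_row,
        pivotComplement_row, h0row, h0row, eliminate_change_pivot (p := A 0) hm]
      simp [c, hk]
  have hne : -(A 0 0 * (A m.succ 0)⁻¹) ≠ 0 := neg_ne_zero.mpr (mul_ne_zero h0 (inv_ne_zero hm))
  rw [pivotExpansion, pivotExpansion, key, hF.scaleRow _ _ _ hne,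
    hFB, if_pos rfl, if_neg (Fin.succ_ne_zero m), ← mul_assoc,
    unitClass_mul_neg_mul_inv _ hm, one_mul]

theorem pivotExpansion_zero_eq (hF : IsRowDet F) {A : Matrix (Fin (n + 1)) (Fin (n + 1)) D}
    (h0 : A 0 0 ≠ 0) {i : Fin (n + 1)} (hi : A i 0 ≠ 0) :
    pivotExpansion F 0 A = pivotExpansion F i A := by
  induction i using Fin.cases with
  | zero => rfl
  | succ m => exact pivotExpansion_zero_eq_succ hF h0 hi

/-- The expansion does not depend on the pivot. -/
theorem pivotExpansion_eq (hF : IsRowDet F) {A : Matrix (Fin (n + 1)) (Fin (n + 1)) D}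
    {i j : Fin (n + 1)} (hi : A i 0 ≠ 0) (hj : A j 0 ≠ 0) :
    pivotExpansion F i A = pivotExpansion F j A := by
  by_cases h0 : A 0 0 = 0
  · have ne_zero : ∀ {k}, A k 0 ≠ 0 → 0 ≠ k := by
      rintro k hk rfl
      exact hk h0
    have hi' : addRow A 0 i 1 i 0 ≠ 0 := by rwa [addRow_of_ne _ (ne_zero hi).symm]
    have hj' : addRow A 0 i 1 j 0 ≠ 0 := by rwa [addRow_of_ne _ (ne_zero hj).symm]
    have h0' : addRow A 0 i 1 0 0 ≠ 0 := by simpa [addRow_self, h0] using hi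
    rw [← pivotExpansion_addRow hF hi (ne_zero hi) (ne_zero hi) 1,
      ← pivotExpansion_addRow hF hj (ne_zero hj) (ne_zero hi) 1,
      ← pivotExpansion_zero_eq hF h0' hi', ← pivotExpansion_zero_eq hF h0' hj']
  · rw [← pivotExpansion_zero_eq hF h0 hi, ← pivotExpansion_zero_eq hF h0 hj]

open Classical in
/-- The Dieudonné determinant, with value `0` on singular matrices. -/
noncomputable def dieudonneDet :
    (n : ℕ) → Matrix (Fin n) (Fin n) D → WithZero (Abelianization Dˣ)
  | 0, _ => 1
  | n + 1, A => if h : ∃ i, A i 0 ≠ 0 then pivotExpansion (dieudonneDet n) h.choose A else 0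

theorem dieudonneDet_succ_of_column_eq_zero {A : Matrix (Fin (n + 1)) (Fin (n + 1)) D}
    (h : ∀ i, A i 0 = 0) : dieudonneDet (n + 1) A = 0 := by
  rw [dieudonneDet, dif_neg]
  simpa using h

theorem dieudonneDet_succ_eq_pivotExpansion
    (hF : IsRowDet (dieudonneDet n : Matrix (Fin n) (Fin n) D → _))
    {A : Matrix (Fin (n + 1)) (Fin (n + 1)) D} {i : Fin (n + 1)} (hi : A i 0 ≠ 0) :
    dieudonneDet (n + 1) A = pivotExpansion (dieudonneDet n) i A := by
  have h : ∃ i, A i 0 ≠ 0 := ⟨i, hi⟩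
  rw [dieudonneDet, dif_pos h]
  exact pivotExpansion_eq hF h.choose_spec hi

theorem isRowDet_dieudonneDet (n : ℕ) :
    IsRowDet (dieudonneDet n : Matrix (Fin n) (Fin n) D → _) := by
  induction n with
  | zero => exact ⟨fun _ i => i.elim0, fun _ i => i.elim0⟩
  | succ n ih =>
    refine ⟨fun A l k c hlk => ?_, fun A l u hu => ?_⟩
    · by_cases hother : ∃ i, i ≠ l ∧ A i 0 ≠ 0
      · obtain ⟨i, hil, hi⟩ := hother
        have hi' : addRow A l k c i 0 ≠ 0 := by rwa [addRow_of_ne _ hil]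
        rw [dieudonneDet_succ_eq_pivotExpansion ih hi,
          dieudonneDet_succ_eq_pivotExpansion ih hi', pivotExpansion_addRow ih hi hil.symm hlk]
      · push Not at hother
        have hl : addRow A l k c l 0 = A l 0 := by simp [addRow_self, hother k hlk.symm]
        have hzero : ∀ i, i ≠ l → addRow A l k c i 0 = 0 := fun i hi => by
          rw [addRow_of_ne _ hi, hother i hi]
        by_cases hA : A l 0 = 0
        · rw [dieudonneDet_succ_of_column_eq_zero, dieudonneDet_succ_of_column_eq_zero]
          · intro i
            by_cases hi : i = l
            · rw [hi, hA]
            · exact hother i hi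
          · intro i
            by_cases hi : i = l
            · rw [hi, hl, hA]
            · exact hzero i hi
        · rw [dieudonneDet_succ_eq_pivotExpansion ih hA,
            dieudonneDet_succ_eq_pivotExpansion ih (hl.trans_ne hA), pivotExpansion,
            pivotExpansion, hl]
          congr 2
          funext m
          have hm := otherRow_ne l m
          rw [pivotComplement_row, pivotComplement_row, eliminate_of_zero _ (hzero _ hm),
            eliminate_of_zero _ (hother _ hm), addRow_of_ne _ hm]
    · by_cases hA : ∃ i, A i 0 ≠ 0
      · obtain ⟨i, hi⟩ := hA
        have hi' : scaleRow A l u i 0 ≠ 0 := by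
          rcases eq_or_ne i l with rfl | h
          · simp [scaleRow_self, hu, hi]
          · rwa [scaleRow_of_ne _ h]
        rw [dieudonneDet_succ_eq_pivotExpansion ih hi,
          dieudonneDet_succ_eq_pivotExpansion ih hi', pivotExpansion, pivotExpansion]
        rcases eq_or_ne l i with rfl | h
        · rw [pivotComplement_scaleRow_pivot _ hu, scaleRow_self, Pi.smul_apply, smul_eq_mul,
            map_mul]
          ac_rfl
        · obtain ⟨k, rfl⟩ := exists_otherRow_eq h
          rw [pivotComplement_scaleRow, scaleRow_of_ne _ h.symm, ih.scaleRow _ _ _ hu]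
          ac_rfl
      · push Not at hA
        rw [dieudonneDet_succ_of_column_eq_zero hA, mul_zero, dieudonneDet_succ_of_column_eq_zero]
        intro i
        rcases eq_or_ne i l with rfl | h
        · simp [scaleRow_self, hA]
        · rw [scaleRow_of_ne _ h, hA]

theorem dieudonneDet_one (n : ℕ) : dieudonneDet n (1 : Matrix (Fin n) (Fin n) D) = 1 := by
  induction n with
  | zero => rfl
  | succ n ih =>
    have h : pivotComplement 0 (1 : Matrix (Fin (n + 1)) (Fin (n + 1)) D) = 1 := by
      ext i j
      rw [pivotComplement_row, otherRow, Equiv.swap_self, Equiv.refl_apply,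
        eliminate_of_zero _ (one_apply_ne (Fin.succ_ne_zero i))]
      simp [one_apply]
    rw [dieudonneDet_succ_eq_pivotExpansion (isRowDet_dieudonneDet n) (i := 0) (by simp),
      pivotExpansion, h, ih]
    simp

theorem dieudonneDet_mul {A : Matrix (Fin n) (Fin n) D} (hA : IsUnit A)
    (B : Matrix (Fin n) (Fin n) D) :
    dieudonneDet n (A * B) = dieudonneDet n A * dieudonneDet n B := by
  have hF := isRowDet_dieudonneDet (D := D) n
  refine isUnit_row_induction
    (Q := fun A => dieudonneDet n (A * B) = dieudonneDet n A * dieudonneDet n B) ?_ ?_ ?_ hA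
  · rw [one_mul, dieudonneDet_one, one_mul]
  · intro A i j c h ih
    rw [addRow_mul, hF.addRow _ _ _ _ h, hF.addRow _ _ _ _ h, ih]
  · intro A i u hu ih
    rw [scaleRow_mul, hF.scaleRow _ _ _ hu, hF.scaleRow _ _ _ hu, ih, mul_assoc]

theorem dieudonneDet_ne_zero {A : Matrix (Fin n) (Fin n) D} (hA : IsUnit A) :
    dieudonneDet n A ≠ 0 := by
  obtain ⟨B, hB⟩ := hA.exists_right_inv
  have h := dieudonneDet_mul hA B
  rw [hB, dieudonneDet_one] at h
  exact left_ne_zero_of_mul (h.symm.trans_ne one_ne_zero)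

end DieudonneDeterminant

section Stabilization

variable {D : Type} [Ring D] {n : ℕ}

theorem stabMat_castSucc_castSucc (A : Matrix (Fin n) (Fin n) D) (i j : Fin n) :
    stabMat A i.castSucc j.castSucc = A i j := by
  simp [stabMat]

theorem stabMat_castSucc_last (A : Matrix (Fin n) (Fin n) D) (i : Fin n) :
    stabMat A i.castSucc (Fin.last n) = 0 := by
  simp [stabMat]

theorem stabMat_last_castSucc (A : Matrix (Fin n) (Fin n) D) (j : Fin n) :
    stabMat A (Fin.last n) j.castSucc = 0 := by
  simp [stabMat]

theorem stabMat_last_last (A : Matrix (Fin n) (Fin n) D) :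
    stabMat A (Fin.last n) (Fin.last n) = 1 := by
  simp [stabMat]

theorem stabMat_one : stabMat (1 : Matrix (Fin n) (Fin n) D) = 1 := by
  ext i j
  induction i using Fin.lastCases <;> induction j using Fin.lastCases <;>
    simp [stabMat_castSucc_castSucc, stabMat_castSucc_last, stabMat_last_castSucc,
      stabMat_last_last, one_apply, (Fin.castSucc_ne_last _).symm]

theorem stabMat_addRow (A : Matrix (Fin n) (Fin n) D) (i j : Fin n) (c : D) :
    stabMat (addRow A i j c) = addRow (stabMat A) i.castSucc j.castSucc c := by
  ext k l
  induction k using Fin.lastCases with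
  | last =>
    rw [addRow_of_ne _ (Fin.castSucc_ne_last i).symm]
    induction l using Fin.lastCases <;> simp [stabMat_last_castSucc, stabMat_last_last]
  | cast k =>
    rcases eq_or_ne k i with rfl | h
    · rw [addRow_self]
      induction l using Fin.lastCases <;>
        simp [stabMat_castSucc_castSucc, stabMat_castSucc_last, addRow_self]
    · rw [addRow_of_ne _ ((Fin.castSucc_injective n).ne h)]
      induction l using Fin.lastCases <;>
        simp [stabMat_castSucc_castSucc, stabMat_castSucc_last, addRow_of_ne _ h]

theorem stabMat_scaleRow (A : Matrix (Fin n) (Fin n) D) (i : Fin n) (u : D) :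
    stabMat (scaleRow A i u) = scaleRow (stabMat A) i.castSucc u := by
  ext k l
  induction k using Fin.lastCases with
  | last =>
    rw [scaleRow_of_ne _ (Fin.castSucc_ne_last i).symm]
    induction l using Fin.lastCases <;> simp [stabMat_last_castSucc, stabMat_last_last]
  | cast k =>
    rcases eq_or_ne k i with rfl | h
    · rw [scaleRow_self]
      induction l using Fin.lastCases <;>
        simp [stabMat_castSucc_castSucc, stabMat_castSucc_last, scaleRow_self]
    · rw [scaleRow_of_ne _ ((Fin.castSucc_injective n).ne h)]
      induction l using Fin.lastCases <;>
        simp [stabMat_castSucc_castSucc, stabMat_castSucc_last, scaleRow_of_ne _ h]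

theorem stabMat_mul (A B : Matrix (Fin n) (Fin n) D) :
    stabMat (A * B) = stabMat A * stabMat B := by
  ext i j
  rw [mul_apply, Fin.sum_univ_castSucc]
  induction i using Fin.lastCases <;> induction j using Fin.lastCases <;>
    simp [stabMat_castSucc_castSucc, stabMat_castSucc_last, stabMat_last_castSucc,
      stabMat_last_last, mul_apply]

theorem isUnit_stabMat_iff {A : Matrix (Fin n) (Fin n) D} : IsUnit (stabMat A) ↔ IsUnit A := by
  constructor
  · intro h
    obtain ⟨B, hAB, hBA⟩ := isUnit_iff_exists.mp h
    refine isUnit_iff_exists.mpr ⟨B.submatrix Fin.castSucc Fin.castSucc, ?_, ?_⟩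
    · ext i j
      have h := congrFun (congrFun hAB i.castSucc) j.castSucc
      rw [mul_apply, Fin.sum_univ_castSucc] at h
      simpa [stabMat_castSucc_castSucc, stabMat_castSucc_last, mul_apply, one_apply] using h
    · ext i j
      have h := congrFun (congrFun hBA i.castSucc) j.castSucc
      rw [mul_apply, Fin.sum_univ_castSucc] at h
      simpa [stabMat_castSucc_castSucc, stabMat_last_castSucc, mul_apply, one_apply] using h
  · intro h
    obtain ⟨B, hAB, hBA⟩ := isUnit_iff_exists.mp h
    exact isUnit_iff_exists.mpr ⟨stabMat B, by rw [← stabMat_mul, hAB, stabMat_one],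
      by rw [← stabMat_mul, hBA, stabMat_one]⟩

end Stabilization

section K1Classes

variable {D : Type} [Ring D] {n : ℕ}

/-- The quotient map onto `K₁`. -/
noncomputable def K1proj (D : Type) [Ring D] : FreeAbelianGroup (MatGen D) →+ K1 D :=
  QuotientAddGroup.mk' (K1Rel D)

theorem K1proj_of (A : Matrix (Fin n) (Fin n) D) :
    K1proj D (FreeAbelianGroup.of ⟨n, A⟩) = K1mk D A := rfl

theorem K1proj_eq_zero {x : FreeAbelianGroup (MatGen D)} (hx : x ∈ K1Rel D) : K1proj D x = 0 :=
  (QuotientAddGroup.eq_zero_iff x).mpr hx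

theorem K1mk_mul {A B : Matrix (Fin n) (Fin n) D} (hA : IsUnit A) (hB : IsUnit B) :
    K1mk D (A * B) = K1mk D A + K1mk D B := by
  have h := K1proj_eq_zero (D := D) (AddSubgroup.subset_closure
    (Or.inl (Or.inl ⟨n, A, B, hA, hB, rfl⟩)))
  rw [map_sub, map_sub, K1proj_of, K1proj_of, K1proj_of, sub_sub, sub_eq_zero] at h
  exact h

theorem K1mk_stabMat (A : Matrix (Fin n) (Fin n) D) : K1mk D (stabMat A) = K1mk D A := by
  have h := K1proj_eq_zero (D := D) (AddSubgroup.subset_closure (Or.inl (Or.inr ⟨n, A, rfl⟩)))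
  rwa [map_sub, K1proj_of, K1proj_of, sub_eq_zero] at h

theorem K1mk_of_not_isUnit {A : Matrix (Fin n) (Fin n) D} (hA : ¬ IsUnit A) : K1mk D A = 0 :=
  K1proj_eq_zero (AddSubgroup.subset_closure (Or.inr ⟨n, A, hA, rfl⟩))

theorem K1mk_one (n : ℕ) : K1mk D (1 : Matrix (Fin n) (Fin n) D) = 0 := by
  have h := K1mk_mul (D := D) (isUnit_one (M := Matrix (Fin n) (Fin n) D)) isUnit_one
  rwa [one_mul, left_eq_add] at h

/-- An elementary matrix is a commutator after one stabilization. -/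
theorem K1mk_addRow_one {i j : Fin n} (h : i ≠ j) (c : D) :
    K1mk D (addRow (1 : Matrix (Fin n) (Fin n) D) i j c) = 0 := by
  have hi : i.castSucc ≠ Fin.last n := Fin.castSucc_ne_last i
  have hj : Fin.last n ≠ j.castSucc := (Fin.castSucc_ne_last j).symm
  have hij : i.castSucc ≠ j.castSucc := (Fin.castSucc_injective n).ne h
  let E := addRow (1 : Matrix (Fin (n + 1)) (Fin (n + 1)) D) i.castSucc j.castSucc c
  let X := addRow (1 : Matrix (Fin (n + 1)) (Fin (n + 1)) D) i.castSucc (Fin.last n) c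
  let Y := addRow (1 : Matrix (Fin (n + 1)) (Fin (n + 1)) D) (Fin.last n) j.castSucc 1
  have hE : IsUnit E := isUnit_addRow_one hij c
  have hX : IsUnit X := isUnit_addRow_one hi c
  have hY : IsUnit Y := isUnit_addRow_one hj 1
  have key : X * Y = E * (Y * X) := by
    simp only [E, X, Y]
    rw [← addRow_eq_mul, ← addRow_eq_mul, ← addRow_eq_mul]
    funext k
    rcases eq_or_ne k i.castSucc with rfl | hk
    · rw [addRow_self, addRow_of_ne _ hi, addRow_self, addRow_self, addRow_of_ne _ hi,
        addRow_of_ne _ hj.symm, addRow_self, addRow_of_ne _ hij.symm, one_smul, smul_add]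
      abel
    · rw [addRow_of_ne _ hk, addRow_of_ne _ hk]
      rcases eq_or_ne k (Fin.last n) with rfl | hl
      · rw [addRow_self, addRow_self, addRow_of_ne _ hi.symm, addRow_of_ne _ hij.symm]
      · rw [addRow_of_ne _ hl, addRow_of_ne _ hl, addRow_of_ne _ hk]
  have h := congrArg (K1mk D) key
  rw [K1mk_mul hX hY, K1mk_mul hE (hY.mul hX), K1mk_mul hY hX, add_comm (K1mk D Y),
    right_eq_add] at h
  rwa [← K1mk_stabMat, stabMat_addRow, stabMat_one]

/-- The class of a diagonal matrix with a single nontrivial entry does not depend on the position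
of that entry. -/
theorem K1mk_scaleRow_one_eq (i j : Fin n) (u : Dˣ) :
    K1mk D (scaleRow (1 : Matrix (Fin n) (Fin n) D) i u) =
      K1mk D (scaleRow (1 : Matrix (Fin n) (Fin n) D) j u) := by
  let P := (1 : Matrix (Fin n) (Fin n) D).submatrix (Equiv.swap i j) id
  have hPP : P * P = 1 := by
    ext k l
    simp [P, mul_apply, one_apply, Equiv.swap_apply_eq_iff]
  have hP : IsUnit P := isUnit_iff_exists.mpr ⟨P, hPP, hPP⟩
  have key : scaleRow 1 i (u : D) * P = P * scaleRow 1 j (u : D) := by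
    rw [← scaleRow_eq_mul]
    ext k l
    rcases eq_or_ne k i with rfl | hk
    · rw [scaleRow_self]
      simp [P, mul_apply, one_apply, scaleRow_self]
    · rw [scaleRow_of_ne _ hk]
      have hk' : Equiv.swap i j k ≠ j := by
        rwa [Ne, Equiv.swap_apply_eq_iff, Equiv.swap_apply_right]
      simp [P, mul_apply, one_apply, scaleRow_of_ne _ hk']
  have h := congrArg (K1mk D) key
  rwa [K1mk_mul (isUnit_scaleRow_one i u) hP, K1mk_mul hP (isUnit_scaleRow_one j u),
    add_comm (K1mk D P), add_left_inj] at h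

theorem of_const_eq_scaleRow (u : D) :
    (of fun _ _ : Fin 1 => u) = scaleRow (1 : Matrix (Fin 1) (Fin 1) D) 0 u := by
  ext i j
  obtain rfl := Subsingleton.elim i 0
  obtain rfl := Subsingleton.elim j 0
  simp [scaleRow_self]

theorem K1mk_scaleRow_one (i : Fin n) (u : Dˣ) :
    K1mk D (scaleRow (1 : Matrix (Fin n) (Fin n) D) i u) =
      K1mk D (of fun _ _ : Fin 1 => (u : D)) := by
  induction n with
  | zero => exact i.elim0
  | succ n ih =>
    rw [K1mk_scaleRow_one_eq i 0]
    cases n with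
    | zero => rw [of_const_eq_scaleRow]
    | succ n =>
      rw [← ih 0, ← K1mk_stabMat (n := n + 1), stabMat_scaleRow, stabMat_one, Fin.castSucc_zero]

/-- The homomorphism `Dˣ/[Dˣ, Dˣ] → K₁(D)` given by `1 × 1` matrices. -/
noncomputable def K1ofUnits (D : Type) [Ring D] : Additive (Abelianization Dˣ) →+ K1 D :=
  MonoidHom.toAdditiveLeft (Abelianization.lift (MonoidHom.mk' (M := Dˣ) (G := Multiplicative (K1 D))
    (fun u => Multiplicative.ofAdd (K1mk D (of fun _ _ : Fin 1 => (u : D)))) (by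
      intro u v
      rw [← ofAdd_add, of_const_eq_scaleRow, of_const_eq_scaleRow, of_const_eq_scaleRow,
        ← K1mk_mul (isUnit_scaleRow_one 0 u) (isUnit_scaleRow_one 0 v), ← scaleRow_eq_mul,
        scaleRow_scaleRow, Units.val_mul])))

theorem K1ofUnits_of (u : Dˣ) :
    K1ofUnits D (Additive.ofMul (Abelianization.of u)) =
      K1mk D (of fun _ _ : Fin 1 => (u : D)) := rfl

end K1Classes

section Isomorphism

variable {D : Type} [DivisionRing D] {n : ℕ}

theorem dieudonneDet_stabMat {A : Matrix (Fin n) (Fin n) D} (hA : IsUnit A) :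
    dieudonneDet (n + 1) (stabMat A) = dieudonneDet n A := by
  have hF := isRowDet_dieudonneDet (D := D) n
  have hF' := isRowDet_dieudonneDet (D := D) (n + 1)
  refine isUnit_row_induction
    (Q := fun A => dieudonneDet (n + 1) (stabMat A) = dieudonneDet n A) ?_ ?_ ?_ hA
  · rw [stabMat_one, dieudonneDet_one, dieudonneDet_one]
  · intro A i j c h ih
    rw [stabMat_addRow, hF'.addRow _ _ _ _ ((Fin.castSucc_injective n).ne h),
      hF.addRow _ _ _ _ h, ih]
  · intro A i u hu ih
    rw [stabMat_scaleRow, hF'.scaleRow _ _ _ hu, hF.scaleRow _ _ _ hu, ih]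

open Classical in
/-- The Dieudonné determinant of an invertible matrix as an element of `Dˣ/[Dˣ, Dˣ]`, extended
by `1` to singular matrices. -/
noncomputable def dieudonneClass (A : Matrix (Fin n) (Fin n) D) : Abelianization Dˣ :=
  if h : IsUnit A then WithZero.unzero (dieudonneDet_ne_zero h) else 1

theorem coe_dieudonneClass {A : Matrix (Fin n) (Fin n) D} (hA : IsUnit A) :
    (dieudonneClass A : WithZero (Abelianization Dˣ)) = dieudonneDet n A := by
  rw [dieudonneClass, dif_pos hA, WithZero.coe_unzero]

theorem dieudonneClass_of_not_isUnit {A : Matrix (Fin n) (Fin n) D} (hA : ¬ IsUnit A) :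
    dieudonneClass A = 1 := by
  rw [dieudonneClass, dif_neg hA]

theorem dieudonneClass_one : dieudonneClass (1 : Matrix (Fin n) (Fin n) D) = 1 := by
  rw [← WithZero.coe_inj, coe_dieudonneClass isUnit_one, dieudonneDet_one, WithZero.coe_one]

theorem dieudonneClass_mul {A B : Matrix (Fin n) (Fin n) D} (hA : IsUnit A) (hB : IsUnit B) :
    dieudonneClass (A * B) = dieudonneClass A * dieudonneClass B := by
  rw [← WithZero.coe_inj, WithZero.coe_mul, coe_dieudonneClass hA, coe_dieudonneClass hB,
    coe_dieudonneClass (hA.mul hB), dieudonneDet_mul hA]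

theorem dieudonneClass_stabMat (A : Matrix (Fin n) (Fin n) D) :
    dieudonneClass (stabMat A) = dieudonneClass A := by
  by_cases hA : IsUnit A
  · rw [← WithZero.coe_inj, coe_dieudonneClass hA, coe_dieudonneClass (isUnit_stabMat_iff.mpr hA),
      dieudonneDet_stabMat hA]
  · rw [dieudonneClass_of_not_isUnit hA,
      dieudonneClass_of_not_isUnit (isUnit_stabMat_iff.not.mpr hA)]

theorem dieudonneClass_addRow_one {i j : Fin n} (h : i ≠ j) (c : D) :
    dieudonneClass (addRow (1 : Matrix (Fin n) (Fin n) D) i j c) = 1 := by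
  rw [← WithZero.coe_inj, coe_dieudonneClass (isUnit_addRow_one h c),
    (isRowDet_dieudonneDet n).addRow _ _ _ _ h, dieudonneDet_one, WithZero.coe_one]

theorem dieudonneClass_scaleRow_one (i : Fin n) (u : Dˣ) :
    dieudonneClass (scaleRow (1 : Matrix (Fin n) (Fin n) D) i u) = Abelianization.of u := by
  rw [← WithZero.coe_inj, coe_dieudonneClass (isUnit_scaleRow_one i u),
    (isRowDet_dieudonneDet n).scaleRow _ _ _ u.ne_zero, dieudonneDet_one, mul_one, unitClass_coe]

/-- The Dieudonné determinant on the free abelian group of all square matrices. -/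
noncomputable def freeDet (D : Type) [DivisionRing D] :
    FreeAbelianGroup (MatGen D) →+ Additive (Abelianization Dˣ) :=
  FreeAbelianGroup.lift fun X => Additive.ofMul (dieudonneClass X.2)

theorem freeDet_of (A : Matrix (Fin n) (Fin n) D) :
    freeDet D (FreeAbelianGroup.of ⟨n, A⟩) = Additive.ofMul (dieudonneClass A) :=
  FreeAbelianGroup.lift_apply_of _ _

theorem K1Rel_le_ker_freeDet (D : Type) [DivisionRing D] : K1Rel D ≤ (freeDet D).ker := by
  refine (AddSubgroup.closure_le _).mpr ?_
  rintro x ((⟨n, A, B, hA, hB, rfl⟩ | ⟨n, A, rfl⟩) | ⟨n, A, hA, rfl⟩) <;>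
    rw [SetLike.mem_coe, AddMonoidHom.mem_ker]
  · rw [map_sub, map_sub, freeDet_of, freeDet_of, freeDet_of, dieudonneClass_mul hA hB, ofMul_mul,
      add_sub_cancel_left, sub_self]
  · rw [map_sub, freeDet_of, freeDet_of, dieudonneClass_stabMat, sub_self]
  · rw [freeDet_of, dieudonneClass_of_not_isUnit hA, ofMul_one]

/-- The homomorphism `K₁(D) → Dˣ/[Dˣ, Dˣ]` induced by the Dieudonné determinant. -/
noncomputable def K1det (D : Type) [DivisionRing D] : K1 D →+ Additive (Abelianization Dˣ) :=
  QuotientAddGroup.lift (K1Rel D) (freeDet D) (K1Rel_le_ker_freeDet D)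

theorem K1det_K1mk (A : Matrix (Fin n) (Fin n) D) :
    K1det D (K1mk D A) = Additive.ofMul (dieudonneClass A) :=
  freeDet_of A

theorem K1det_K1ofUnits (x : Additive (Abelianization Dˣ)) : K1det D (K1ofUnits D x) = x := by
  obtain ⟨u, hu⟩ := QuotientGroup.mk_surjective x.toMul
  obtain rfl : Additive.ofMul (Abelianization.of u) = x := congrArg Additive.ofMul hu
  rw [K1ofUnits_of, K1det_K1mk, of_const_eq_scaleRow, dieudonneClass_scaleRow_one]

theorem K1ofUnits_dieudonneClass (A : Matrix (Fin n) (Fin n) D) :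
    K1ofUnits D (Additive.ofMul (dieudonneClass A)) = K1mk D A := by
  by_cases hA : IsUnit A
  · refine (isUnit_row_induction (Q := fun A => IsUnit A ∧
      K1ofUnits D (Additive.ofMul (dieudonneClass A)) = K1mk D A) ?_ ?_ ?_ hA).2
    · exact ⟨isUnit_one, by rw [dieudonneClass_one, ofMul_one, map_zero, K1mk_one]⟩
    · rintro A i j c h ⟨hA, ih⟩
      have hE := isUnit_addRow_one h c
      refine ⟨(isUnit_addRow_iff h c).mpr hA, ?_⟩
      rw [addRow_eq_mul, dieudonneClass_mul hE hA, K1mk_mul hE hA, dieudonneClass_addRow_one h,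
        K1mk_addRow_one h, one_mul, zero_add, ih]
    · rintro A i u hu ⟨hA, ih⟩
      lift u to Dˣ using hu.isUnit
      have hS := isUnit_scaleRow_one i u
      refine ⟨(isUnit_scaleRow_iff i hu).mpr hA, ?_⟩
      rw [scaleRow_eq_mul, dieudonneClass_mul hS hA, K1mk_mul hS hA, dieudonneClass_scaleRow_one,
        K1mk_scaleRow_one, ofMul_mul, map_add, K1ofUnits_of, ih]
  · rw [dieudonneClass_of_not_isUnit hA, K1mk_of_not_isUnit hA, ofMul_one, map_zero]

theorem K1ofUnits_K1det (x : K1 D) : K1ofUnits D (K1det D x) = x := by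
  obtain ⟨y, rfl⟩ : ∃ y, K1proj D y = x := QuotientAddGroup.mk'_surjective _ x
  suffices h : ((K1ofUnits D).comp (K1det D)).comp (K1proj D) = K1proj D from
    DFunLike.congr_fun h y
  refine FreeAbelianGroup.lift_ext _ _ fun X => ?_
  obtain ⟨n, A⟩ := X
  rw [AddMonoidHom.comp_apply, AddMonoidHom.comp_apply, K1proj_of, K1det_K1mk,
    K1ofUnits_dieudonneClass]

end Isomorphism

/-- for a division ring `D`, the Dieudonné determinant induces an
isomorphism `K₁(D) ≅ D^×/[D^×,D^×]` whose inverse sends the class of a unit `u` to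
the class of the `1×1` matrix `(u)`. -/
theorem stmt12 (D : Type) [DivisionRing D] :
    ∃ φ : K1 D ≃+ Additive (Abelianization Dˣ),
      ∀ u : Dˣ,
        φ.symm (Additive.ofMul (Abelianization.of u)) =
          K1mk D (Matrix.of fun (_ _ : Fin 1) => (u : D)) :=
  ⟨AddEquiv.mk' ⟨K1det D, K1ofUnits D, K1ofUnits_K1det, K1det_K1ofUnits⟩ (map_add (K1det D)),
    K1ofUnits_of⟩
end

section
/- Let R be a ring and Σ a saturated set of endomorphisms of finitely generated projective R-modules such that the canonical map i : R → R_Σ into the universal localization is injective. Then the homomorphism α : K₁(R, Σ) → K₁(R_Σ), [f : P → P] ↦ [id_{R_Σ} ⊗_R f], is bijective. -/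
/- ## Universal localization at a set of endomorphisms of finitely generated
projective modules -/

/-- A bundled endomorphism of a finitely generated projective left `R`-module. -/
structure REnd (R : Type) [Ring R] : Type 1 where
  P : Type
  [acg : AddCommGroup P]
  [mod : Module R P]
  f : P →ₗ[R] P
  fin : Module.Finite R P
  proj : Module.Projective R P

attribute [instance] REnd.acg REnd.mod

/-- A ring homomorphism `j : R →+* S` inverts `σ` if `id_S ⊗_R σ.f` is an
isomorphism; via the hom-tensor adjunction this is expressed by saying that
precomposition with `σ.f` is bijective on `R`-linear maps into every `S`-module
(restricted to `R` along `j`). -/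
def Inverts {R : Type} [Ring R] {S : Type} [Ring S] (j : R →+* S) (σ : REnd R) :
    Prop :=
  ∀ (M : Type) [AddCommGroup M] [Module S M],
    letI : Module R M := Module.compHom M j
    Function.Bijective fun φ : σ.P →ₗ[R] M => φ.comp σ.f

/-- `j` is `Σ`-inverting. -/
def SigInverting {R : Type} [Ring R] (Sig : Set (REnd R)) {S : Type} [Ring S]
    (j : R →+* S) : Prop :=
  ∀ σ ∈ Sig, Inverts j σ

/-- `i : R →+* L` is the universal localization of `R` at `Σ`. -/
def IsUniversalLocalization {R : Type} [Ring R] (Sig : Set (REnd R)) {L : Type}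
    [Ring L] (i : R →+* L) : Prop :=
  SigInverting Sig i ∧
    ∀ (S : Type) [Ring S] (j : R →+* S), SigInverting Sig j →
      ∃! k : L →+* S, k.comp i = j

/-- `Σ` is saturated (with respect to its universal localization `i`): it contains
every endomorphism of a finitely generated projective module which becomes
invertible over `R_Σ`. -/
def Saturated {R : Type} [Ring R] (Sig : Set (REnd R)) {L : Type} [Ring L]
    (i : R →+* L) : Prop :=
  ∀ σ : REnd R, Inverts i σ → σ ∈ Sig

/- ## `K₁(R, Σ)` -/

/-- Data for the composition relation `[g ∘ f] = [g] + [f]` in `K₁(R,Σ)`. -/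
structure CompD {R L : Type} [Ring R] [Ring L] (i : R →+* L) : Type 1 where
  P : Type
  [acg : AddCommGroup P]
  [mod : Module R P]
  f : P →ₗ[R] P
  g : P →ₗ[R] P
  fin : Module.Finite R P
  proj : Module.Projective R P
  invf : Inverts i ⟨P, f, fin, proj⟩
  invg : Inverts i ⟨P, g, fin, proj⟩
  invgf : Inverts i ⟨P, g.comp f, fin, proj⟩

attribute [instance] CompD.acg CompD.mod

/-- The composition relation. -/
def CompD.rel {R L : Type} [Ring R] [Ring L] {i : R →+* L} (d : CompD i) :
    FreeAbelianGroup {σ : REnd R // Inverts i σ} :=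
  FreeAbelianGroup.of ⟨⟨d.P, d.g.comp d.f, d.fin, d.proj⟩, d.invgf⟩
    - FreeAbelianGroup.of ⟨⟨d.P, d.g, d.fin, d.proj⟩, d.invg⟩
    - FreeAbelianGroup.of ⟨⟨d.P, d.f, d.fin, d.proj⟩, d.invf⟩

/-- Data for the additivity relation over a short exact sequence. -/
structure SESD {R L : Type} [Ring R] [Ring L] (i : R →+* L) : Type 1 where
  P0 : Type
  P1 : Type
  P2 : Type
  [acg0 : AddCommGroup P0]
  [acg1 : AddCommGroup P1]
  [acg2 : AddCommGroup P2]
  [mod0 : Module R P0]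
  [mod1 : Module R P1]
  [mod2 : Module R P2]
  ι : P0 →ₗ[R] P1
  p : P1 →ₗ[R] P2
  inj : Function.Injective ι
  surj : Function.Surjective p
  exact : LinearMap.range ι = LinearMap.ker p
  f0 : P0 →ₗ[R] P0
  f1 : P1 →ₗ[R] P1
  f2 : P2 →ₗ[R] P2
  comm₀ : f1.comp ι = ι.comp f0
  comm₁ : f2.comp p = p.comp f1
  fin0 : Module.Finite R P0
  fin1 : Module.Finite R P1
  fin2 : Module.Finite R P2
  proj0 : Module.Projective R P0
  proj1 : Module.Projective R P1
  proj2 : Module.Projective R P2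
  inv0 : Inverts i ⟨P0, f0, fin0, proj0⟩
  inv1 : Inverts i ⟨P1, f1, fin1, proj1⟩
  inv2 : Inverts i ⟨P2, f2, fin2, proj2⟩

attribute [instance] SESD.acg0 SESD.acg1 SESD.acg2 SESD.mod0 SESD.mod1 SESD.mod2

/-- The additivity relation. -/
def SESD.rel {R L : Type} [Ring R] [Ring L] {i : R →+* L} (d : SESD i) :
    FreeAbelianGroup {σ : REnd R // Inverts i σ} :=
  FreeAbelianGroup.of ⟨⟨d.P1, d.f1, d.fin1, d.proj1⟩, d.inv1⟩
    - FreeAbelianGroup.of ⟨⟨d.P0, d.f0, d.fin0, d.proj0⟩, d.inv0⟩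
    - FreeAbelianGroup.of ⟨⟨d.P2, d.f2, d.fin2, d.proj2⟩, d.inv2⟩

/-- The relation subgroup of `K₁(R,Σ)`. -/
def K1SRel {R L : Type} [Ring R] [Ring L] (i : R →+* L) :
    AddSubgroup (FreeAbelianGroup {σ : REnd R // Inverts i σ}) :=
  AddSubgroup.closure
    (Set.range (CompD.rel (i := i)) ∪ Set.range (SESD.rel (i := i)))

/-- `K₁(R,Σ)`: generated by endomorphisms `f` of finitely generated projective
`R`-modules with `id_{R_Σ} ⊗ f` bijective, modulo composition and additivity. -/
def K1S {R L : Type} [Ring R] [Ring L] (i : R →+* L) : Type 1 :=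
  FreeAbelianGroup {σ : REnd R // Inverts i σ} ⧸ K1SRel i

noncomputable instance {R L : Type} [Ring R] [Ring L] (i : R →+* L) :
    AddCommGroup (K1S i) := by
  unfold K1S; infer_instance

/-- The endomorphism of the free left module `Rⁿ` given by right multiplication
with a matrix `A`. -/
def matEndo {R : Type} [Ring R] {n : ℕ} (A : Matrix (Fin n) (Fin n) R) :
    (Fin n → R) →ₗ[R] (Fin n → R) where
  toFun v := fun j => ∑ i, v i * A i j
  map_add' x y := by
    funext j
    simp [add_mul, Finset.sum_add_distrib]
  map_smul' r v := by
    funext j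
    simp [Finset.mul_sum, mul_assoc]

/-- The bundled endomorphism of `Rⁿ` given by a matrix. -/
def matREnd {R : Type} [Ring R] {n : ℕ} (A : Matrix (Fin n) (Fin n) R) : REnd R :=
  ⟨Fin n → R, matEndo A, inferInstance, inferInstance⟩

/- ## Block matrices -/

section Blocks

open Matrix

variable {R : Type*} [Ring R] {ι μ ν : Type*} [Fintype ι] [Fintype μ] [Fintype ν]
  [DecidableEq ι] [DecidableEq μ] [DecidableEq ν]

theorem isUnit_fromBlocks_one_zero_zero_iff (C : Matrix μ μ R) :
    IsUnit (fromBlocks (1 : Matrix ι ι R) 0 0 C) ↔ IsUnit C := by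
  constructor
  · rintro ⟨⟨U, W, hUW, hWU⟩, rfl : U = _⟩
    rw [← fromBlocks_toBlocks W, fromBlocks_multiply, ← fromBlocks_one, fromBlocks_inj] at hUW hWU
    exact ⟨⟨C, W.toBlocks₂₂, by simpa using hUW.2.2.2, by simpa using hWU.2.2.2⟩, rfl⟩
  · rintro ⟨⟨U, W, hUW, hWU⟩, rfl⟩
    exact ⟨⟨fromBlocks 1 0 0 U, fromBlocks 1 0 0 W, by simp [fromBlocks_multiply, hUW],
      by simp [fromBlocks_multiply, hWU]⟩, rfl⟩

theorem isUnit_submatrix_equiv_iff_of_ring (A : Matrix ι ι R) (e : μ ≃ ι) :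
    IsUnit (A.submatrix e e) ↔ IsUnit A := by
  have h := MulEquiv.isUnit_map (reindexRingEquiv R e.symm) (x := A)
  simpa using h

theorem isUnit_fromBlocks_zero_zero_one_iff (A : Matrix ι ι R) :
    IsUnit (fromBlocks A 0 0 (1 : Matrix μ μ R)) ↔ IsUnit A := by
  rw [← isUnit_submatrix_equiv_iff_of_ring _ (Equiv.sumComm μ ι)]
  simpa using isUnit_fromBlocks_one_zero_zero_iff (ι := μ) A

theorem isUnit_fromBlocks_one_left (B : Matrix ι μ R) (C : Matrix μ μ R) :
    IsUnit (fromBlocks (1 : Matrix ι ι R) B 0 C) ↔ IsUnit C := by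
  have hB : IsUnit (fromBlocks (1 : Matrix ι ι R) B 0 (1 : Matrix μ μ R)) :=
    ⟨⟨fromBlocks 1 B 0 1, fromBlocks 1 (-B) 0 1, by simp [fromBlocks_multiply],
      by simp [fromBlocks_multiply]⟩, rfl⟩
  rw [← isUnit_fromBlocks_one_zero_zero_iff (ι := ι) C,
    show fromBlocks (1 : Matrix ι ι R) B 0 C =
      fromBlocks (1 : Matrix ι ι R) 0 0 C * fromBlocks 1 B 0 1 by
      simp [fromBlocks_multiply]]
  exact hB.unit.isUnit_mul_units _

theorem isUnit_fromBlocks_one_right (A : Matrix ι ι R) (B : Matrix ι μ R) :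
    IsUnit (fromBlocks A B 0 (1 : Matrix μ μ R)) ↔ IsUnit A := by
  have hB : IsUnit (fromBlocks (1 : Matrix ι ι R) B 0 (1 : Matrix μ μ R)) :=
    (isUnit_fromBlocks_one_left B 1).2 isUnit_one
  rw [← isUnit_fromBlocks_zero_zero_one_iff (μ := μ) A,
    show fromBlocks A B 0 (1 : Matrix μ μ R) =
      fromBlocks 1 B 0 (1 : Matrix μ μ R) * fromBlocks A 0 0 1 by
      simp [fromBlocks_multiply]]
  exact hB.unit.isUnit_units_mul _

theorem isUnit_fromBlocks_upper_iff_right {A : Matrix ι ι R} (hA : IsUnit A) (B : Matrix ι μ R)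
    (C : Matrix μ μ R) : IsUnit (fromBlocks A B 0 C) ↔ IsUnit C := by
  rw [← isUnit_fromBlocks_one_zero_zero_iff (ι := ι) C,
    show fromBlocks A B 0 C = fromBlocks 1 0 0 C * fromBlocks A B 0 1 by
      simp [fromBlocks_multiply]]
  exact ((isUnit_fromBlocks_one_right A B).2 hA).unit.isUnit_mul_units _

theorem isUnit_fromBlocks_upper_iff_left (A : Matrix ι ι R) (B : Matrix ι μ R)
    {C : Matrix μ μ R} (hC : IsUnit C) : IsUnit (fromBlocks A B 0 C) ↔ IsUnit A := by
  rw [← isUnit_fromBlocks_zero_zero_one_iff (μ := μ) A,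
    show fromBlocks A B 0 C = fromBlocks 1 B 0 C * fromBlocks A 0 0 1 by
      simp [fromBlocks_multiply]]
  exact ((isUnit_fromBlocks_one_left B C).2 hC).unit.isUnit_units_mul _

end Blocks

/- ## Endomorphisms inverted by a ring homomorphism -/

section Inverting

open Matrix

variable {R S : Type} [Ring R] [Ring S]

/-- The bundled endomorphism of `R^ι` given by right multiplication with a matrix. -/
def vecMulREnd {ι : Type} [Fintype ι] (A : Matrix ι ι R) : REnd R :=
  ⟨ι → R, A.vecMulLinear, inferInstance, inferInstance⟩

theorem matREnd_eq_vecMulREnd {n : ℕ} (A : Matrix (Fin n) (Fin n) R) :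
    matREnd A = vecMulREnd A := by
  have h : matEndo A = A.vecMulLinear := by
    ext v j
    simp [matEndo, Matrix.vecMul, dotProduct]
  simp only [matREnd, vecMulREnd, h]

theorem inverts_vecMulREnd_iff {ι : Type} [Fintype ι] [DecidableEq ι] (j : R →+* S)
    (A : Matrix ι ι R) : Inverts j (vecMulREnd A) ↔ IsUnit (A.map j) := by
  constructor
  · intro h
    have hb := h S
    let _ : Module R S := Module.compHom S j
    have hsmul : ∀ (r : R) (s : S), r • s = j r * s := fun _ _ => rfl
    have key : ∀ (φ : (ι → R) →ₗ[R] S), (fun a => (φ ∘ₗ A.vecMulLinear) (Pi.single a 1)) =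
        A.map j *ᵥ fun b => φ (Pi.single b 1) := by
      intro φ
      funext a
      have : A.vecMulLinear (Pi.single a 1) = ∑ b, A a b • (Pi.single b 1 : ι → R) := by
        ext c
        simp [Finset.sum_apply, Pi.single_apply]
      rw [LinearMap.comp_apply, this]
      simp [mulVec, dotProduct, hsmul]
    have ext' : ∀ φ ψ : (ι → R) →ₗ[R] S,
        (∀ b, φ (Pi.single b 1) = ψ (Pi.single b 1)) → φ = ψ := by
      intro φ ψ h
      apply LinearMap.pi_ext'
      intro b
      ext
      simpa using h b
    have mk : ∀ c : ι → S, ∃ φ : (ι → R) →ₗ[R] S, (fun b => φ (Pi.single b 1)) = c := by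
      intro c
      refine ⟨Fintype.linearCombination R c, ?_⟩
      funext b
      simp [Fintype.linearCombination_apply_single, hsmul]
    have hinj : Function.Injective fun c => A.map j *ᵥ c := by
      intro c d hcd
      obtain ⟨φ, rfl⟩ := mk c
      obtain ⟨ψ, rfl⟩ := mk d
      simp only [← key] at hcd
      have := hb.1 (ext' (φ ∘ₗ A.vecMulLinear) (ψ ∘ₗ A.vecMulLinear) (congrFun hcd))
      rw [this]
    have hsurj : ∀ d, ∃ c, A.map j *ᵥ c = d := by
      intro d
      obtain ⟨ψ, rfl⟩ := mk d
      obtain ⟨φ, hφ⟩ := hb.2 ψ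
      exact ⟨_, (key φ).symm.trans (by rw [← hφ]; rfl)⟩
    choose c hc using hsurj
    have h1 : A.map j * (Matrix.of fun a b => c (Pi.single b 1) a) = 1 := by
      ext a b
      have := congrFun (hc (Pi.single b 1)) a
      simpa [Matrix.mul_apply, mulVec, dotProduct, Matrix.one_apply, Pi.single_apply] using this
    refine ⟨⟨A.map j, _, h1, ?_⟩, rfl⟩
    have hm : ∀ B C : Matrix ι ι S, A.map j * B = A.map j * C → B = C := by
      intro B C hBC
      ext a b
      have : (fun x => B x b) = fun x => C x b := hinj (by
        funext x
        exact congrFun (congrFun hBC x) b)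
      exact congrFun this a
    apply hm
    rw [← Matrix.mul_assoc, h1, one_mul, mul_one]
  · rintro ⟨⟨U, W, hUW, hWU⟩, hU : U = _⟩ M _ _
    subst hU
    let _ : Module R M := Module.compHom M j
    have hsmul : ∀ (r : R) (m : M), r • m = j r • m := fun _ _ => rfl
    have ext' : ∀ φ ψ : (ι → R) →ₗ[R] M,
        (∀ b, φ (Pi.single b 1) = ψ (Pi.single b 1)) → φ = ψ := by
      intro φ ψ h
      apply LinearMap.pi_ext'
      intro b
      ext
      simpa using h b
    have key : ∀ (φ : (ι → R) →ₗ[R] M) (a : ι), (φ ∘ₗ A.vecMulLinear) (Pi.single a 1) =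
        ∑ b, j (A a b) • φ (Pi.single b 1) := by
      intro φ a
      have : A.vecMulLinear (Pi.single a 1) = ∑ b, A a b • (Pi.single b 1 : ι → R) := by
        ext c
        simp [Finset.sum_apply, Pi.single_apply]
      rw [LinearMap.comp_apply, this]
      simp [hsmul]
    have hcomp : ∀ (X Y : Matrix ι ι S) (c : ι → M) (a : ι),
        ∑ b, X a b • ∑ d, Y b d • c d = ∑ d, (X * Y) a d • c d := by
      intro X Y c a
      simp only [Finset.smul_sum, smul_smul, Matrix.mul_apply, Finset.sum_smul]
      exact Finset.sum_comm
    change Function.Bijective fun φ : (ι → R) →ₗ[R] M => φ ∘ₗ A.vecMulLinear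
    constructor
    · intro φ ψ h
      apply ext'
      intro b
      have h2 : ∀ a, ∑ b, j (A a b) • φ (Pi.single b 1) = ∑ b, j (A a b) • ψ (Pi.single b 1) :=
        fun a => by
          rw [← key, ← key]
          exact congrArg (fun χ : (ι → R) →ₗ[R] M => χ (Pi.single a 1)) h
      have h3 := hcomp W (A.map j) (fun b => φ (Pi.single b 1)) b
      have h4 := hcomp W (A.map j) (fun b => ψ (Pi.single b 1)) b
      simp only [map_apply, h2] at h3 h4
      rw [h3, hWU] at h4
      simpa [Matrix.one_apply, ite_smul] using h4
    · intro ψ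
      refine ⟨Fintype.linearCombination R fun b => ∑ d, W b d • ψ (Pi.single d 1), ?_⟩
      apply ext'
      intro a
      refine (key _ a).trans ?_
      simp only [Fintype.linearCombination_apply_single, one_smul]
      have := hcomp (A.map j) W (fun b => ψ (Pi.single b 1)) a
      rw [hUW] at this
      simpa [Matrix.one_apply, ite_smul] using this

/-- The extension by the identity of an endomorphism of a retract of `Q`. -/
def retractExtend {P Q : Type*} [AddCommGroup P] [Module R P] [AddCommGroup Q] [Module R Q]
    (s : P →ₗ[R] Q) (r : Q →ₗ[R] P) (f : P →ₗ[R] P) : Q →ₗ[R] Q :=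
  s ∘ₗ f ∘ₗ r + (LinearMap.id - s ∘ₗ r)

theorem inverts_retractExtend_iff {P Q : Type} [AddCommGroup P] [Module R P] [AddCommGroup Q]
    [Module R Q] (j : R →+* S) (s : P →ₗ[R] Q) (r : Q →ₗ[R] P) (hrs : ∀ x, r (s x) = x)
    (f : P →ₗ[R] P) (h1 h2 h3 h4) :
    Inverts j ⟨Q, retractExtend s r f, h1, h2⟩ ↔ Inverts j ⟨P, f, h3, h4⟩ := by
  unfold Inverts
  refine forall_congr' fun M => forall_congr' fun _ => forall_congr' fun _ => ?_
  let _ : Module R M := Module.compHom M j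
  change Function.Bijective (fun φ : Q →ₗ[R] M => φ ∘ₗ retractExtend s r f) ↔
    Function.Bijective (fun φ : P →ₗ[R] M => φ ∘ₗ f)
  constructor
  · rintro ⟨hi, hs⟩
    refine ⟨fun φ ψ h => ?_, fun χ => ?_⟩
    · have : φ ∘ₗ r = ψ ∘ₗ r := hi (by
        ext x
        simpa [retractExtend, hrs] using LinearMap.congr_fun h (r x))
      ext x
      simpa [hrs] using LinearMap.congr_fun this (s x)
    · obtain ⟨φ, hφ⟩ := hs (χ ∘ₗ r)
      refine ⟨φ ∘ₗ s, ?_⟩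
      ext x
      simpa [retractExtend, hrs] using LinearMap.congr_fun hφ (s x)
  · rintro ⟨hi, hs⟩
    refine ⟨fun φ ψ h => ?_, fun ψ => ?_⟩
    · have h' : φ ∘ₗ s = ψ ∘ₗ s := hi (by
        ext x
        simpa [retractExtend, hrs] using LinearMap.congr_fun h (s x))
      have hx : ∀ y, φ (s y) = ψ (s y) := LinearMap.congr_fun h'
      ext x
      simpa [retractExtend, hx] using LinearMap.congr_fun h x
    · obtain ⟨χ, hχ⟩ := hs (ψ ∘ₗ s)
      have hx : ∀ y, χ (f y) = ψ (s y) := LinearMap.congr_fun hχ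
      refine ⟨χ ∘ₗ r + ψ ∘ₗ (LinearMap.id - s ∘ₗ r), ?_⟩
      ext x
      simp [retractExtend, hrs, hx]

theorem REnd.exists_retract (σ : REnd R) : ∃ (n : ℕ) (s : σ.P →ₗ[R] (Fin n → R))
    (r : (Fin n → R) →ₗ[R] σ.P), ∀ x, r (s x) = x := by
  have := σ.fin
  have := σ.proj
  obtain ⟨n, r, hr⟩ := Module.Finite.exists_fin' R σ.P
  obtain ⟨s, hs⟩ := Module.projective_lifting_property r LinearMap.id hr
  exact ⟨n, s, r, LinearMap.congr_fun hs⟩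

/-- The matrix of the extension by the identity of an endomorphism of a retract of `R^ι`. -/
noncomputable def retractMatrix {P : Type} [AddCommGroup P] [Module R P] {ι : Type} [Fintype ι]
    [DecidableEq ι] (s : P →ₗ[R] (ι → R)) (r : (ι → R) →ₗ[R] P) (f : P →ₗ[R] P) :
    Matrix ι ι R :=
  (retractExtend s r f).toMatrixRight'

theorem vecMulLinear_toMatrixRight' {ι μ : Type} [Fintype ι] [DecidableEq ι]
    (g : (ι → R) →ₗ[R] (μ → R)) : g.toMatrixRight'.vecMulLinear = g :=
  LinearMap.toMatrixRight'.symm_apply_apply g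

theorem vecMulREnd_retractMatrix {P : Type} [AddCommGroup P] [Module R P] {ι : Type}
    [Fintype ι] [DecidableEq ι] (s : P →ₗ[R] (ι → R)) (r : (ι → R) →ₗ[R] P) (f : P →ₗ[R] P) :
    vecMulREnd (retractMatrix s r f) =
      ⟨ι → R, retractExtend s r f, inferInstance, inferInstance⟩ := by
  simp only [vecMulREnd, retractMatrix, vecMulLinear_toMatrixRight']

theorem isUnit_retractMatrix_iff {P : Type} [AddCommGroup P] [Module R P] {ι : Type}
    [Fintype ι] [DecidableEq ι] (j : R →+* S) (s : P →ₗ[R] (ι → R)) (r : (ι → R) →ₗ[R] P)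
    (hrs : ∀ x, r (s x) = x) (f : P →ₗ[R] P) (h1 h2) :
    IsUnit ((retractMatrix s r f).map j) ↔ Inverts j ⟨P, f, h1, h2⟩ := by
  rw [← inverts_vecMulREnd_iff, vecMulREnd_retractMatrix, inverts_retractExtend_iff j s r hrs]

theorem SigInverting.of_isUnit {S' : Type} [Ring S'] {Sig : Set (REnd R)} {i : R →+* S}
    {j : R →+* S'} (hi : SigInverting Sig i)
    (h : ∀ (n : ℕ) (A : Matrix (Fin n) (Fin n) R), IsUnit (A.map i) → IsUnit (A.map j)) :
    SigInverting Sig j := by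
  intro σ hσ
  obtain ⟨n, s, r, hrs⟩ := σ.exists_retract
  exact (isUnit_retractMatrix_iff j s r hrs σ.f σ.fin σ.proj).1
    (h n _ ((isUnit_retractMatrix_iff i s r hrs σ.f σ.fin σ.proj).2 (hi σ hσ)))

end Inverting

/- ## Determinant-like functions on square matrices over a ring -/

open Matrix in
/-- A function on square matrices of all sizes with values in a commutative group with zero,
which is multiplicative and additive on block triangular matrices as soon as one of the two
factors has a nonzero value. -/
structure DetLike (R : Type) [Ring R] (Γ : Type*) [CommGroupWithZero Γ] where
  val : ∀ {ι : Type} [Fintype ι], Matrix ι ι R → Γ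
  val_one : ∀ {ι : Type} [Fintype ι] [DecidableEq ι], val (1 : Matrix ι ι R) = 1
  val_mul_left : ∀ {ι : Type} [Fintype ι] (A B : Matrix ι ι R),
    val A ≠ 0 → val (A * B) = val A * val B
  val_mul_right : ∀ {ι : Type} [Fintype ι] (A B : Matrix ι ι R),
    val B ≠ 0 → val (A * B) = val A * val B
  val_upper_left : ∀ {ι μ : Type} [Fintype ι] [Fintype μ] (A : Matrix ι ι R) (B : Matrix ι μ R)
    (C : Matrix μ μ R), val A ≠ 0 → val (fromBlocks A B 0 C) = val A * val C
  val_upper_right : ∀ {ι μ : Type} [Fintype ι] [Fintype μ] (A : Matrix ι ι R) (B : Matrix ι μ R)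
    (C : Matrix μ μ R), val C ≠ 0 → val (fromBlocks A B 0 C) = val A * val C
  val_reindex : ∀ {ι μ : Type} [Fintype ι] [Fintype μ] (e : μ ≃ ι) (A : Matrix ι ι R),
    val (A.submatrix e e) = val A

section ThreeBlocks

open Matrix

variable {α : Type*} {ι μ ν : Type*}

/-- A matrix made of nine blocks. -/
def fromBlocksThree (a₁₁ : Matrix ι ι α) (a₁₂ : Matrix ι μ α) (a₁₃ : Matrix ι ν α)
    (a₂₁ : Matrix μ ι α) (a₂₂ : Matrix μ μ α) (a₂₃ : Matrix μ ν α)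
    (a₃₁ : Matrix ν ι α) (a₃₂ : Matrix ν μ α) (a₃₃ : Matrix ν ν α) :
    Matrix (ι ⊕ (μ ⊕ ν)) (ι ⊕ (μ ⊕ ν)) α :=
  fromBlocks a₁₁ (fromCols a₁₂ a₁₃) (fromRows a₂₁ a₃₁) (fromBlocks a₂₂ a₂₃ a₃₂ a₃₃)

theorem fromBlocksThree_mul [NonUnitalNonAssocSemiring α] [Fintype ι] [Fintype μ] [Fintype ν]
    (a₁₁ : Matrix ι ι α) (a₁₂ : Matrix ι μ α) (a₁₃ : Matrix ι ν α)
    (a₂₁ : Matrix μ ι α) (a₂₂ : Matrix μ μ α) (a₂₃ : Matrix μ ν α)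
    (a₃₁ : Matrix ν ι α) (a₃₂ : Matrix ν μ α) (a₃₃ : Matrix ν ν α)
    (b₁₁ : Matrix ι ι α) (b₁₂ : Matrix ι μ α) (b₁₃ : Matrix ι ν α)
    (b₂₁ : Matrix μ ι α) (b₂₂ : Matrix μ μ α) (b₂₃ : Matrix μ ν α)
    (b₃₁ : Matrix ν ι α) (b₃₂ : Matrix ν μ α) (b₃₃ : Matrix ν ν α) :
    fromBlocksThree a₁₁ a₁₂ a₁₃ a₂₁ a₂₂ a₂₃ a₃₁ a₃₂ a₃₃ *
        fromBlocksThree b₁₁ b₁₂ b₁₃ b₂₁ b₂₂ b₂₃ b₃₁ b₃₂ b₃₃ =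
      fromBlocksThree
        (a₁₁ * b₁₁ + (a₁₂ * b₂₁ + a₁₃ * b₃₁)) (a₁₁ * b₁₂ + (a₁₂ * b₂₂ + a₁₃ * b₃₂))
        (a₁₁ * b₁₃ + (a₁₂ * b₂₃ + a₁₃ * b₃₃))
        (a₂₁ * b₁₁ + (a₂₂ * b₂₁ + a₂₃ * b₃₁)) (a₂₁ * b₁₂ + (a₂₂ * b₂₂ + a₂₃ * b₃₂))
        (a₂₁ * b₁₃ + (a₂₂ * b₂₃ + a₂₃ * b₃₃))
        (a₃₁ * b₁₁ + (a₃₂ * b₂₁ + a₃₃ * b₃₁)) (a₃₁ * b₁₂ + (a₃₂ * b₂₂ + a₃₃ * b₃₂))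
        (a₃₁ * b₁₃ + (a₃₂ * b₂₃ + a₃₃ * b₃₃)) := by
  ext (x | x | x) (y | y | y) <;>
    simp [fromBlocksThree, Matrix.mul_apply, Fintype.sum_sum_type]

end ThreeBlocks

namespace DetLike

open Matrix

variable {R : Type} [Ring R] {Γ : Type*} [CommGroupWithZero Γ] (D : DetLike R Γ)
  {ι μ ν : Type} [Fintype ι] [Fintype μ] [Fintype ν]

theorem val_lower_left (A : Matrix ι ι R) (B : Matrix μ ι R) (C : Matrix μ μ R)
    (hA : D.val A ≠ 0) : D.val (fromBlocks A 0 B C) = D.val A * D.val C := by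
  rw [← D.val_reindex (Equiv.sumComm μ ι), mul_comm, ← D.val_upper_right C B A hA]
  simp

theorem val_three_of_col (a₁₁ : Matrix ι ι R) (a₁₂ : Matrix ι μ R) (a₁₃ : Matrix ι ν R)
    (a₂₂ : Matrix μ μ R) (a₂₃ : Matrix μ ν R) (a₃₂ : Matrix ν μ R) (a₃₃ : Matrix ν ν R)
    (h : D.val a₁₁ ≠ 0) :
    D.val (fromBlocksThree a₁₁ a₁₂ a₁₃ 0 a₂₂ a₂₃ 0 a₃₂ a₃₃) =
      D.val a₁₁ * D.val (fromBlocks a₂₂ a₂₃ a₃₂ a₃₃) := by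
  rw [fromBlocksThree, fromRows_zero, D.val_upper_left _ _ _ h]

theorem val_three_of_row (a₁₁ : Matrix ι ι R) (a₂₁ : Matrix μ ι R) (a₃₁ : Matrix ν ι R)
    (a₂₂ : Matrix μ μ R) (a₂₃ : Matrix μ ν R) (a₃₂ : Matrix ν μ R) (a₃₃ : Matrix ν ν R)
    (h : D.val a₁₁ ≠ 0) :
    D.val (fromBlocksThree a₁₁ 0 0 a₂₁ a₂₂ a₂₃ a₃₁ a₃₂ a₃₃) =
      D.val a₁₁ * D.val (fromBlocks a₂₂ a₂₃ a₃₂ a₃₃) := by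
  rw [fromBlocksThree, fromCols_zero, D.val_lower_left _ _ _ h]

/-- Exchanging the first two blocks of indices. -/
theorem val_three_swap (a₁₁ : Matrix ι ι R) (a₁₂ : Matrix ι μ R) (a₁₃ : Matrix ι ν R)
    (a₂₁ : Matrix μ ι R) (a₂₂ : Matrix μ μ R) (a₂₃ : Matrix μ ν R)
    (a₃₁ : Matrix ν ι R) (a₃₂ : Matrix ν μ R) (a₃₃ : Matrix ν ν R) :
    D.val (fromBlocksThree a₁₁ a₁₂ a₁₃ a₂₁ a₂₂ a₂₃ a₃₁ a₃₂ a₃₃) =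
      D.val (fromBlocksThree a₂₂ a₂₁ a₂₃ a₁₂ a₁₁ a₁₃ a₃₂ a₃₁ a₃₃) := by
  rw [← D.val_reindex (((Equiv.sumAssoc μ ι ν).symm.trans
    ((Equiv.sumComm μ ι).sumCongr (Equiv.refl ν))).trans (Equiv.sumAssoc ι μ ν))]
  congr 1
  ext (x | x | x) (y | y | y) <;> rfl

theorem val_three_assoc (a₁₁ : Matrix ι ι R) (a₁₂ : Matrix ι μ R) (a₁₃ : Matrix ι ν R)
    (a₂₁ : Matrix μ ι R) (a₂₂ : Matrix μ μ R) (a₂₃ : Matrix μ ν R)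
    (a₃₁ : Matrix ν ι R) (a₃₂ : Matrix ν μ R) (a₃₃ : Matrix ν ν R) :
    D.val (fromBlocks (fromBlocks a₁₁ a₁₂ a₂₁ a₂₂) (fromRows a₁₃ a₂₃) (fromCols a₃₁ a₃₂) a₃₃) =
      D.val (fromBlocksThree a₁₁ a₁₂ a₁₃ a₂₁ a₂₂ a₂₃ a₃₁ a₃₂ a₃₃) := by
  rw [← D.val_reindex (Equiv.sumAssoc ι μ ν)]
  congr 1
  ext ((x | x) | x) ((y | y) | y) <;> rfl

theorem val_three_elementary [DecidableEq ι] [DecidableEq μ] [DecidableEq ν] (Z : Matrix μ ι R) :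
    D.val (fromBlocksThree (1 : Matrix ι ι R) 0 0 Z (1 : Matrix μ μ R) 0 0 0
      (1 : Matrix ν ν R)) = 1 := by
  rw [D.val_three_of_row _ _ _ _ _ _ _ (by simp [D.val_one]), fromBlocks_one]
  simp [D.val_one]

/-- The basic column operation followed by the corresponding row operation. -/
theorem val_three_transfer (t : Matrix ι ι R) (s : Matrix μ μ R) (X X' : Matrix μ ι R)
    (hX : s * X = X' * t) (a : Matrix ι ν R) (b : Matrix ν μ R) (c : Matrix ν ι R)
    (B : Matrix ν ν R) :
    D.val (fromBlocksThree t 0 a 0 s (X' * a) c b B) =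
      D.val (fromBlocksThree t 0 a 0 s 0 (c + b * X) b B) := by
  classical
  have h1 := D.val_three_elementary (ι := ι) (μ := μ) (ν := ν)
  rw [← one_mul (D.val (fromBlocksThree t 0 a 0 s (X' * a) c b B)), ← h1 (-X'),
    ← D.val_mul_left _ _ (by simp [h1]),
    ← mul_one (D.val (_ * _)), ← h1 X, ← D.val_mul_right _ _ (by simp [h1]),
    fromBlocksThree_mul, fromBlocksThree_mul]
  simp [hX]

/-- The value of the block matrix with diagonal blocks `t`, `B` determined by a triple `(f, t, Y)`
and a context `(B, u, V)`. -/
def pairing {κ : Type} [Fintype κ] (t : Matrix ι ι R) (Y : Matrix ι κ R) (f : ι → R)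
    (B : Matrix ν ν R) (u : ν → R) (V : Matrix κ ν R) : Γ :=
  D.val (fromBlocks t (Y * V) (vecMulVec u f) B)

variable {κ : Type} [Fintype κ]

/-- Two triples are equivalent if they have the same normalized value in all contexts. -/
def Equivalent (t : Matrix ι ι R) (Y : Matrix ι κ R) (f : ι → R) (s : Matrix μ μ R)
    (W : Matrix μ κ R) (g : μ → R) : Prop :=
  ∀ (ν : Type) [Fintype ν] (B : Matrix ν ν R) (u : ν → R) (V : Matrix κ ν R),
    D.pairing t Y f B u V * D.val s = D.pairing s W g B u V * D.val t

variable {D} in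
theorem Equivalent.symm {t : Matrix ι ι R} {Y : Matrix ι κ R} {f : ι → R} {s : Matrix μ μ R}
    {W : Matrix μ κ R} {g : μ → R} (h : D.Equivalent t Y f s W g) : D.Equivalent s W g t Y f :=
  fun ν _ B u V => (h ν B u V).symm

variable {D} in
theorem Equivalent.trans {t : Matrix ι ι R} {Y : Matrix ι κ R} {f : ι → R} {s : Matrix μ μ R}
    {W : Matrix μ κ R} {g : μ → R} {r : Matrix ν ν R} {Z : Matrix ν κ R} {k : ν → R}
    (h : D.Equivalent t Y f s W g) (h' : D.Equivalent s W g r Z k) (hs : D.val s ≠ 0) :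
    D.Equivalent t Y f r Z k := by
  intro ξ _ B u V
  apply mul_right_cancel₀ hs
  rw [mul_right_comm, h, mul_right_comm, h', mul_right_comm]

theorem equivalent_of_hom (t : Matrix ι ι R) (Y : Matrix ι κ R) (s : Matrix μ μ R) (g : μ → R)
    (X X' : Matrix μ ι R) (hX : s * X = X' * t) (ht : D.val t ≠ 0) (hs : D.val s ≠ 0) :
    D.Equivalent t Y (g ᵥ* X) s (X' * Y) g := by
  intro ν _ B u V
  have h := D.val_three_transfer t s X X' hX (Y * V) (vecMulVec u g) 0 B
  rw [D.val_three_of_col _ _ _ _ _ _ _ ht, D.val_three_swap, D.val_three_of_row _ _ _ _ _ _ _ hs,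
    zero_add, vecMulVec_mul, ← Matrix.mul_assoc] at h
  simp only [pairing]
  rw [mul_comm, ← h, mul_comm]

theorem equivalent_reindex (e : μ ≃ ι) (t : Matrix ι ι R) (Y : Matrix ι κ R) (f : ι → R) :
    D.Equivalent (t.submatrix e e) (Y.submatrix e id) (f ∘ e) t Y f := by
  intro ν _ B u V
  rw [D.val_reindex]
  congr 1
  simp only [pairing]
  rw [← D.val_reindex (e.sumCongr (Equiv.refl ν)) (fromBlocks t _ _ B)]
  congr 1
  ext (x | x) (y | y) <;> rfl

/-- The value in a context of a triple whose row is a combination of the rows of `t`. -/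
theorem pairing_vecMul_self (t : Matrix ι ι R) (ht : D.val t ≠ 0) (Y : Matrix ι κ R) (h : ι → R)
    (B : Matrix ν ν R) (u : ν → R) (V : Matrix κ ν R) :
    D.pairing t Y (h ᵥ* t) B u V = D.val t * D.val (B - vecMulVec u (h ᵥ* Y) * V) := by
  classical
  have h1 : D.val (fromBlocks (1 : Matrix ι ι R) 0 (vecMulVec u h) (1 : Matrix ν ν R)) = 1 := by
    rw [D.val_lower_left _ _ _ (by simp [D.val_one])]
    simp [D.val_one]
  rw [← D.val_upper_left t (Y * V) _ ht, ← one_mul (D.val (fromBlocks t _ 0 _)), ← h1,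
    ← D.val_mul_left _ _ (by simp [h1]), fromBlocks_multiply, pairing]
  simp [← vecMulVec_mul, Matrix.mul_assoc]

theorem equivalent_vecMul_self (t : Matrix ι ι R) (ht : D.val t ≠ 0) (Y : Matrix ι κ R)
    (h : ι → R) (s : Matrix μ μ R) (hs : D.val s ≠ 0) (W : Matrix μ κ R) (k : μ → R)
    (hk : h ᵥ* Y = k ᵥ* W) : D.Equivalent t Y (h ᵥ* t) s W (k ᵥ* s) := by
  intro ν _ B u V
  rw [D.pairing_vecMul_self t ht, D.pairing_vecMul_self s hs, hk]
  ac_rfl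

theorem pairing_sum (t : Matrix ι ι R) (Y : Matrix ι κ R) (f : ι → R) (s : Matrix μ μ R)
    (W : Matrix μ κ R) (g : μ → R) (B : Matrix ν ν R) (u : ν → R) (V : Matrix κ ν R) :
    D.pairing (fromBlocks t 0 0 s) (fromRows Y W) (Sum.elim f g) B u V =
      D.pairing t Y f (fromBlocks s (W * V) (vecMulVec u g) B) (Sum.elim 0 u)
        (fromCols 0 V) := by
  have h := D.val_three_assoc t 0 (Y * V) 0 s (W * V) (vecMulVec u f) (vecMulVec u g) B
  simp only [pairing]
  convert h using 2
  · rw [fromRows_mul]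
    congr 1
    ext x (y | y) <;> rfl
  · rw [fromBlocksThree, mul_fromCols, Matrix.mul_zero]
    congr 1
    ext (x | x) y <;> simp [vecMulVec_apply]

theorem val_diag (t : Matrix ι ι R) (ht : D.val t ≠ 0) (s : Matrix μ μ R) :
    D.val (fromBlocks t 0 0 s) = D.val t * D.val s :=
  D.val_upper_left t 0 s ht

variable {D} in
theorem Equivalent.sum_right {t : Matrix ι ι R} {Y : Matrix ι κ R} {f : ι → R} {s : Matrix μ μ R}
    {W : Matrix μ κ R} {g : μ → R} (h : D.Equivalent t Y f s W g) (ht : D.val t ≠ 0)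
    (hs : D.val s ≠ 0) (r : Matrix ν ν R) (Z : Matrix ν κ R) (k : ν → R) :
    D.Equivalent (fromBlocks t 0 0 r) (fromRows Y Z) (Sum.elim f k)
      (fromBlocks s 0 0 r) (fromRows W Z) (Sum.elim g k) := by
  intro ξ _ B u V
  rw [D.val_diag t ht, D.val_diag s hs, pairing_sum, pairing_sum, ← mul_assoc, h, ← mul_assoc]

theorem equivalent_sum_comm (t : Matrix ι ι R) (Y : Matrix ι κ R) (f : ι → R) (s : Matrix μ μ R)
    (W : Matrix μ κ R) (g : μ → R) :
    D.Equivalent (fromBlocks t 0 0 s) (fromRows Y W) (Sum.elim f g)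
      (fromBlocks s 0 0 t) (fromRows W Y) (Sum.elim g f) := by
  convert D.equivalent_reindex (Equiv.sumComm ι μ) (fromBlocks s 0 0 t) (fromRows W Y)
    (Sum.elim g f) using 1
  · simp
  · ext (x | x) y <;> rfl
  · ext (x | x) <;> rfl

end DetLike

/- ## The module of fractions of a determinant-like function -/

namespace DetLike

open Matrix

variable {R : Type} [Ring R] {Γ : Type*} [CommGroupWithZero Γ] (D : DetLike R Γ)
  (κ : Type) [Fintype κ]

/-- Triples `(f, t, Y)`, representing the row vector `f t⁻¹ Y`. -/
structure Triple where
  n : ℕ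
  t : Matrix (Fin n) (Fin n) R
  ht : D.val t ≠ 0
  Y : Matrix (Fin n) κ R
  f : Fin n → R

instance tripleSetoid : Setoid (D.Triple κ) where
  r z w := D.Equivalent z.t z.Y z.f w.t w.Y w.f
  iseqv := ⟨fun _ _ _ _ _ _ => rfl, fun h => h.symm, fun {_ w _} h h' => h.trans h' w.ht⟩

/-- The module of fractions `f t⁻¹ Y`. -/
def Fractions : Type := Quotient (D.tripleSetoid κ)

variable {κ} {ι μ ν : Type} [Fintype ι] [Fintype μ] [Fintype ν]

/-- The triple on a standard index set obtained by reindexing. -/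
noncomputable def triple (t : Matrix ι ι R) (ht : D.val t ≠ 0) (Y : Matrix ι κ R) (f : ι → R) :
    D.Triple κ where
  n := Fintype.card ι
  t := t.submatrix (Fintype.equivFin ι).symm (Fintype.equivFin ι).symm
  ht := by rwa [D.val_reindex]
  Y := Y.submatrix (Fintype.equivFin ι).symm id
  f := f ∘ (Fintype.equivFin ι).symm

theorem triple_equivalent (t : Matrix ι ι R) (ht : D.val t ≠ 0) (Y : Matrix ι κ R) (f : ι → R) :
    D.Equivalent (D.triple t ht Y f).t (D.triple t ht Y f).Y (D.triple t ht Y f).f t Y f :=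
  D.equivalent_reindex _ t Y f

/-- The fraction `f t⁻¹ Y`. -/
noncomputable def frac (t : Matrix ι ι R) (ht : D.val t ≠ 0) (Y : Matrix ι κ R) (f : ι → R) :
    D.Fractions κ :=
  Quotient.mk _ (D.triple t ht Y f)

theorem frac_eq_iff {t : Matrix ι ι R} {ht : D.val t ≠ 0} {Y : Matrix ι κ R} {f : ι → R}
    {s : Matrix μ μ R} {hs : D.val s ≠ 0} {W : Matrix μ κ R} {g : μ → R} :
    D.frac t ht Y f = D.frac s hs W g ↔ D.Equivalent t Y f s W g := by
  refine Quotient.eq.trans ?_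
  constructor
  · intro h
    exact ((D.triple_equivalent t ht Y f).symm.trans h (D.triple t ht Y f).ht).trans
      (D.triple_equivalent s hs W g) (D.triple s hs W g).ht
  · intro h
    exact ((D.triple_equivalent t ht Y f).trans h ht).trans
      (D.triple_equivalent s hs W g).symm hs

theorem mk_eq_frac (z : D.Triple κ) :
    (Quotient.mk _ z : D.Fractions κ) = D.frac z.t z.ht z.Y z.f :=
  Quotient.sound (D.triple_equivalent z.t z.ht z.Y z.f).symm

variable {D} in
theorem Fractions.induction {motive : D.Fractions κ → Prop}
    (h : ∀ (n : ℕ) (t : Matrix (Fin n) (Fin n) R) (ht : D.val t ≠ 0) (Y : Matrix (Fin n) κ R)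
      (f : Fin n → R), motive (D.frac t ht Y f)) (x : D.Fractions κ) : motive x := by
  induction x using Quotient.inductionOn with
  | _ z => rw [mk_eq_frac]; exact h _ _ _ _ _

theorem val_diag_ne_zero {t : Matrix ι ι R} (ht : D.val t ≠ 0) {s : Matrix μ μ R}
    (hs : D.val s ≠ 0) : D.val (fromBlocks t 0 0 s) ≠ 0 := by
  rw [D.val_diag t ht]
  exact mul_ne_zero ht hs

theorem equivalent_sum_congr {ι' μ' : Type} [Fintype ι'] [Fintype μ']
    {t : Matrix ι ι R} {Y : Matrix ι κ R} {f : ι → R} {t' : Matrix ι' ι' R} {Y' : Matrix ι' κ R}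
    {f' : ι' → R} {s : Matrix μ μ R} {W : Matrix μ κ R} {g : μ → R} {s' : Matrix μ' μ' R}
    {W' : Matrix μ' κ R} {g' : μ' → R} (ht : D.val t ≠ 0) (ht' : D.val t' ≠ 0)
    (hs : D.val s ≠ 0) (hs' : D.val s' ≠ 0) (h : D.Equivalent t Y f t' Y' f')
    (h' : D.Equivalent s W g s' W' g') :
    D.Equivalent (fromBlocks t 0 0 s) (fromRows Y W) (Sum.elim f g)
      (fromBlocks t' 0 0 s') (fromRows Y' W') (Sum.elim f' g') := by
  refine (h.sum_right ht ht' s W g).trans ?_ (D.val_diag_ne_zero ht' hs)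
  refine (D.equivalent_sum_comm _ _ _ _ _ _).trans ?_ (D.val_diag_ne_zero hs ht')
  exact (h'.sum_right hs hs' t' Y' f').trans (D.equivalent_sum_comm _ _ _ _ _ _)
    (D.val_diag_ne_zero hs' ht')

noncomputable instance : Add (D.Fractions κ) :=
  ⟨Quotient.map₂ (fun z w => D.triple (fromBlocks z.t 0 0 w.t) (D.val_diag_ne_zero z.ht w.ht)
      (fromRows z.Y w.Y) (Sum.elim z.f w.f)) (by
    intro z z' h w w' h'
    exact Quotient.exact ((D.frac_eq_iff).2 (D.equivalent_sum_congr z.ht z'.ht w.ht w'.ht h h')))⟩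

theorem frac_add_frac (t : Matrix ι ι R) (ht : D.val t ≠ 0) (Y : Matrix ι κ R) (f : ι → R)
    (s : Matrix μ μ R) (hs : D.val s ≠ 0) (W : Matrix μ κ R) (g : μ → R) :
    D.frac t ht Y f + D.frac s hs W g =
      D.frac (fromBlocks t 0 0 s) (D.val_diag_ne_zero ht hs) (fromRows Y W) (Sum.elim f g) :=
  (D.frac_eq_iff).2 (D.equivalent_sum_congr (D.triple t ht Y f).ht ht (D.triple s hs W g).ht hs
    (D.triple_equivalent t ht Y f) (D.triple_equivalent s hs W g))

theorem pairing_smul (t : Matrix ι ι R) (Y : Matrix ι κ R) (f : ι → R) (r : R)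
    (B : Matrix ν ν R) (u : ν → R) (V : Matrix κ ν R) :
    D.pairing t Y (r • f) B u V = D.pairing t Y f B (fun x => u x * r) V := by
  simp only [pairing]
  congr 2
  ext x y
  simp [vecMulVec_apply, mul_assoc]

theorem equivalent_smul {t : Matrix ι ι R} {Y : Matrix ι κ R} {f : ι → R} {s : Matrix μ μ R}
    {W : Matrix μ κ R} {g : μ → R} (r : R) (h : D.Equivalent t Y f s W g) :
    D.Equivalent t Y (r • f) s W (r • g) := by
  intro ν _ B u V
  rw [pairing_smul, pairing_smul, h]

noncomputable instance : SMul R (D.Fractions κ) :=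
  ⟨fun r => Quotient.map (fun z => D.triple z.t z.ht z.Y (r • z.f)) (by
    intro z z' h
    exact Quotient.exact ((D.frac_eq_iff).2 (D.equivalent_smul r h)))⟩

theorem smul_frac (r : R) (t : Matrix ι ι R) (ht : D.val t ≠ 0) (Y : Matrix ι κ R) (f : ι → R) :
    r • D.frac t ht Y f = D.frac t ht Y (r • f) :=
  (D.frac_eq_iff).2 (D.equivalent_smul r (D.triple_equivalent t ht Y f))

theorem frac_vecMul (t : Matrix ι ι R) (ht : D.val t ≠ 0) (Y : Matrix ι κ R) (s : Matrix μ μ R)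
    (hs : D.val s ≠ 0) (g : μ → R) (X X' : Matrix μ ι R) (hX : s * X = X' * t) :
    D.frac t ht Y (g ᵥ* X) = D.frac s hs (X' * Y) g :=
  (D.frac_eq_iff).2 (D.equivalent_of_hom t Y s g X X' hX ht hs)

theorem frac_add (t : Matrix ι ι R) (ht : D.val t ≠ 0) (Y : Matrix ι κ R) (f g : ι → R) :
    D.frac t ht Y (f + g) = D.frac t ht Y f + D.frac t ht Y g := by
  classical
  rw [frac_add_frac]
  have h := D.frac_vecMul t ht Y _ (D.val_diag_ne_zero ht ht) (Sum.elim f g) (fromRows 1 1)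
    (fromRows 1 1) (by
      rw [fromRows_mul, ← fromCols_fromRows_eq_fromBlocks, fromCols_mul_fromRows]
      ext (x | x) y <;> simp)
  simpa [fromRows_mul, vecMul_fromRows] using h

theorem val_empty_ne_zero : D.val (0 : Matrix Empty Empty R) ≠ 0 := by
  rw [Subsingleton.elim (0 : Matrix Empty Empty R) 1, D.val_one]
  exact one_ne_zero

noncomputable instance : Zero (D.Fractions κ) :=
  ⟨D.frac (0 : Matrix Empty Empty R) D.val_empty_ne_zero 0 0⟩

theorem zero_def : (0 : D.Fractions κ) =
    D.frac (0 : Matrix Empty Empty R) D.val_empty_ne_zero 0 0 := rfl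

theorem frac_zero (t : Matrix ι ι R) (ht : D.val t ≠ 0) (Y : Matrix ι κ R) :
    D.frac t ht Y 0 = 0 := by
  have h := D.frac_vecMul t ht Y (0 : Matrix Empty Empty R) D.val_empty_ne_zero 0 0 0
    (Subsingleton.elim _ _)
  rw [zero_vecMul] at h
  rw [h, zero_def]
  congr 1
  exact Subsingleton.elim _ _

noncomputable instance : Neg (D.Fractions κ) := ⟨fun x => (-1 : R) • x⟩

theorem neg_frac (t : Matrix ι ι R) (ht : D.val t ≠ 0) (Y : Matrix ι κ R) (f : ι → R) :
    -D.frac t ht Y f = D.frac t ht Y (-f) := by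
  rw [← neg_one_smul R f, ← smul_frac]
  rfl

theorem fractions_add_comm (x y : D.Fractions κ) : x + y = y + x := by
  induction x using Fractions.induction with | _ _ t ht Y f
  induction y using Fractions.induction with | _ _ s hs W g
  rw [frac_add_frac, frac_add_frac, frac_eq_iff]
  exact D.equivalent_sum_comm _ _ _ _ _ _

theorem fractions_zero_add (x : D.Fractions κ) : 0 + x = x := by
  induction x using Fractions.induction with | _ _ t ht Y f
  rw [← D.frac_zero t ht Y, ← frac_add, zero_add]

theorem fractions_add_assoc (x y z : D.Fractions κ) : x + y + z = x + (y + z) := by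
  induction x using Fractions.induction with | _ _ t ht Y f
  induction y using Fractions.induction with | _ _ s hs W g
  induction z using Fractions.induction with | _ _ r hr Z k
  simp only [frac_add_frac, frac_eq_iff]
  convert D.equivalent_reindex (Equiv.sumAssoc _ _ _) (fromBlocks t 0 0 (fromBlocks s 0 0 r))
    (fromRows Y (fromRows W Z)) (Sum.elim f (Sum.elim g k)) using 1
  · ext ((x | x) | x) ((y | y) | y) <;> rfl
  · ext ((x | x) | x) y <;> rfl
  · ext ((x | x) | x) <;> rfl

noncomputable instance : AddCommGroup (D.Fractions κ) where
  add_assoc := D.fractions_add_assoc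
  zero_add := D.fractions_zero_add
  add_zero x := by rw [fractions_add_comm, fractions_zero_add]
  add_comm := D.fractions_add_comm
  neg_add_cancel x := by
    induction x using Fractions.induction with | _ _ t ht Y f
    rw [neg_frac, ← frac_add, neg_add_cancel, frac_zero]
  nsmul := nsmulRec
  zsmul := zsmulRec

noncomputable instance : Module R (D.Fractions κ) where
  one_smul x := by
    induction x using Fractions.induction with | _ _ t ht Y f
    rw [smul_frac, one_smul]
  mul_smul a b x := by
    induction x using Fractions.induction with | _ _ t ht Y f
    simp only [smul_frac, mul_smul]
  smul_zero a := by rw [zero_def, smul_frac, smul_zero]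
  smul_add a x y := by
    induction x using Fractions.induction with | _ _ t ht Y f
    induction y using Fractions.induction with | _ _ s hs W g
    simp only [frac_add_frac, smul_frac]
    congr 1
    ext (x | x) <;> rfl
  add_smul a b x := by
    induction x using Fractions.induction with | _ _ t ht Y f
    simp only [smul_frac, add_smul, frac_add]
  zero_smul x := by
    induction x using Fractions.induction with | _ _ t ht Y f
    rw [smul_frac, zero_smul, frac_zero]

/-- The fraction `f t⁻¹ Y` as a linear function of `f`. -/
noncomputable def fracLinear (t : Matrix ι ι R) (ht : D.val t ≠ 0) (Y : Matrix ι κ R) :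
    (ι → R) →ₗ[R] D.Fractions κ where
  toFun := D.frac t ht Y
  map_add' := D.frac_add t ht Y
  map_smul' r f := (D.smul_frac r t ht Y f).symm

theorem sum_smul_frac (t : Matrix ι ι R) (ht : D.val t ≠ 0) (Y : Matrix ι κ R) (a : μ → R)
    (F : Matrix μ ι R) : ∑ x, a x • D.frac t ht Y (F x) = D.frac t ht Y (a ᵥ* F) := by
  have h : a ᵥ* F = ∑ x, a x • F x := by
    ext y
    simp [vecMul, dotProduct, Finset.sum_apply]
  rw [h]
  exact ((map_sum (D.fracLinear t ht Y) _ _).trans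
    (Finset.sum_congr rfl fun x _ => (D.fracLinear t ht Y).map_smul (a x) (F x))).symm

theorem frac_eq_zero_iff {t : Matrix ι ι R} {ht : D.val t ≠ 0} {Y : Matrix ι κ R} {f : ι → R} :
    D.frac t ht Y f = 0 ↔ ∀ (ν : Type) [Fintype ν] (B : Matrix ν ν R) (u : ν → R)
      (V : Matrix κ ν R), D.pairing t Y f B u V = D.val t * D.val B := by
  rw [← D.frac_zero t ht Y, frac_eq_iff]
  refine forall_congr' fun ν => forall_congr' fun _ => forall_congr' fun B =>
    forall_congr' fun u => forall_congr' fun V => ?_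
  have h0 : vecMulVec u (0 : ι → R) = 0 := by ext; simp [vecMulVec_apply]
  rw [mul_left_inj' ht, pairing, pairing, h0, D.val_upper_left _ _ _ ht]

theorem frac_vecMul_self_eq_zero (t : Matrix ι ι R) (ht : D.val t ≠ 0) (Y : Matrix ι κ R)
    (h : ι → R) (hY : h ᵥ* Y = 0) : D.frac t ht Y (h ᵥ* t) = 0 := by
  rw [frac_eq_zero_iff]
  intro ν _ B u V
  have h0 : vecMulVec u (0 : κ → R) = 0 := by ext; simp [vecMulVec_apply]
  rw [D.pairing_vecMul_self t ht, hY, h0, Matrix.zero_mul, sub_zero]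

/-- A multiple of a null row may be added to the lower left block. -/
theorem val_add_vecMulVec (t : Matrix ι ι R) (ht : D.val t ≠ 0) (Y : Matrix ι κ R) (h : ι → R)
    (hh : D.frac t ht Y h = 0) (u : ν → R) (V : Matrix κ ν R) (X : Matrix ν ι R)
    (B : Matrix ν ν R) :
    D.val (fromBlocks t (Y * V) (X + vecMulVec u h) B) = D.val (fromBlocks t (Y * V) X B) := by
  classical
  have h1 := (D.frac_eq_zero_iff).1 hh (ι ⊕ ν) (fromBlocks t (Y * V) X B) (Sum.elim 0 u)
    (fromCols 0 V)
  have h2 := D.val_three_transfer t t 1 1 (by simp) (Y * V) X (vecMulVec u h) B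
  have h3 : D.pairing t Y h (fromBlocks t (Y * V) X B) (Sum.elim 0 u) (fromCols 0 V) =
      D.val (fromBlocksThree t 0 (Y * V) 0 t ((1 : Matrix ι ι R) * (Y * V)) (vecMulVec u h) X B) := by
    rw [pairing, fromBlocksThree, mul_fromCols, Matrix.mul_zero, Matrix.one_mul]
    congr 2
    ext (x | x) y <;> simp [vecMulVec_apply]
  rw [← h3, h1, D.val_three_swap, D.val_three_of_row _ _ _ _ _ _ _ ht, Matrix.mul_one] at h2
  rw [add_comm X, ← mul_left_cancel₀ ht h2]

theorem val_add_mul (t : Matrix ι ι R) (ht : D.val t ≠ 0) (Y : Matrix ι κ R) (H : Matrix μ ι R)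
    (hH : ∀ x, D.frac t ht Y (H x) = 0) (U : Matrix ν μ R) (V : Matrix κ ν R) (X : Matrix ν ι R)
    (B : Matrix ν ν R) :
    D.val (fromBlocks t (Y * V) (X + U * H) B) = D.val (fromBlocks t (Y * V) X B) := by
  classical
  have h : U * H = ∑ x, vecMulVec (fun a => U a x) (H x) := by
    ext a b
    simp [Matrix.mul_apply, Matrix.sum_apply, vecMulVec_apply]
  rw [h]
  induction (Finset.univ : Finset μ) using Finset.induction_on with
  | empty => simp
  | insert a s ha ih =>
    rw [Finset.sum_insert ha, add_comm (vecMulVec _ _), ← add_assoc,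
      D.val_add_vecMulVec t ht Y _ (hH a), ih]

theorem exists_common_denominator (x : μ → D.Fractions κ) :
    ∃ (ι : Type) (_ : Fintype ι) (t : Matrix ι ι R) (ht : D.val t ≠ 0) (Y : Matrix ι κ R)
      (F : Matrix μ ι R), ∀ a, x a = D.frac t ht Y (F a) := by
  classical
  have h : x = ∑ a, Pi.single a (x a) := (Finset.univ_sum_single x).symm
  rw [h]
  refine Finset.sum_induction _ (fun x : μ → D.Fractions κ => ∃ (ι : Type) (_ : Fintype ι)
    (t : Matrix ι ι R) (ht : D.val t ≠ 0) (Y : Matrix ι κ R) (F : Matrix μ ι R),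
      ∀ a, x a = D.frac t ht Y (F a)) ?_ ?_ ?_
  · rintro x y ⟨ι, _, t, ht, Y, F, hF⟩ ⟨ι', _, s, hs, W, G, hG⟩
    refine ⟨ι ⊕ ι', inferInstance, _, D.val_diag_ne_zero ht hs, fromRows Y W, fromCols F G, ?_⟩
    intro a
    rw [Pi.add_apply, hF, hG, frac_add_frac]
    rfl
  · exact ⟨Empty, inferInstance, 0, D.val_empty_ne_zero, 0, 0, fun a => rfl⟩
  · intro a _
    generalize x a = y
    induction y using Fractions.induction with | _ n t ht Y f
    refine ⟨Fin n, inferInstance, t, ht, Y, Pi.single a f, fun b => ?_⟩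
    by_cases hb : b = a
    · subst hb
      simp
    · simp [hb, frac_zero]

/-- A matrix of nonzero value acts injectively on vectors of fractions. -/
theorem eq_zero_of_sum_smul_eq_zero (s : Matrix μ μ R) (hs : D.val s ≠ 0)
    (x : μ → D.Fractions κ) (h : ∀ a, ∑ b, s a b • x b = 0) : x = 0 := by
  classical
  obtain ⟨ι, _, t, ht, Y, F, hF⟩ := D.exists_common_denominator x
  have hsF : ∀ a, D.frac t ht Y ((s * F) a) = 0 := by
    intro a
    rw [← h a]
    simp only [hF]
    exact (D.sum_smul_frac t ht Y (s a) F).symm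
  funext c
  rw [hF, Pi.zero_apply, frac_eq_zero_iff]
  intro ν _ B u V
  have h1 := D.val_add_mul t ht Y (s * F) hsF (fromRows 1 0 : Matrix (μ ⊕ ν) μ R) (fromCols 0 V)
    0 (fromBlocks s 0 (-vecMulVec u (Pi.single c 1)) B)
  rw [zero_add, D.val_upper_left _ _ _ ht, D.val_lower_left _ _ _ hs] at h1
  have h2 : fromBlocks t (Y * (fromCols 0 V : Matrix κ (μ ⊕ ν) R))
      ((fromRows 1 0 : Matrix (μ ⊕ ν) μ R) * (s * F))
      (fromBlocks s 0 (-vecMulVec u (Pi.single c 1)) B) *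
      fromBlocksThree 1 0 0 (-F) 1 0 0 0 1 =
      fromBlocksThree t 0 (Y * V) 0 s 0 (vecMulVec u (F c)) (-vecMulVec u (Pi.single c 1)) B := by
    rw [mul_fromCols, fromRows_mul, ← fromBlocksThree, fromBlocksThree_mul]
    simp [vecMulVec_mul, Matrix.row]
  have h3 := D.val_three_elementary (ι := ι) (μ := μ) (ν := ν) (-F)
  have h4 := congrArg D.val h2
  rw [D.val_mul_right _ _ (by simp [h3]), h3, h1, mul_one, D.val_three_swap,
    D.val_three_of_row _ _ _ _ _ _ _ hs, mul_left_comm] at h4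
  exact (mul_left_cancel₀ hs h4).symm

/-- A matrix of nonzero value acts surjectively on vectors of fractions. -/
theorem exists_sum_smul_eq (s : Matrix μ μ R) (hs : D.val s ≠ 0) (y : μ → D.Fractions κ) :
    ∃ x : μ → D.Fractions κ, ∀ a, ∑ b, s a b • x b = y a := by
  classical
  obtain ⟨ι, _, t, ht, Y, F, hF⟩ := D.exists_common_denominator y
  have hE : D.val (fromBlocks s (-F) 0 t) ≠ 0 := by
    rw [D.val_upper_left _ _ _ hs]
    exact mul_ne_zero hs ht
  refine ⟨fun b => D.frac _ hE (fromRows 0 Y) ((fromCols 1 0 : Matrix μ (μ ⊕ ι) R) b),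
    fun a => ?_⟩
  rw [D.sum_smul_frac _ hE, hF]
  have h1 := D.frac_vecMul_self_eq_zero _ hE (fromRows 0 Y) (Sum.elim (Pi.single a 1) 0)
    (by ext c; simp [Matrix.row])
  have h2 := D.frac_vecMul _ hE (fromRows 0 Y) t ht (F a) (fromCols 0 1 : Matrix ι (μ ⊕ ι) R)
    (fromCols 0 1) (by
      rw [mul_fromCols, ← fromRows_fromCols_eq_fromBlocks, fromCols_mul_fromRows]
      simp)
  rw [fromCols_mul_fromRows, Matrix.zero_mul, zero_add, Matrix.one_mul] at h2
  rw [← h2, ← sub_eq_zero, sub_eq_add_neg, neg_frac, ← frac_add, ← h1]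
  congr 1
  ext (b | b) <;> simp [vecMul_fromCols, Matrix.row]

theorem isUnit_map_toModuleEnd [DecidableEq μ] (s : Matrix μ μ R) (hs : D.val s ≠ 0) :
    IsUnit (s.map (Module.toModuleEnd ℤ (D.Fractions κ) : R →+* _)) := by
  rw [← MulEquiv.isUnit_map (endVecRingEquivMatrixEnd μ ℤ (D.Fractions κ)).symm,
    Module.End.isUnit_iff]
  have happ : ∀ x a, (endVecRingEquivMatrixEnd μ ℤ (D.Fractions κ)).symm
      (s.map (Module.toModuleEnd ℤ (D.Fractions κ))) x a = ∑ b, s a b • x b := fun _ _ => rfl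
  constructor
  · rw [injective_iff_map_eq_zero]
    intro x hx
    exact D.eq_zero_of_sum_smul_eq_zero s hs x fun a => (happ x a).symm.trans (congrFun hx a)
  · intro y
    obtain ⟨x, hx⟩ := D.exists_sum_smul_eq s hs y
    exact ⟨x, funext fun a => (happ x a).trans (hx a)⟩

end DetLike

/- ## Fractions over a universal localization -/

namespace DetLike

open Matrix

variable {R L : Type} [Ring R] [Ring L] {Γ : Type*} [CommGroupWithZero Γ] (D : DetLike R Γ)
  {i : R →+* L} {Sig : Set (REnd R)} {ι μ ν κ : Type} [Fintype ι] [Fintype μ] [Fintype ν]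
  [Fintype κ]

/-- The values of `D` are nonzero exactly on the matrices which become invertible along `i`. -/
def Detects (i : R →+* L) : Prop :=
  ∀ {ι : Type} [Fintype ι] [DecidableEq ι] (A : Matrix ι ι R), D.val A ≠ 0 ↔ IsUnit (A.map i)

variable {D}

theorem exists_ringHom_toModuleEnd (hD : D.Detects i) (huniv : IsUniversalLocalization Sig i)
    (κ : Type) [Fintype κ] : ∃ k : L →+* Module.End ℤ (D.Fractions κ),
      ∀ (r : R) (x : D.Fractions κ), k (i r) x = r • x := by
  obtain ⟨k, hk, -⟩ := huniv.2 (Module.End ℤ (D.Fractions κ)) (Module.toModuleEnd ℤ _)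
    (huniv.1.of_isUnit fun n A hA => D.isUnit_map_toModuleEnd A ((hD A).2 hA))
  exact ⟨k, fun r x => by rw [← RingHom.comp_apply, hk]; rfl⟩

theorem frac_eq_zero_of_vecMul_eq_zero (hD : D.Detects i) (huniv : IsUniversalLocalization Sig i)
    (t : Matrix ι ι R) (ht : D.val t ≠ 0) (Y : Matrix ι κ R) (Z : Matrix ι κ L)
    (hZ : t.map i * Z = Y.map i) (h : ι → R) (hh : (i ∘ h) ᵥ* Z = 0) : D.frac t ht Y h = 0 := by
  classical
  obtain ⟨k, hk⟩ := exists_ringHom_toModuleEnd hD huniv κ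
  have h1 : D.val (1 : Matrix κ κ R) ≠ 0 := by simp [D.val_one]
  let e : κ → D.Fractions κ := fun c => D.frac 1 h1 1 ((1 : Matrix κ κ R) c)
  have hx : (fun a => D.frac t ht Y ((1 : Matrix ι ι R) a)) = fun a => ∑ c, k (Z a c) (e c) := by
    rw [← sub_eq_zero]
    refine D.eq_zero_of_sum_smul_eq_zero t ht _ fun a => ?_
    simp only [Pi.sub_apply, smul_sub, Finset.sum_sub_distrib, sub_eq_zero]
    rw [sum_smul_frac, vecMul_one]
    have h2 : D.frac t ht Y (t a) = D.frac 1 h1 1 (Y a) := by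
      have := D.equivalent_vecMul_self t ht Y (Pi.single a 1) 1 h1 1 (Y a) (by simp [Matrix.row])
      rw [← frac_eq_iff] at this
      simpa [Matrix.row] using this
    have h3 : D.frac 1 h1 1 (Y a) = ∑ c, Y a c • e c := by
      rw [D.sum_smul_frac, vecMul_one]
    rw [h2, h3]
    simp_rw [Finset.smul_sum, ← hk, ← Module.End.mul_apply, ← map_mul]
    rw [Finset.sum_comm]
    refine Finset.sum_congr rfl fun c _ => ?_
    rw [← LinearMap.sum_apply, ← map_sum]
    congr 2
    exact (congrFun (congrFun hZ a) c).symm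
  have h4 := D.sum_smul_frac t ht Y h 1
  rw [vecMul_one] at h4
  rw [← h4]
  simp_rw [fun a => congrFun hx a, Finset.smul_sum, ← hk, ← Module.End.mul_apply, ← map_mul]
  rw [Finset.sum_comm]
  refine Finset.sum_eq_zero fun c _ => ?_
  rw [← LinearMap.sum_apply, ← map_sum]
  have h5 : ∑ a, i (h a) * Z a c = 0 := congrFun hh c
  rw [h5, map_zero, LinearMap.zero_apply]

/-- The numerator of the determinant of `F t⁻¹ Y`. -/
def num (D : DetLike R Γ) (F : Matrix ν ι R) (t : Matrix ι ι R) (Y : Matrix ι ν R) : Γ :=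
  D.val (fromBlocks t Y (-F) 0)

theorem num_mul_val_eq (hD : D.Detects i) (huniv : IsUniversalLocalization Sig i)
    {F : Matrix ν ι R} {t : Matrix ι ι R} {Y : Matrix ι ν R} {Z : Matrix ι ν L}
    {G : Matrix ν μ R} {s : Matrix μ μ R} {W : Matrix μ ν R} {Z' : Matrix μ ν L}
    (ht : D.val t ≠ 0) (hs : D.val s ≠ 0) (hZ : t.map i * Z = Y.map i)
    (hZ' : s.map i * Z' = W.map i) (h : F.map i * Z = G.map i * Z') :
    D.num F t Y * D.val s = D.num G s W * D.val t := by
  classical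
  have hts := D.val_diag_ne_zero ht hs
  have h1 := D.val_add_mul (fromBlocks t 0 0 s) hts (fromRows Y W) (fromCols F (-G))
    (fun x => frac_eq_zero_of_vecMul_eq_zero hD huniv _ hts _ (fromRows Z Z')
      (by
        have h0 : ∀ {α β : Type}, (0 : Matrix α β R).map i = 0 := by intros; ext; simp
        rw [fromBlocks_map, fromBlocks_mul_fromRows, h0, h0, Matrix.zero_mul, Matrix.zero_mul,
          add_zero, zero_add, hZ, hZ']
        ext (a | a) b <;> rfl) _ (by
        have h2 : (i ∘ (fromCols F (-G)) x) = Sum.elim (F.map i x) (-(G.map i x)) := by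
          ext (a | a) <;> simp
        rw [h2]
        have h3 : F.map i x ᵥ* Z = G.map i x ᵥ* Z' := congrFun h x
        ext c
        simp [vecMul_fromRows, h3, neg_vecMul]))
    1 1 (fromCols (-F) 0) (0 : Matrix ν ν R)
  have h2 : (fromCols (-F) 0 + (1 : Matrix ν ν R) * fromCols F (-G) : Matrix ν (ι ⊕ μ) R) = fromCols 0 (-G) := by
    rw [Matrix.one_mul]; ext a (b | b) <;> simp
  rw [h2, Matrix.mul_one, val_three_assoc, val_three_assoc, D.val_three_of_col _ _ _ _ _ _ _ ht,
    D.val_three_swap, D.val_three_of_col _ _ _ _ _ _ _ hs] at h1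
  rw [num, num, mul_comm, ← h1, mul_comm]

end DetLike

/- ## Cramer's rule over a universal localization -/

section Representation

open Matrix

variable {R L : Type} [Ring R] [Ring L] {i : R →+* L} {ι μ ν κ ξ ν' κ' : Type} [Fintype ι]
  [Fintype μ] [Fintype ν] [Fintype κ] [Fintype ξ] [DecidableEq ι] [DecidableEq μ] [DecidableEq κ]

/-- The matrix `X` over `L` is the fraction `F t⁻¹ Y`. -/
def IsRep (i : R →+* L) (F : Matrix ν' ι R) (t : Matrix ι ι R) (Y : Matrix ι κ' R)
    (X : Matrix ν' κ' L) : Prop :=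
  IsUnit (t.map i) ∧ ∃ Z : Matrix ι κ' L, t.map i * Z = Y.map i ∧ X = F.map i * Z

/-- The matrix `X` over `L` can be written as a fraction. -/
def HasRep (i : R →+* L) (X : Matrix ν' κ' L) : Prop :=
  ∃ (ι : Type) (_ : Fintype ι) (_ : DecidableEq ι) (F : Matrix ν' ι R) (t : Matrix ι ι R)
    (Y : Matrix ι κ' R), IsRep i F t Y X

theorem map_one_ringHom {ι : Type*} [DecidableEq ι] : (1 : Matrix ι ι R).map i = 1 :=
  Matrix.map_one _ (map_zero i) (map_one i)

theorem map_zero_ringHom {ι μ : Type*} : (0 : Matrix ι μ R).map i = 0 :=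
  Matrix.map_zero _ (map_zero i)

theorem map_neg_ringHom {ι μ : Type*} (A : Matrix ι μ R) : (-A).map i = -A.map i := by
  ext; simp

theorem map_fromCols_ringHom {ι μ κ : Type*} (A : Matrix κ ι R) (B : Matrix κ μ R) :
    (fromCols A B).map i = fromCols (A.map i) (B.map i) := by
  ext a (b | b) <;> rfl

theorem isRep_map (A : Matrix ν' κ R) : IsRep i A 1 1 (A.map i) :=
  ⟨by simp, 1, by simp, by simp⟩

theorem isRep_inv {t : Matrix ι ι R} {Z : Matrix ι ι L} (h : t.map i * Z = 1)
    (h' : Z * t.map i = 1) : IsRep i 1 t 1 Z :=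
  ⟨⟨⟨_, _, h, h'⟩, rfl⟩, Z, by simp [h], by simp⟩

theorem IsRep.neg {F : Matrix ν' ι R} {t : Matrix ι ι R} {Y : Matrix ι κ' R} {X : Matrix ν' κ' L}
    (h : IsRep i F t Y X) : IsRep i (-F) t Y (-X) := by
  obtain ⟨ht, Z, hZ, rfl⟩ := h
  exact ⟨ht, Z, hZ, by rw [map_neg_ringHom, Matrix.neg_mul]⟩

theorem IsRep.mul_left {F : Matrix ν ι R} {t : Matrix ι ι R} {Y : Matrix ι κ' R}
    {X : Matrix ν κ' L} (h : IsRep i F t Y X) (A : Matrix ν' ν R) :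
    IsRep i (A * F) t Y (A.map i * X) := by
  obtain ⟨ht, Z, hZ, rfl⟩ := h
  exact ⟨ht, Z, hZ, by rw [Matrix.map_mul, Matrix.mul_assoc]⟩

theorem IsRep.mul_right {F : Matrix ν' ι R} {t : Matrix ι ι R} {Y : Matrix ι ν R}
    {X : Matrix ν' ν L} (h : IsRep i F t Y X) (B : Matrix ν κ' R) :
    IsRep i F t (Y * B) (X * B.map i) := by
  obtain ⟨ht, Z, hZ, rfl⟩ := h
  exact ⟨ht, Z * B.map i, by rw [Matrix.map_mul, ← hZ, Matrix.mul_assoc], Matrix.mul_assoc _ _ _⟩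

theorem isUnit_map_fromBlocks_upper {t : Matrix ι ι R} {s : Matrix μ μ R}
    (ht : IsUnit (t.map i)) (hs : IsUnit (s.map i)) (B : Matrix ι μ R) :
    IsUnit ((fromBlocks t B 0 s).map i) := by
  rw [fromBlocks_map, map_zero_ringHom]
  exact (isUnit_fromBlocks_upper_iff_right ht _ _).2 hs

theorem IsRep.add {F : Matrix ν' ι R} {t : Matrix ι ι R} {Y : Matrix ι κ' R} {X : Matrix ν' κ' L}
    {G : Matrix ν' μ R} {s : Matrix μ μ R} {W : Matrix μ κ' R} {X' : Matrix ν' κ' L}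
    (h : IsRep i F t Y X) (h' : IsRep i G s W X') :
    IsRep i (fromCols F G) (fromBlocks t 0 0 s) (fromRows Y W) (X + X') := by
  obtain ⟨ht, Z, hZ, rfl⟩ := h
  obtain ⟨hs, Z', hZ', rfl⟩ := h'
  refine ⟨isUnit_map_fromBlocks_upper ht hs 0, fromRows Z Z', ?_, ?_⟩
  · simp [fromBlocks_map, fromBlocks_mul_fromRows, fromRows_map, hZ, hZ']
  · rw [map_fromCols_ringHom, fromCols_mul_fromRows]

theorem IsRep.mul {F : Matrix ν' ι R} {t : Matrix ι ι R} {Y : Matrix ι ν R} {X : Matrix ν' ν L}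
    {G : Matrix ν μ R} {s : Matrix μ μ R} {W : Matrix μ κ' R} {X' : Matrix ν κ' L}
    (h : IsRep i F t Y X) (h' : IsRep i G s W X') :
    IsRep i (fromCols F 0) (fromBlocks t (-(Y * G)) 0 s) (fromRows 0 W) (X * X') := by
  obtain ⟨ht, Z, hZ, rfl⟩ := h
  obtain ⟨hs, Z', hZ', rfl⟩ := h'
  refine ⟨isUnit_map_fromBlocks_upper ht hs _, fromRows (Z * G.map i * Z') Z', ?_, ?_⟩
  · simp [fromBlocks_map, fromBlocks_mul_fromRows, fromRows_map, ← hZ,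
      hZ', map_neg_ringHom, Matrix.map_mul, Matrix.mul_assoc]
  · rw [map_fromCols_ringHom, fromCols_mul_fromRows, map_zero_ringHom]
    simp [Matrix.mul_assoc]

theorem hasRep_map (A : Matrix ν' κ R) : HasRep i (A.map i) :=
  ⟨_, _, inferInstance, _, _, _, isRep_map A⟩

theorem HasRep.add {X X' : Matrix ν' κ' L} (h : HasRep i X) (h' : HasRep i X') :
    HasRep i (X + X') := by
  obtain ⟨_, _, _, _, _, _, h⟩ := h
  obtain ⟨_, _, _, _, _, _, h'⟩ := h'
  exact ⟨_, _, inferInstance, _, _, _, h.add h'⟩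

theorem HasRep.neg {X : Matrix ν' κ' L} (h : HasRep i X) : HasRep i (-X) := by
  obtain ⟨_, _, _, _, _, _, h⟩ := h
  exact ⟨_, _, inferInstance, _, _, _, h.neg⟩

theorem HasRep.mul {X : Matrix ν' ν L} {X' : Matrix ν κ' L} (h : HasRep i X) (h' : HasRep i X') :
    HasRep i (X * X') := by
  obtain ⟨_, _, _, _, _, _, h⟩ := h
  obtain ⟨_, _, _, _, _, _, h'⟩ := h'
  exact ⟨_, _, inferInstance, _, _, _, h.mul h'⟩

variable (i) in
/-- The subring of all elements which are fractions. -/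
def fractionSubring : Subring L where
  carrier := {x | HasRep i (of fun _ _ : Unit => x)}
  mul_mem' {x y} hx hy := by
    have h := HasRep.mul hx hy
    have e : (of fun _ _ : Unit => x) * (of fun _ _ : Unit => y) = of fun _ _ : Unit => x * y := by
      ext; simp [Matrix.mul_apply]
    rwa [e] at h
  one_mem' := by
    have h := hasRep_map (i := i) (of fun _ _ : Unit => (1 : R))
    have e : (of fun _ _ : Unit => (1 : R)).map i = of fun _ _ : Unit => 1 := by ext; simp
    rwa [e] at h
  add_mem' {x y} hx hy := HasRep.add hx hy
  zero_mem' := by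
    have h := hasRep_map (i := i) (of fun _ _ : Unit => (0 : R))
    have e : (of fun _ _ : Unit => (0 : R)).map i = of fun _ _ : Unit => 0 := by ext; simp
    rwa [e] at h
  neg_mem' {x} hx := HasRep.neg hx

theorem map_mem_fractionSubring (r : R) : i r ∈ fractionSubring i := by
  have h := hasRep_map (i := i) (of fun _ _ : Unit => r)
  have e : (of fun _ _ : Unit => r).map i = of fun _ _ : Unit => i r := by ext; simp
  rwa [e] at h

theorem apply_mem_fractionSubring {X : Matrix ν κ L} (h : HasRep i X) (a : ν) (b : κ) :
    X a b ∈ fractionSubring i := by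
  classical
  obtain ⟨_, _, _, _, _, _, h⟩ := h
  have h1 := (h.mul_left (of fun (_ : Unit) c => (Pi.single a 1 : ν → R) c)).mul_right
    (of fun c (_ : Unit) => (Pi.single b 1 : κ → R) c)
  have h2 : HasRep i _ := ⟨_, _, inferInstance, _, _, _, h1⟩
  change HasRep i _
  convert h2 using 1
  ext
  simp [Matrix.mul_apply, Pi.single_apply, apply_ite i]

theorem fractionSubring_eq_top {Sig : Set (REnd R)} (huniv : IsUniversalLocalization Sig i) :
    fractionSubring i = ⊤ := by
  let j : R →+* fractionSubring i := i.codRestrict _ map_mem_fractionSubring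
  have hj : (fractionSubring i).subtype.comp j = i := rfl
  obtain ⟨k, hk, -⟩ := huniv.2 _ j (huniv.1.of_isUnit fun n A hA => by
    obtain ⟨⟨U, Z, h, h'⟩, rfl : U = _⟩ := hA
    have hZ : HasRep i Z := ⟨_, _, inferInstance, _, _, _, isRep_inv h h'⟩
    let Z' : Matrix (Fin n) (Fin n) (fractionSubring i) :=
      of fun a b => ⟨Z a b, apply_mem_fractionSubring hZ a b⟩
    have hinj := Matrix.map_injective (m := Fin n) (n := Fin n)
      (Subtype.val_injective (p := (· ∈ fractionSubring i)))
    have hA' : (A.map j).map (fractionSubring i).subtype = A.map i := rfl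
    have hZ' : Z'.map (fractionSubring i).subtype = Z := rfl
    refine ⟨⟨A.map j, Z', hinj ?_, hinj ?_⟩, rfl⟩
    · change (A.map j * Z').map (fractionSubring i).subtype =
        (1 : Matrix _ _ _).map (fractionSubring i).subtype
      rw [Matrix.map_mul, map_one_ringHom, hA', hZ', h]
    · change (Z' * A.map j).map (fractionSubring i).subtype =
        (1 : Matrix _ _ _).map (fractionSubring i).subtype
      rw [Matrix.map_mul, map_one_ringHom, hA', hZ', h'])
  have h := (huniv.2 L i huniv.1).unique (y₁ := (fractionSubring i).subtype.comp k)
    (y₂ := RingHom.id L) (by rw [RingHom.comp_assoc, hk, hj]) rfl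
  refine (Subring.eq_top_iff' _).2 fun x => ?_
  have hx : ((k x : fractionSubring i) : L) = x := RingHom.congr_fun h x
  rw [← hx]
  exact (k x).2

/-- Cramer's rule: every matrix over a universal localization is a fraction. -/
theorem hasRep_of_isUniversalLocalization {Sig : Set (REnd R)}
    (huniv : IsUniversalLocalization Sig i) (X : Matrix ν κ L) : HasRep i X := by
  classical
  have hsingle : ∀ a b, HasRep i (Matrix.single a b (X a b)) := by
    intro a b
    have hx : X a b ∈ fractionSubring i := by rw [fractionSubring_eq_top huniv]; trivial
    have h1 := (hasRep_map (i := i) (of fun c (_ : Unit) => (Pi.single a 1 : ν → R) c)).mul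
      (HasRep.mul hx (hasRep_map (i := i) (of fun (_ : Unit) c => (Pi.single b 1 : κ → R) c)))
    convert h1 using 1
    ext c d
    simp only [Matrix.single_apply, Matrix.mul_apply, map_apply, of_apply, Pi.single_apply,
      apply_ite i, map_one, map_zero, Finset.univ_unique, Finset.sum_singleton]
    grind
  have hsum : ∀ S : Finset (ν × κ), HasRep i (∑ p ∈ S, Matrix.single p.1 p.2 (X p.1 p.2)) := by
    intro S
    induction S using Finset.induction_on with
    | empty =>
      rw [Finset.sum_empty, ← map_zero_ringHom (i := i)]
      exact hasRep_map _
    | insert p S hp ih =>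
      rw [Finset.sum_insert hp]
      exact (hsingle _ _).add ih
  have h := hsum Finset.univ
  rw [Fintype.sum_prod_type] at h
  rwa [matrix_eq_sum_single X]

end Representation

namespace DetLike

open Matrix

variable {R L : Type} [Ring R] [Ring L] {Γ : Type*} [CommGroupWithZero Γ] {D : DetLike R Γ}
  {i : R →+* L} {Sig : Set (REnd R)} {ι μ ν κ : Type} [Fintype ι] [Fintype μ] [Fintype ν]
  [Fintype κ] [DecidableEq ι] [DecidableEq μ]

theorem num_ne_zero_iff [DecidableEq ν] (hD : D.Detects i) {F : Matrix ν ι R} {t : Matrix ι ι R}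
    {Y : Matrix ι ν R} {X : Matrix ν ν L} (h : IsRep i F t Y X) :
    D.num F t Y ≠ 0 ↔ IsUnit X := by
  obtain ⟨ht, Z, hZ, rfl⟩ := h
  have h1 : fromBlocks (t.map i) (Y.map i) (-F.map i) 0 =
      fromBlocks (t.map i) 0 (-F.map i) (F.map i * Z) * fromBlocks 1 Z 0 1 := by
    simp [fromBlocks_multiply, hZ]
  have h2 : IsUnit (fromBlocks (1 : Matrix ι ι L) Z 0 (1 : Matrix ν ν L)) :=
    (isUnit_fromBlocks_one_left _ _).2 isUnit_one
  rw [num, hD, fromBlocks_map, map_neg_ringHom, map_zero_ringHom, h1,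
    ← h2.unit_spec, Units.isUnit_mul_units,
    ← isUnit_submatrix_equiv_iff_of_ring _ (Equiv.sumComm ν ι), Equiv.sumComm_apply,
    fromBlocks_submatrix_sum_swap_sum_swap, isUnit_fromBlocks_upper_iff_left _ _ ht]

theorem exists_det (hD : D.Detects i) (huniv : IsUniversalLocalization Sig i)
    (X : Matrix ν ν L) : ∃ γ : Γ, ∀ (ι : Type) [Fintype ι] [DecidableEq ι] (F : Matrix ν ι R)
      (t : Matrix ι ι R) (Y : Matrix ι ν R), IsRep i F t Y X → D.num F t Y = γ * D.val t := by
  classical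
  obtain ⟨μ, _, _, G, s, W, hs, Z', hZ', hX'⟩ := hasRep_of_isUniversalLocalization huniv X
  refine ⟨D.num G s W / D.val s, fun ι _ _ F t Y h => ?_⟩
  obtain ⟨ht, Z, hZ, hX⟩ := h
  rw [div_mul_eq_mul_div, eq_div_iff ((hD s).2 hs)]
  exact num_mul_val_eq hD huniv ((hD t).2 ht) ((hD s).2 hs) hZ hZ' (hX.symm.trans hX')

/-- The extension of `D` to the universal localization. -/
noncomputable def det (hD : D.Detects i) (huniv : IsUniversalLocalization Sig i)
    (X : Matrix ν ν L) : Γ :=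
  (exists_det hD huniv X).choose

theorem num_eq_det_mul (hD : D.Detects i) (huniv : IsUniversalLocalization Sig i)
    {X : Matrix ν ν L} {F : Matrix ν ι R} {t : Matrix ι ι R} {Y : Matrix ι ν R}
    (h : IsRep i F t Y X) : D.num F t Y = det hD huniv X * D.val t :=
  (exists_det hD huniv X).choose_spec ι F t Y h

theorem det_ne_zero_iff [DecidableEq ν] (hD : D.Detects i) (huniv : IsUniversalLocalization Sig i)
    (X : Matrix ν ν L) : det hD huniv X ≠ 0 ↔ IsUnit X := by
  classical
  obtain ⟨ι, _, _, F, t, Y, h⟩ := hasRep_of_isUniversalLocalization huniv X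
  rw [← num_ne_zero_iff hD h, num_eq_det_mul hD huniv h, mul_ne_zero_iff,
    and_iff_left ((hD t).2 h.1)]

theorem num_mul (F : Matrix ν ι R) (t : Matrix ι ι R) (Y : Matrix ι ν R) (G : Matrix ν μ R)
    (s : Matrix μ μ R) (W : Matrix μ ν R) (h : D.num F t Y ≠ 0) :
    D.num (fromCols F 0) (fromBlocks t (-(Y * G)) 0 s) (fromRows 0 W) =
      D.num F t Y * D.num G s W := by
  have h1 : D.val (fromBlocksThree t 0 Y 0 (1 : Matrix μ μ R) 0 (-F) 0 0) = D.num F t Y := by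
    rw [D.val_three_swap, D.val_three_of_col _ _ _ _ _ _ _ (by simp [D.val_one]), D.val_one,
      one_mul, num]
  have h2 : D.val (fromBlocksThree (1 : Matrix ι ι R) 0 0 0 s W 0 (-G) 0) = D.num G s W := by
    rw [D.val_three_of_col _ _ _ _ _ _ _ (by simp [D.val_one]), D.val_one, one_mul, num]
  have h3 : -(fromCols F (0 : Matrix ν μ R)) = fromCols (-F) 0 := by ext a (b | b) <;> simp
  rw [num, h3, val_three_assoc, ← h1, ← h2, ← D.val_mul_left _ _ (by rwa [h1]),
    fromBlocksThree_mul]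
  simp

theorem det_mul [DecidableEq ν] (hD : D.Detects i) (huniv : IsUniversalLocalization Sig i)
    {X : Matrix ν ν L} (hX : IsUnit X) (X' : Matrix ν ν L) :
    det hD huniv (X * X') = det hD huniv X * det hD huniv X' := by
  classical
  obtain ⟨ι, _, _, F, t, Y, h⟩ := hasRep_of_isUniversalLocalization huniv X
  obtain ⟨μ, _, _, G, s, W, h'⟩ := hasRep_of_isUniversalLocalization huniv X'
  have ht := (hD t).2 h.1
  have hs := (hD s).2 h'.1
  have h1 := num_eq_det_mul hD huniv (h.mul h')
  rw [num_mul _ _ _ _ _ _ ((num_ne_zero_iff hD h).2 hX), D.val_upper_left _ _ _ ht,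
    num_eq_det_mul hD huniv h, num_eq_det_mul hD huniv h', mul_mul_mul_comm] at h1
  exact (mul_right_cancel₀ (mul_ne_zero ht hs) h1).symm

theorem num_one_one [DecidableEq ν] (A : Matrix ν ν R) : D.num A 1 1 = D.val A := by
  have h1 : fromBlocks (1 : Matrix ν ν R) (1 : Matrix ν ν R) (-A) 0 =
      fromBlocks 1 0 (-A) A * fromBlocks 1 1 0 (1 : Matrix ν ν R) := by
    simp [fromBlocks_multiply]
  have h0 : D.val (1 : Matrix ν ν R) ≠ 0 := by simp [D.val_one]
  have h2 : D.val (fromBlocks (1 : Matrix ν ν R) 1 0 (1 : Matrix ν ν R)) = 1 := by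
    rw [D.val_upper_left _ _ _ h0, D.val_one, one_mul]
  rw [num, h1, D.val_mul_right _ _ (by simp [h2]), h2, D.val_lower_left _ _ _ h0, D.val_one,
    one_mul, mul_one]

theorem det_map [DecidableEq ν] (hD : D.Detects i) (huniv : IsUniversalLocalization Sig i)
    (A : Matrix ν ν R) : det hD huniv (A.map i) = D.val A := by
  have h := num_eq_det_mul hD huniv (isRep_map (i := i) A)
  rw [num_one_one, D.val_one, mul_one] at h
  exact h.symm

theorem det_submatrix_equiv (hD : D.Detects i) (huniv : IsUniversalLocalization Sig i)
    {ξ : Type} [Fintype ξ] (X : Matrix ν ν L) (e : ξ ≃ ν) : det hD huniv (X.submatrix e e) = det hD huniv X := by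
  classical
  obtain ⟨ι, _, _, F, t, Y, h⟩ := hasRep_of_isUniversalLocalization huniv X
  have h' : IsRep i (F.submatrix e id) t (Y.submatrix id e) (X.submatrix e e) := by
    obtain ⟨ht, Z, hZ, rfl⟩ := h
    refine ⟨ht, Z.submatrix id e, ?_, ?_⟩
    · ext a b
      exact congrFun (congrFun hZ a) (e b)
    · ext a b
      rfl
  have h1 := num_eq_det_mul hD huniv h
  have h2 := num_eq_det_mul hD huniv h'
  have h3 : D.num (F.submatrix e id) t (Y.submatrix id e) = D.num F t Y := by
    rw [num, num, ← D.val_reindex ((Equiv.refl ι).sumCongr e)]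
    congr 1
    ext (a | a) (b | b) <;> rfl
  rw [h3, h1] at h2
  exact (mul_right_cancel₀ ((hD t).2 h.1) h2).symm

theorem det_fromBlocks_one [DecidableEq ν] [DecidableEq κ] (hD : D.Detects i)
    (huniv : IsUniversalLocalization Sig i) (X : Matrix ν ν L) :
    det hD huniv (fromBlocks X 0 0 (1 : Matrix κ κ L)) = det hD huniv X := by
  obtain ⟨ι, _, _, F, t, Y, h⟩ := hasRep_of_isUniversalLocalization huniv X
  have h1 : D.val (1 : Matrix κ κ R) ≠ 0 := by simp [D.val_one]
  have h' : IsRep i (fromBlocks F 0 0 (1 : Matrix κ κ R)) (fromBlocks t 0 0 1)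
      (fromBlocks Y 0 0 1) (fromBlocks X 0 0 (1 : Matrix κ κ L)) := by
    obtain ⟨ht, Z, hZ, rfl⟩ := h
    refine ⟨isUnit_map_fromBlocks_upper ht (by simp) 0, fromBlocks Z 0 0 1, ?_, ?_⟩ <;>
    simp [fromBlocks_map, fromBlocks_multiply, hZ]
  have h2 := num_eq_det_mul hD huniv h
  have h3 := num_eq_det_mul hD huniv h'
  have h4 : D.num (fromBlocks F 0 0 (1 : Matrix κ κ R)) (fromBlocks t 0 0 1)
      (fromBlocks Y 0 0 1) = D.num F t Y * D.num (1 : Matrix κ κ R) 1 1 := by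
    rw [num, num, num, ← D.val_upper_right _ 0 _ (by rw [← num, num_one_one]; exact h1),
      ← D.val_reindex (Equiv.sumSumSumComm ι ν κ κ).symm]
    congr 1
    ext ((a | a) | (a | a)) ((b | b) | (b | b)) <;> simp
  rw [h4, h2, num_one_one, D.val_upper_right _ _ _ h1, D.val_one, mul_one, mul_one] at h3
  exact (mul_right_cancel₀ ((hD t).2 h.1) h3).symm

end DetLike

/- ## The group `K₁(R, Σ)` -/

section Presentation

open Matrix

variable {R L : Type} [Ring R] [Ring L] {i : R →+* L}

/-- The class of an endomorphism in `K₁(R, Σ)`. -/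
noncomputable def K1S.mk (i : R →+* L) (σ : REnd R) (h : Inverts i σ) : K1S i :=
  QuotientAddGroup.mk (FreeAbelianGroup.of ⟨σ, h⟩)

theorem inverts_id {P : Type} [AddCommGroup P] [Module R P] {h1 h2} :
    Inverts i ⟨P, LinearMap.id, h1, h2⟩ := fun _ _ _ => Function.bijective_id

theorem K1S.mk_comp {P : Type} [AddCommGroup P] [Module R P] {f g : P →ₗ[R] P} {h1 h2}
    (hf : Inverts i ⟨P, f, h1, h2⟩) (hg : Inverts i ⟨P, g, h1, h2⟩) (hgf) :
    K1S.mk i ⟨P, g ∘ₗ f, h1, h2⟩ hgf = K1S.mk i _ hg + K1S.mk i _ hf := by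
  have h : CompD.rel (⟨P, f, g, h1, h2, hf, hg, hgf⟩ : CompD i) ∈ K1SRel i :=
    AddSubgroup.subset_closure (Or.inl ⟨_, rfl⟩)
  rw [← QuotientAddGroup.eq_zero_iff, CompD.rel, QuotientAddGroup.mk_sub,
    QuotientAddGroup.mk_sub, sub_sub, sub_eq_zero] at h
  exact h

theorem K1S.mk_of_exact {P₀ P₁ P₂ : Type} [AddCommGroup P₀] [AddCommGroup P₁] [AddCommGroup P₂]
    [Module R P₀] [Module R P₁] [Module R P₂] (s : P₀ →ₗ[R] P₁) (p : P₁ →ₗ[R] P₂)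
    (hs : Function.Injective s) (hp : Function.Surjective p)
    (he : LinearMap.range s = LinearMap.ker p) {f₀ : P₀ →ₗ[R] P₀} {f₁ : P₁ →ₗ[R] P₁}
    {f₂ : P₂ →ₗ[R] P₂} (h₀ : f₁ ∘ₗ s = s ∘ₗ f₀) (h₁ : f₂ ∘ₗ p = p ∘ₗ f₁) {a₀ b₀ a₁ b₁ a₂ b₂}
    (i₀ : Inverts i ⟨P₀, f₀, a₀, b₀⟩) (i₁ : Inverts i ⟨P₁, f₁, a₁, b₁⟩)
    (i₂ : Inverts i ⟨P₂, f₂, a₂, b₂⟩) :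
    K1S.mk i _ i₁ = K1S.mk i _ i₀ + K1S.mk i _ i₂ := by
  have h : SESD.rel (⟨P₀, P₁, P₂, s, p, hs, hp, he, f₀, f₁, f₂, h₀, h₁, a₀, a₁, a₂, b₀, b₁, b₂,
      i₀, i₁, i₂⟩ : SESD i) ∈ K1SRel i :=
    AddSubgroup.subset_closure (Or.inr ⟨_, rfl⟩)
  rw [← QuotientAddGroup.eq_zero_iff, SESD.rel, QuotientAddGroup.mk_sub,
    QuotientAddGroup.mk_sub, sub_sub, sub_eq_zero] at h
  exact h

theorem K1S.mk_id {P : Type} [AddCommGroup P] [Module R P] {h1 h2} (h) :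
    K1S.mk i ⟨P, LinearMap.id, h1, h2⟩ h = 0 := by
  have h' := K1S.mk_comp (i := i) h h (by rwa [LinearMap.comp_id])
  simp only [LinearMap.comp_id] at h'
  exact left_eq_add.1 h'

theorem K1S.mk_congr {P Q : Type} [AddCommGroup P] [Module R P] [AddCommGroup Q] [Module R Q]
    (e : P ≃ₗ[R] Q) {f : P →ₗ[R] P} {g : Q →ₗ[R] Q} (h : ∀ x, g (e x) = e (f x)) {h1 h2 h3 h4}
    (hf : Inverts i ⟨P, f, h1, h2⟩) (hg : Inverts i ⟨Q, g, h3, h4⟩) :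
    K1S.mk i _ hf = K1S.mk i _ hg := by
  have h' := K1S.mk_of_exact (i := i) (P₂ := PUnit) e.toLinearMap 0 e.injective
    (fun x => ⟨0, Subsingleton.elim _ _⟩) (by simp) (f₁ := g) (f₂ := LinearMap.id)
    (LinearMap.ext h) (Subsingleton.elim _ _) (a₂ := inferInstance) (b₂ := inferInstance) hf hg
    inverts_id
  rw [K1S.mk_id, add_zero] at h'
  exact h'.symm

open Classical in
/-- The class of a matrix in `K₁(R, Σ)`, and zero if the matrix is not inverted. -/
noncomputable def K1S.val (i : R →+* L) {ι : Type} [Fintype ι] (A : Matrix ι ι R) :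
    WithZero (Multiplicative (K1S i)) :=
  if h : Inverts i (vecMulREnd A) then
    ((Multiplicative.ofAdd (K1S.mk i _ h) : Multiplicative (K1S i)) : WithZero _) else 0

theorem K1S.val_of_inverts {ι : Type} [Fintype ι] {A : Matrix ι ι R}
    (h : Inverts i (vecMulREnd A)) : K1S.val i A =
      ((Multiplicative.ofAdd (K1S.mk i _ h) : Multiplicative (K1S i)) : WithZero _) :=
  dif_pos h

theorem K1S.val_ne_zero_iff {ι : Type} [Fintype ι] (A : Matrix ι ι R) :
    K1S.val i A ≠ 0 ↔ Inverts i (vecMulREnd A) := by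
  by_cases h : Inverts i (vecMulREnd A)
  · simp [K1S.val_of_inverts h, h]
  · simp [K1S.val, h]

theorem K1S.val_eq_mul {ι μ ν : Type} [Fintype ι] [Fintype μ] [Fintype ν] {A : Matrix ι ι R}
    {B : Matrix μ μ R} {C : Matrix ν ν R}
    (h : Inverts i (vecMulREnd C) ↔ Inverts i (vecMulREnd A) ∧ Inverts i (vecMulREnd B))
    (h' : ∀ hA hB hC, K1S.mk i (vecMulREnd C) hC =
      K1S.mk i (vecMulREnd A) hA + K1S.mk i (vecMulREnd B) hB) :
    K1S.val i C = K1S.val i A * K1S.val i B := by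
  by_cases hC : Inverts i (vecMulREnd C)
  · obtain ⟨hA, hB⟩ := h.1 hC
    rw [K1S.val_of_inverts hA, K1S.val_of_inverts hB, K1S.val_of_inverts hC, h' hA hB hC,
      ofAdd_add, WithZero.coe_mul]
  · have h1 : K1S.val i C = 0 := not_not.1 (mt (K1S.val_ne_zero_iff C).1 hC)
    rw [h1]
    by_contra h2
    have h3 := mul_ne_zero_iff.1 (Ne.symm h2)
    rw [K1S.val_ne_zero_iff, K1S.val_ne_zero_iff] at h3
    exact hC (h.2 h3)

theorem K1S.mk_vecMulREnd_mul {ι : Type} [Fintype ι] (A B : Matrix ι ι R) (hA hB hAB) :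
    K1S.mk i (vecMulREnd (A * B)) hAB =
      K1S.mk i (vecMulREnd A) hA + K1S.mk i (vecMulREnd B) hB := by
  have h : (A * B).vecMulLinear = B.vecMulLinear ∘ₗ A.vecMulLinear := by
    ext; simp
  have h' := K1S.mk_comp (i := i) (f := A.vecMulLinear) (g := B.vecMulLinear) hA hB (by
    rw [← h]; exact hAB)
  rw [add_comm]
  refine Eq.trans ?_ h'
  simp only [← h]
  rfl

theorem K1S.mk_vecMulREnd_upper {ι μ : Type} [Fintype ι] [Fintype μ] (A : Matrix ι ι R)
    (B : Matrix ι μ R) (C : Matrix μ μ R) (hA hC hABC) :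
    K1S.mk i (vecMulREnd (fromBlocks A B 0 C)) hABC =
      K1S.mk i (vecMulREnd A) hA + K1S.mk i (vecMulREnd C) hC := by
  classical
  rw [add_comm]
  let s : (μ → R) →ₗ[R] (ι ⊕ μ → R) :=
    { toFun := fun y => Sum.elim 0 y
      map_add' := fun x y => by ext (a | a) <;> simp
      map_smul' := fun r x => by ext (a | a) <;> simp }
  let p : (ι ⊕ μ → R) →ₗ[R] (ι → R) := LinearMap.funLeft R R Sum.inl
  refine K1S.mk_of_exact (i := i) s p (fun x y h => ?_) (fun x => ⟨Sum.elim x 0, ?_⟩) ?_ ?_ ?_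
    hC hABC hA
  · exact funext fun a => congrFun h (Sum.inr a)
  · rfl
  · ext v
    constructor
    · rintro ⟨y, rfl⟩
      rfl
    · intro hv
      exact ⟨v ∘ Sum.inr, funext fun a => by
        cases a with
        | inl a => exact (congrFun (LinearMap.mem_ker.1 hv) a).symm
        | inr a => rfl⟩
  · refine LinearMap.ext fun y => ?_
    ext (a | a) <;> simp [s, vecMul_fromBlocks]
  · refine LinearMap.ext fun v => ?_
    ext a
    simp only [p, LinearMap.comp_apply, vecMulLinear_apply, LinearMap.funLeft_apply,
      vecMul_fromBlocks, vecMul_zero, add_zero, Sum.elim_inl]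
    rfl

theorem K1S.inverts_mul_iff_of_left {ι : Type} [Fintype ι] {A B : Matrix ι ι R}
    (hA : Inverts i (vecMulREnd A)) : Inverts i (vecMulREnd (A * B)) ↔
      Inverts i (vecMulREnd A) ∧ Inverts i (vecMulREnd B) := by
  classical
  rw [and_iff_right hA]
  rw [inverts_vecMulREnd_iff] at hA ⊢
  rw [inverts_vecMulREnd_iff, Matrix.map_mul, ← hA.unit_spec, Units.isUnit_units_mul]

theorem K1S.inverts_mul_iff_of_right {ι : Type} [Fintype ι] {A B : Matrix ι ι R}
    (hB : Inverts i (vecMulREnd B)) : Inverts i (vecMulREnd (A * B)) ↔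
      Inverts i (vecMulREnd A) ∧ Inverts i (vecMulREnd B) := by
  classical
  rw [and_iff_left hB]
  rw [inverts_vecMulREnd_iff] at hB ⊢
  rw [inverts_vecMulREnd_iff, Matrix.map_mul, ← hB.unit_spec, Units.isUnit_mul_units]

theorem K1S.val_submatrix_equiv {ι μ : Type} [Fintype ι] [Fintype μ] (e : μ ≃ ι)
    (A : Matrix ι ι R) : K1S.val i (A.submatrix e e) = K1S.val i A := by
  classical
  have h : Inverts i (vecMulREnd (A.submatrix e e)) ↔ Inverts i (vecMulREnd A) := by
    rw [inverts_vecMulREnd_iff, inverts_vecMulREnd_iff, ← submatrix_map,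
      isUnit_submatrix_equiv_iff_of_ring]
  by_cases hA : Inverts i (vecMulREnd A)
  · rw [K1S.val_of_inverts hA, K1S.val_of_inverts (h.2 hA)]
    congr 2
    refine K1S.mk_congr (LinearEquiv.funCongrLeft R R e.symm) (fun x => ?_) (h.2 hA) hA
    ext a
    simp only [vecMulLinear_apply, LinearEquiv.funCongrLeft_apply, LinearMap.funLeft_apply]
    simp only [vecMul, dotProduct, LinearMap.funLeft_apply, submatrix_apply, Equiv.apply_symm_apply]
    exact (e.symm.sum_comp fun b => x b * A (e b) a).symm.trans (by simp) |>.symm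
  · rw [K1S.val, K1S.val, dif_neg hA, dif_neg (mt h.1 hA)]

/-- The classes of matrices in `K₁(R, Σ)` behave like a determinant. -/
noncomputable def K1S.detLike (i : R →+* L) :
    DetLike R (WithZero (Multiplicative (K1S i))) where
  val := K1S.val i
  val_one := by
    intro ι _ _
    have h : (vecMulREnd (1 : Matrix ι ι R)) =
        ⟨ι → R, LinearMap.id, inferInstance, inferInstance⟩ := by
      rw [vecMulREnd]; congr 1; ext; simp
    have h1 : Inverts i (vecMulREnd (1 : Matrix ι ι R)) := by rw [h]; exact inverts_id
    rw [K1S.val_of_inverts h1]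
    simp only [h, K1S.mk_id, ofAdd_zero, WithZero.coe_one]
  val_mul_left A B hA := K1S.val_eq_mul
    (K1S.inverts_mul_iff_of_left ((K1S.val_ne_zero_iff A).1 hA)) (K1S.mk_vecMulREnd_mul A B)
  val_mul_right A B hB := K1S.val_eq_mul
    (K1S.inverts_mul_iff_of_right ((K1S.val_ne_zero_iff B).1 hB)) (K1S.mk_vecMulREnd_mul A B)
  val_upper_left A B C hA := K1S.val_eq_mul (by
    classical
    rw [K1S.val_ne_zero_iff] at hA
    rw [and_iff_right hA]
    rw [inverts_vecMulREnd_iff] at hA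
    rw [inverts_vecMulREnd_iff, inverts_vecMulREnd_iff, fromBlocks_map, map_zero_ringHom,
      isUnit_fromBlocks_upper_iff_right hA]) (K1S.mk_vecMulREnd_upper A B C)
  val_upper_right A B C hC := K1S.val_eq_mul (by
    classical
    rw [K1S.val_ne_zero_iff] at hC
    rw [and_iff_left hC]
    rw [inverts_vecMulREnd_iff] at hC
    rw [inverts_vecMulREnd_iff, inverts_vecMulREnd_iff, fromBlocks_map, map_zero_ringHom,
      isUnit_fromBlocks_upper_iff_left _ _ hC]) (K1S.mk_vecMulREnd_upper A B C)
  val_reindex := K1S.val_submatrix_equiv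

theorem K1S.detLike_detects : (K1S.detLike i).Detects i := fun A =>
  (K1S.val_ne_zero_iff A).trans (inverts_vecMulREnd_iff i A)

end Presentation

/- ## The group `K₁` of a ring -/

namespace K1

open Matrix

variable {L : Type} [Ring L]

theorem mk_mul {n : ℕ} {A B : Matrix (Fin n) (Fin n) L} (hA : IsUnit A) (hB : IsUnit B) :
    K1mk L (A * B) = K1mk L A + K1mk L B := by
  have h : FreeAbelianGroup.of (α := MatGen L) ⟨n, A * B⟩
      - FreeAbelianGroup.of (α := MatGen L) ⟨n, A⟩ - FreeAbelianGroup.of (α := MatGen L) ⟨n, B⟩ ∈ K1Rel L :=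
    AddSubgroup.subset_closure (Or.inl (Or.inl ⟨n, A, B, hA, hB, rfl⟩))
  rw [← QuotientAddGroup.eq_zero_iff, QuotientAddGroup.mk_sub, QuotientAddGroup.mk_sub, sub_sub,
    sub_eq_zero] at h
  exact h

theorem mk_stabMat {n : ℕ} (A : Matrix (Fin n) (Fin n) L) : K1mk L (stabMat A) = K1mk L A := by
  have h : FreeAbelianGroup.of (α := MatGen L) ⟨n + 1, stabMat A⟩
      - FreeAbelianGroup.of (α := MatGen L) ⟨n, A⟩ ∈ K1Rel L :=
    AddSubgroup.subset_closure (Or.inl (Or.inr ⟨n, A, rfl⟩))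
  rw [← QuotientAddGroup.eq_zero_iff, QuotientAddGroup.mk_sub, sub_eq_zero] at h
  exact h

theorem mk_of_not_isUnit {n : ℕ} {A : Matrix (Fin n) (Fin n) L} (hA : ¬IsUnit A) :
    K1mk L A = 0 := by
  have h : FreeAbelianGroup.of (α := MatGen L) ⟨n, A⟩ ∈ K1Rel L :=
    AddSubgroup.subset_closure (Or.inr ⟨n, A, hA, rfl⟩)
  rw [← QuotientAddGroup.eq_zero_iff] at h
  exact h

theorem mk_one {n : ℕ} : K1mk L (1 : Matrix (Fin n) (Fin n) L) = 0 := by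
  have h := mk_mul (L := L) (n := n) isUnit_one isUnit_one
  rw [mul_one] at h
  exact left_eq_add.1 h

theorem mk_submatrix_perm {n : ℕ} (A : Matrix (Fin n) (Fin n) L) (e : Fin n ≃ Fin n) :
    K1mk L (A.submatrix e e) = K1mk L A := by
  by_cases hA : IsUnit A
  · let P : Matrix (Fin n) (Fin n) L := (1 : Matrix _ _ L).submatrix e id
    let Q : Matrix (Fin n) (Fin n) L := (1 : Matrix _ _ L).submatrix id e
    have hPQ : P * Q = 1 := by
      ext a b
      simp [P, Q, Matrix.mul_apply, one_apply]
    have hQP : Q * P = 1 := by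
      rw [Matrix.submatrix_mul_equiv, Matrix.one_mul, submatrix_id_id]
    have hP : IsUnit P := ⟨⟨P, Q, hPQ, hQP⟩, rfl⟩
    have hQ : IsUnit Q := ⟨⟨Q, P, hQP, hPQ⟩, rfl⟩
    have h : A.submatrix e e = P * A * Q := by
      ext a b
      simp [P, Q, Matrix.mul_apply, one_apply]
    have h1 := mk_mul hP hQ
    rw [hPQ, mk_one] at h1
    rw [h, mk_mul (hP.mul hA) hQ, mk_mul hP hA, add_right_comm, ← h1, zero_add]
  · rw [mk_of_not_isUnit hA, mk_of_not_isUnit]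
    rwa [isUnit_submatrix_equiv_iff_of_ring]

variable {ι μ κ : Type} [Fintype ι] [Fintype μ] [Fintype κ]

/-- The class in `K₁` of a square matrix with an arbitrary index type. -/
noncomputable def cls (A : Matrix ι ι L) : K1 L :=
  K1mk L (A.submatrix (Fintype.equivFin ι).symm (Fintype.equivFin ι).symm)

theorem cls_eq_mk {n : ℕ} (A : Matrix ι ι L) (e : Fin n ≃ ι) :
    cls A = K1mk L (A.submatrix e e) := by
  obtain rfl : n = Fintype.card ι := by simpa using Fintype.card_congr e
  rw [← mk_submatrix_perm _ ((Fintype.equivFin ι).symm.trans e.symm), submatrix_submatrix]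
  have h : e ∘ (Fintype.equivFin ι).symm.trans e.symm = (Fintype.equivFin ι).symm := by
    ext; simp
  rw [h, cls]

theorem cls_fin {n : ℕ} (A : Matrix (Fin n) (Fin n) L) : cls A = K1mk L A :=
  cls_eq_mk A (Equiv.refl _)

theorem cls_submatrix_equiv (A : Matrix ι ι L) (e : μ ≃ ι) : cls (A.submatrix e e) = cls A := by
  rw [cls, submatrix_submatrix]
  exact (cls_eq_mk A ((Fintype.equivFin μ).symm.trans e)).symm

theorem stabMat_eq_submatrix {n : ℕ} (A : Matrix (Fin n) (Fin n) L) :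
    stabMat A = (fromBlocks A 0 0 (1 : Matrix (Fin 1) (Fin 1) L)).submatrix finSumFinEquiv.symm
      finSumFinEquiv.symm := by
  ext a b
  refine Fin.addCases (fun a => ?_) (fun a => ?_) a <;>
  refine Fin.addCases (fun b => ?_) (fun b => ?_) b <;> simp [stabMat, Fin.fin_one_eq_zero]

theorem cls_fromBlocks_one_unit (A : Matrix ι ι L) :
    cls (fromBlocks A 0 0 (1 : Matrix (Fin 1) (Fin 1) L)) = cls A := by
  rw [← cls_submatrix_equiv A (Fintype.equivFin ι).symm, cls_fin, ← mk_stabMat,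
    cls_eq_mk _ (finSumFinEquiv.symm.trans ((Fintype.equivFin ι).symm.sumCongr (Equiv.refl _)))]
  rw [stabMat_eq_submatrix]
  congr 1
  ext a b
  simp only [submatrix_apply, Equiv.trans_apply]
  rcases finSumFinEquiv.symm a with a | a <;> rcases finSumFinEquiv.symm b with b | b <;> rfl

theorem cls_fromBlocks_one_fin (A : Matrix ι ι L) (m : ℕ) :
    cls (fromBlocks A 0 0 (1 : Matrix (Fin m) (Fin m) L)) = cls A := by
  induction m with
  | zero =>
    rw [← cls_submatrix_equiv _ (Equiv.sumEmpty ι (Fin 0)).symm]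
    rfl
  | succ m ih =>
    rw [← ih, ← cls_fromBlocks_one_unit (fromBlocks A 0 0 (1 : Matrix (Fin m) (Fin m) L)),
      ← cls_submatrix_equiv (fromBlocks A 0 0 (1 : Matrix (Fin (m + 1)) (Fin (m + 1)) L))
      ((Equiv.sumAssoc ι (Fin m) (Fin 1)).trans ((Equiv.refl ι).sumCongr finSumFinEquiv))]
    congr 1
    ext ((a | a) | a) ((b | b) | b) <;> simp [one_apply, Fin.ext_iff] <;> lia

theorem cls_fromBlocks_one_right [DecidableEq κ] (A : Matrix ι ι L) :
    cls (fromBlocks A 0 0 (1 : Matrix κ κ L)) = cls A := by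
  rw [← cls_fromBlocks_one_fin A (Fintype.card κ), ← cls_submatrix_equiv _
    ((Equiv.refl ι).sumCongr (Fintype.equivFin κ))]
  congr 1
  ext (a | a) (b | b) <;> simp [one_apply]

theorem cls_fromBlocks_one_left [DecidableEq κ] (A : Matrix ι ι L) :
    cls (fromBlocks (1 : Matrix κ κ L) 0 0 A) = cls A := by
  rw [← cls_fromBlocks_one_right (κ := κ) A, ← cls_submatrix_equiv _ (Equiv.sumComm ι κ)]
  simp

variable [DecidableEq ι] [DecidableEq μ]

theorem cls_mul {A B : Matrix ι ι L} (hA : IsUnit A) (hB : IsUnit B) :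
    cls (A * B) = cls A + cls B := by
  rw [cls, ← submatrix_mul_equiv A B _ (Fintype.equivFin ι).symm, mk_mul, cls, cls]
  all_goals rwa [isUnit_submatrix_equiv_iff_of_ring]

theorem cls_one : cls (1 : Matrix ι ι L) = 0 := by
  rw [cls, submatrix_one_equiv, mk_one]

theorem isUnit_fromBlocks_one_one (B : Matrix ι μ L) :
    IsUnit (fromBlocks (1 : Matrix ι ι L) B 0 (1 : Matrix μ μ L)) :=
  (isUnit_fromBlocks_one_left _ _).2 isUnit_one

theorem cls_add_cls_eq_zero {A B : Matrix ι ι L} (hAB : A * B = 1) (hBA : B * A = 1) :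
    cls A + cls B = 0 := by
  rw [← cls_mul ⟨⟨A, B, hAB, hBA⟩, rfl⟩ ⟨⟨B, A, hBA, hAB⟩, rfl⟩, hAB, cls_one]

theorem fromBlocksThree_one {ι μ ν : Type*} [DecidableEq ι] [DecidableEq μ] [DecidableEq ν] :
    fromBlocksThree (1 : Matrix ι ι L) 0 0 0 (1 : Matrix μ μ L) 0 0 0 (1 : Matrix ν ν L) = 1 := by
  ext (a | a | a) (b | b | b) <;> simp [fromBlocksThree, one_apply]

/-- Elementary block matrices are trivial in `K₁`, being commutators after stabilization. -/
theorem cls_elementary (B : Matrix ι μ L) :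
    cls (fromBlocks (1 : Matrix ι ι L) B 0 (1 : Matrix μ μ L)) = 0 := by
  let E (C : Matrix ι μ L) : Matrix (ι ⊕ (μ ⊕ μ)) (ι ⊕ (μ ⊕ μ)) L :=
    fromBlocksThree 1 C 0 0 1 0 0 0 1
  let G (C : Matrix μ μ L) : Matrix (ι ⊕ (μ ⊕ μ)) (ι ⊕ (μ ⊕ μ)) L :=
    fromBlocksThree 1 0 0 0 1 C 0 0 1
  have hE : ∀ C, E C * E (-C) = 1 := fun C => by
    simp only [E, fromBlocksThree_mul, ← fromBlocksThree_one]; simp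
  have hG : ∀ C, G C * G (-C) = 1 := fun C => by
    simp only [G, fromBlocksThree_mul, ← fromBlocksThree_one]; simp
  have hE' : ∀ C, E (-C) * E C = 1 := fun C => by simpa using hE (-C)
  have hG' : ∀ C, G (-C) * G C = 1 := fun C => by simpa using hG (-C)
  have uE : ∀ C, IsUnit (E C) := fun C => ⟨⟨_, _, hE C, hE' C⟩, rfl⟩
  have uG : ∀ C, IsUnit (G C) := fun C => ⟨⟨_, _, hG C, hG' C⟩, rfl⟩
  have h1 : E B * G 1 * (E (-B) * G (-1)) = fromBlocksThree 1 0 B 0 1 0 0 0 1 := by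
    simp only [E, G, fromBlocksThree_mul]; simp
  have h2 := cls_mul ((uE B).mul (uG 1)) ((uE (-B)).mul (uG (-1)))
  rw [h1, cls_mul (uE B) (uG 1), cls_mul (uE (-B)) (uG (-1)), add_add_add_comm,
    cls_add_cls_eq_zero (hE B) (hE' B), cls_add_cls_eq_zero (hG 1) (hG' 1), add_zero] at h2
  rw [← h2, ← cls_fromBlocks_one_left (κ := μ)]
  let e : μ ⊕ (ι ⊕ μ) ≃ ι ⊕ (μ ⊕ μ) :=
    (Equiv.sumAssoc μ ι μ).symm.trans
      (((Equiv.sumComm μ ι).sumCongr (Equiv.refl μ)).trans (Equiv.sumAssoc ι μ μ))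
  rw [← cls_submatrix_equiv (fromBlocksThree _ _ _ _ _ _ _ _ _) e]
  congr 1
  ext (a | a | a) (b | b | b) <;> simp [e, fromBlocksThree, one_apply]

theorem cls_fromBlocks_upper {A : Matrix ι ι L} {C : Matrix μ μ L} (hA : IsUnit A) (hC : IsUnit C)
    (B : Matrix ι μ L) : cls (fromBlocks A B 0 C) = cls A + cls C := by
  have h : fromBlocks A B 0 C = fromBlocks 1 0 0 C * (fromBlocks 1 B 0 1 * fromBlocks A 0 0 1) := by
    simp [fromBlocks_multiply]
  have hA' : IsUnit (fromBlocks A 0 0 (1 : Matrix μ μ L)) :=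
    (isUnit_fromBlocks_zero_zero_one_iff A).2 hA
  have hB := isUnit_fromBlocks_one_one B
  rw [h, cls_mul ((isUnit_fromBlocks_one_zero_zero_iff C).2 hC) (hB.mul hA'), cls_mul hB hA',
    cls_elementary, cls_fromBlocks_one_left, cls_fromBlocks_one_right, zero_add, add_comm]

theorem isUnit_fromBlocks_lower {A : Matrix ι ι L} {C : Matrix μ μ L} (hA : IsUnit A)
    (hC : IsUnit C) (B : Matrix μ ι L) : IsUnit (fromBlocks A 0 B C) := by
  rw [← isUnit_submatrix_equiv_iff_of_ring _ (Equiv.sumComm μ ι), Equiv.sumComm_apply,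
    fromBlocks_submatrix_sum_swap_sum_swap, isUnit_fromBlocks_upper_iff_left _ _ hA]
  exact hC

theorem cls_fromBlocks_lower {A : Matrix ι ι L} {C : Matrix μ μ L} (hA : IsUnit A) (hC : IsUnit C)
    (B : Matrix μ ι L) : cls (fromBlocks A 0 B C) = cls A + cls C := by
  rw [← cls_submatrix_equiv _ (Equiv.sumComm μ ι), Equiv.sumComm_apply,
    fromBlocks_submatrix_sum_swap_sum_swap, cls_fromBlocks_upper hC hA, add_comm]

theorem cls_one_add_mul_comm (X : Matrix ι μ L) (Y : Matrix μ ι L) (h : IsUnit (1 + X * Y))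
    (h' : IsUnit (1 + Y * X)) : cls (1 + X * Y) = cls (1 + Y * X) := by
  have e : fromBlocks (1 : Matrix ι ι L) 0 Y (1 : Matrix μ μ L) * fromBlocks 1 (-X) 0 (1 + Y * X) =
      fromBlocks (1 + X * Y) (-X) 0 1 * fromBlocks 1 0 Y 1 := by
    simp [fromBlocks_multiply]
  have hY : IsUnit (fromBlocks (1 : Matrix ι ι L) 0 Y (1 : Matrix μ μ L)) :=
    isUnit_fromBlocks_lower isUnit_one isUnit_one Y
  have h1 := congrArg cls e
  rw [cls_mul hY ((isUnit_fromBlocks_upper_iff_right isUnit_one _ _).2 h'),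
    cls_mul ((isUnit_fromBlocks_upper_iff_right h _ _).2 isUnit_one) hY,
    cls_fromBlocks_upper isUnit_one h', cls_fromBlocks_upper h isUnit_one,
    cls_fromBlocks_lower isUnit_one isUnit_one] at h1
  simpa [cls_one] using h1.symm

end K1

/- ## The comparison of `K₁(R, Σ)` and `K₁(R_Σ)` -/

section Comparison

open Matrix K1

variable {R L : Type} [Ring R] [Ring L] {i : R →+* L} {ι μ : Type} [Fintype ι] [Fintype μ]
  [DecidableEq ι] [DecidableEq μ] {P : Type} [AddCommGroup P] [Module R P]

theorem retractMatrix_eq_one_add (s : P →ₗ[R] (ι → R)) (r : (ι → R) →ₗ[R] P)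
    (s' : P →ₗ[R] (μ → R)) (r' : (μ → R) →ₗ[R] P) (h : ∀ x, r' (s' x) = x) (f : P →ₗ[R] P) :
    retractMatrix s r f = 1 + (s' ∘ₗ r).toMatrixRight' *
      (s ∘ₗ (f - LinearMap.id) ∘ₗ r').toMatrixRight' := by
  rw [← LinearMap.toMatrixRight'_comp, ← LinearMap.toMatrixRight'_id, ← map_add, retractMatrix]
  congr 1
  refine LinearMap.ext fun x => ?_
  simp only [retractExtend, LinearMap.add_apply, LinearMap.sub_apply, LinearMap.comp_apply,
    LinearMap.id_apply, h, map_sub]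
  abel

theorem retractMatrix_eq_one_add' (s : P →ₗ[R] (ι → R)) (r : (ι → R) →ₗ[R] P)
    (s' : P →ₗ[R] (μ → R)) (r' : (μ → R) →ₗ[R] P) (h : ∀ x, r (s x) = x) (f : P →ₗ[R] P) :
    retractMatrix s' r' f = 1 + (s ∘ₗ (f - LinearMap.id) ∘ₗ r').toMatrixRight' *
      (s' ∘ₗ r).toMatrixRight' := by
  rw [← LinearMap.toMatrixRight'_comp, ← LinearMap.toMatrixRight'_id, ← map_add, retractMatrix]
  congr 1
  refine LinearMap.ext fun x => ?_
  simp only [retractExtend, LinearMap.add_apply, LinearMap.sub_apply, LinearMap.comp_apply,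
    LinearMap.id_apply, h, map_sub]
  abel

theorem map_one_add_mul {ι μ : Type} [Fintype μ] [DecidableEq ι] (X : Matrix ι μ R) (Y : Matrix μ ι R) :
    (1 + X * Y).map i = 1 + X.map i * Y.map i := by
  rw [Matrix.map_add _ (map_add i), map_one_ringHom, Matrix.map_mul]

theorem cls_retractMatrix_eq (s : P →ₗ[R] (ι → R)) (r : (ι → R) →ₗ[R] P)
    (hrs : ∀ x, r (s x) = x) (s' : P →ₗ[R] (μ → R)) (r' : (μ → R) →ₗ[R] P)
    (hrs' : ∀ x, r' (s' x) = x) {f : P →ₗ[R] P} {h1 h2} (h : Inverts i ⟨P, f, h1, h2⟩) :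
    cls ((retractMatrix s r f).map i) = cls ((retractMatrix s' r' f).map i) := by
  have u := (isUnit_retractMatrix_iff i s r hrs f h1 h2).2 h
  have u' := (isUnit_retractMatrix_iff i s' r' hrs' f h1 h2).2 h
  rw [retractMatrix_eq_one_add s r s' r' hrs', map_one_add_mul] at u ⊢
  rw [retractMatrix_eq_one_add' s r s' r' hrs, map_one_add_mul] at u' ⊢
  exact cls_one_add_mul_comm _ _ u u'

/-- The class over `L` of an endomorphism, computed by means of a retraction from a free
module. -/
noncomputable def extendCls (i : R →+* L) (σ : REnd R) : K1 L :=
  cls ((retractMatrix σ.exists_retract.choose_spec.choose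
    σ.exists_retract.choose_spec.choose_spec.choose σ.f).map i)

theorem extendCls_eq (s : P →ₗ[R] (ι → R)) (r : (ι → R) →ₗ[R] P) (hrs : ∀ x, r (s x) = x)
    {f : P →ₗ[R] P} {h1 h2} (h : Inverts i ⟨P, f, h1, h2⟩) :
    extendCls i ⟨P, f, h1, h2⟩ = cls ((retractMatrix s r f).map i) :=
  cls_retractMatrix_eq _ _
    (REnd.exists_retract ⟨P, f, h1, h2⟩).choose_spec.choose_spec.choose_spec s r hrs h

theorem extendCls_vecMulREnd (A : Matrix ι ι R) (h : Inverts i (vecMulREnd A)) :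
    extendCls i (vecMulREnd A) = cls (A.map i) := by
  refine (extendCls_eq LinearMap.id LinearMap.id (fun _ => rfl) h).trans ?_
  have h' : retractExtend LinearMap.id LinearMap.id A.vecMulLinear = A.vecMulLinear := by
    simp [retractExtend]
  rw [retractMatrix, h']
  congr 2
  exact LinearMap.toMatrixRight'.apply_symm_apply A

theorem extendCls_comp {f g : P →ₗ[R] P} {h1 h2} (hf : Inverts i ⟨P, f, h1, h2⟩)
    (hg : Inverts i ⟨P, g, h1, h2⟩) (hgf : Inverts i ⟨P, g ∘ₗ f, h1, h2⟩) :
    extendCls i ⟨P, g ∘ₗ f, h1, h2⟩ = extendCls i ⟨P, g, h1, h2⟩ + extendCls i ⟨P, f, h1, h2⟩ := by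
  obtain ⟨n, s, r, hrs⟩ := REnd.exists_retract ⟨P, f, h1, h2⟩
  have h : retractExtend s r (g ∘ₗ f) = retractExtend s r g ∘ₗ retractExtend s r f := by
    refine LinearMap.ext fun x => ?_
    simp only [retractExtend, LinearMap.add_apply, LinearMap.sub_apply, LinearMap.comp_apply,
      LinearMap.id_apply, map_add, map_sub, hrs]
    abel
  rw [extendCls_eq s r hrs hf, extendCls_eq s r hrs hg, extendCls_eq s r hrs hgf, retractMatrix, h,
    LinearMap.toMatrixRight'_comp, Matrix.map_mul, cls_mul, add_comm, retractMatrix, retractMatrix]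
  · exact (isUnit_retractMatrix_iff i s r hrs f h1 h2).2 hf
  · exact (isUnit_retractMatrix_iff i s r hrs g h1 h2).2 hg

theorem exists_splitting {P₀ P₁ P₂ : Type} [AddCommGroup P₀] [AddCommGroup P₁] [AddCommGroup P₂]
    [Module R P₀] [Module R P₁] [Module R P₂] [Module.Projective R P₂] (j : P₀ →ₗ[R] P₁)
    (p : P₁ →ₗ[R] P₂) (hj : Function.Injective j) (hp : Function.Surjective p)
    (he : LinearMap.range j = LinearMap.ker p) :
    ∃ (σ : P₂ →ₗ[R] P₁) (ρ : P₁ →ₗ[R] P₀), (∀ x, p (σ x) = x) ∧ (∀ x, ρ (j x) = x) ∧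
      ∀ x, j (ρ x) + σ (p x) = x := by
  obtain ⟨σ, hσ⟩ := Module.projective_lifting_property p LinearMap.id hp
  have hσ' : ∀ x, p (σ x) = x := LinearMap.congr_fun hσ
  have hpj : ∀ x, p (j x) = 0 := fun x => LinearMap.mem_ker.1 (he ▸ LinearMap.mem_range_self j x)
  let q : P₁ →ₗ[R] LinearMap.range j := (LinearMap.id - σ ∘ₗ p).codRestrict _ fun x => by
    rw [he, LinearMap.mem_ker]
    simp [hσ']
  let ρ : P₁ →ₗ[R] P₀ := (LinearEquiv.ofInjective j hj).symm.toLinearMap ∘ₗ q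
  have hρ : ∀ x, j (ρ x) = x - σ (p x) := fun x =>
    congrArg Subtype.val ((LinearEquiv.ofInjective j hj).apply_symm_apply (q x))
  exact ⟨σ, ρ, hσ', fun x => hj (by rw [hρ, hpj, map_zero, sub_zero]), fun x => by simp [hρ]⟩

theorem extendCls_of_exact {P₀ P₁ P₂ : Type} [AddCommGroup P₀] [AddCommGroup P₁] [AddCommGroup P₂]
    [Module R P₀] [Module R P₁] [Module R P₂] (j : P₀ →ₗ[R] P₁) (p : P₁ →ₗ[R] P₂)
    (hj : Function.Injective j) (hp : Function.Surjective p)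
    (he : LinearMap.range j = LinearMap.ker p) {f₀ : P₀ →ₗ[R] P₀} {f₁ : P₁ →ₗ[R] P₁}
    {f₂ : P₂ →ₗ[R] P₂} (h₀ : f₁ ∘ₗ j = j ∘ₗ f₀) (h₁ : f₂ ∘ₗ p = p ∘ₗ f₁) {a₀ b₀ a₁ b₁ a₂ b₂}
    (i₀ : Inverts i ⟨P₀, f₀, a₀, b₀⟩) (i₁ : Inverts i ⟨P₁, f₁, a₁, b₁⟩)
    (i₂ : Inverts i ⟨P₂, f₂, a₂, b₂⟩) :
    extendCls i ⟨P₁, f₁, a₁, b₁⟩ = extendCls i ⟨P₀, f₀, a₀, b₀⟩ + extendCls i ⟨P₂, f₂, a₂, b₂⟩ := by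
  have := b₂
  obtain ⟨σ, ρ, hσ, hρ, hσρ⟩ := exists_splitting j p hj hp he
  obtain ⟨n₀, s₀, r₀, hrs₀⟩ := REnd.exists_retract ⟨P₀, f₀, a₀, b₀⟩
  obtain ⟨n₂, s₂, r₂, hrs₂⟩ := REnd.exists_retract ⟨P₂, f₂, a₂, b₂⟩
  have hpj : ∀ x, p (j x) = 0 := fun x => LinearMap.mem_ker.1 (he ▸ LinearMap.mem_range_self j x)
  have h₀' : ∀ x, f₁ (j x) = j (f₀ x) := LinearMap.congr_fun h₀
  have h₁' : ∀ x, p (f₁ x) = f₂ (p x) := fun x => (LinearMap.congr_fun h₁ x).symm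
  let s₁ : P₁ →ₗ[R] (Fin n₀ ⊕ Fin n₂ → R) :=
    { toFun := fun x => Sum.elim (s₀ (ρ x)) (s₂ (p x))
      map_add' := fun x y => by ext (a | a) <;> simp
      map_smul' := fun c x => by ext (a | a) <;> simp }
  let r₁ : (Fin n₀ ⊕ Fin n₂ → R) →ₗ[R] P₁ :=
    j ∘ₗ r₀ ∘ₗ LinearMap.funLeft R R Sum.inl + σ ∘ₗ r₂ ∘ₗ LinearMap.funLeft R R Sum.inr
  have hs₁ : ∀ x, s₁ x = Sum.elim (s₀ (ρ x)) (s₂ (p x)) := fun x => rfl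
  have hr₁ : ∀ v, r₁ v = j (r₀ (v ∘ Sum.inl)) + σ (r₂ (v ∘ Sum.inr)) := fun v => rfl
  have hrs₁ : ∀ x, r₁ (s₁ x) = x := fun x => by
    rw [hr₁, hs₁, Sum.elim_comp_inl, Sum.elim_comp_inr]
    simp only at hrs₀ hrs₂
    rw [hrs₀, hrs₂, hσρ]
  have hl : ∀ x, retractExtend s₁ r₁ f₁ (Sum.elim x 0) = Sum.elim (retractExtend s₀ r₀ f₀ x) 0 := by
    intro x
    ext (a | a) <;> simp [retractExtend, hs₁, hr₁, h₀', hρ, hpj]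
  have hr : ∀ v, retractExtend s₁ r₁ f₁ v ∘ Sum.inr = retractExtend s₂ r₂ f₂ (v ∘ Sum.inr) := by
    intro v
    ext a
    simp [retractExtend, hs₁, hr₁, h₁', hσ, hpj]
  have hM : retractMatrix s₁ r₁ f₁ = fromBlocks (retractMatrix s₀ r₀ f₀) 0
      (retractMatrix s₁ r₁ f₁).toBlocks₂₁ (retractMatrix s₂ r₂ f₂) := by
    have e₁ : ∀ a, Sum.elim (Pi.single a 1) 0 = (Pi.single (Sum.inl a) 1 : Fin n₀ ⊕ Fin n₂ → R) :=
      fun a => by ext (b | b) <;> simp [Pi.single_apply]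
    have e₂ : ∀ a, (Pi.single (Sum.inr a) 1 : Fin n₀ ⊕ Fin n₂ → R) ∘ Sum.inr = Pi.single a 1 :=
      fun a => by ext b; simp [Pi.single_apply]
    ext (a | a) (b | b)
    · have h := congrFun (hl (Pi.single a 1)) (Sum.inl b)
      rw [e₁] at h
      exact h
    · have h := congrFun (hl (Pi.single a 1)) (Sum.inr b)
      rw [e₁] at h
      exact h
    · rfl
    · have h := congrFun (hr (Pi.single (Sum.inr a) 1)) b
      rw [e₂] at h
      exact h
  rw [extendCls_eq s₀ r₀ hrs₀ i₀, extendCls_eq s₂ r₂ hrs₂ i₂, extendCls_eq s₁ r₁ hrs₁ i₁, hM,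
    fromBlocks_map, map_zero_ringHom]
  exact cls_fromBlocks_lower ((isUnit_retractMatrix_iff i s₀ r₀ hrs₀ f₀ a₀ b₀).2 i₀)
    ((isUnit_retractMatrix_iff i s₂ r₂ hrs₂ f₂ a₂ b₂).2 i₂) _

/-- The homomorphism `K₁(R, Σ) → K₁(R_Σ)` induced by extension of scalars. -/
noncomputable def K1S.toK1 (i : R →+* L) : K1S i →+ K1 L :=
  QuotientAddGroup.lift (K1SRel i) (FreeAbelianGroup.lift fun σ => extendCls i σ.1) (by
    rw [K1SRel, AddSubgroup.closure_le]
    rintro x (⟨d, rfl⟩ | ⟨d, rfl⟩)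
    · change FreeAbelianGroup.lift _ d.rel = 0
      simp only [CompD.rel, map_sub, FreeAbelianGroup.lift_apply_of]
      rw [sub_sub, sub_eq_zero]
      exact extendCls_comp d.invf d.invg d.invgf
    · change FreeAbelianGroup.lift _ d.rel = 0
      simp only [SESD.rel, map_sub, FreeAbelianGroup.lift_apply_of]
      rw [sub_sub, sub_eq_zero]
      exact extendCls_of_exact d.ι d.p d.inj d.surj d.exact d.comm₀ d.comm₁ d.inv0 d.inv1 d.inv2)

theorem K1S.toK1_mk (σ : REnd R) (h : Inverts i σ) : K1S.toK1 i (K1S.mk i σ h) = extendCls i σ :=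
  FreeAbelianGroup.lift_apply_of _ _

end Comparison

section Inverse

open Matrix K1

variable {R L : Type} [Ring R] [Ring L] {i : R →+* L} {Sig : Set (REnd R)}

/-- The additive class of a matrix over the universal localization in `K₁(R, Σ)`, and zero if
the matrix is not invertible. -/
noncomputable def K1S.logDet (huniv : IsUniversalLocalization Sig i) {ν : Type} [Fintype ν]
    (X : Matrix ν ν L) : K1S i :=
  WithZero.log (DetLike.det K1S.detLike_detects huniv X)

theorem K1S.logDet_mul (huniv : IsUniversalLocalization Sig i) {ν : Type} [Fintype ν]
    [DecidableEq ν] {X Y : Matrix ν ν L} (hX : IsUnit X) (hY : IsUnit Y) :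
    K1S.logDet huniv (X * Y) = K1S.logDet huniv X + K1S.logDet huniv Y := by
  rw [logDet, DetLike.det_mul _ _ hX]
  exact WithZero.log_mul ((DetLike.det_ne_zero_iff _ huniv X).2 hX)
    ((DetLike.det_ne_zero_iff _ huniv Y).2 hY)

theorem K1S.logDet_of_not_isUnit (huniv : IsUniversalLocalization Sig i) {ν : Type} [Fintype ν]
    [DecidableEq ν] {X : Matrix ν ν L} (hX : ¬ IsUnit X) : K1S.logDet huniv X = 0 := by
  rw [logDet, not_not.1 (mt (DetLike.det_ne_zero_iff K1S.detLike_detects huniv X).1 hX),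
    WithZero.log_zero]

theorem K1S.logDet_stabMat (huniv : IsUniversalLocalization Sig i) {n : ℕ}
    (X : Matrix (Fin n) (Fin n) L) : K1S.logDet huniv (stabMat X) = K1S.logDet huniv X := by
  rw [logDet, K1.stabMat_eq_submatrix, DetLike.det_submatrix_equiv, DetLike.det_fromBlocks_one, logDet]

/-- The extension of `K1S.logDet` to formal combinations of matrices. -/
noncomputable def K1S.logDetHom (huniv : IsUniversalLocalization Sig i) :
    FreeAbelianGroup (MatGen L) →+ K1S i :=
  FreeAbelianGroup.lift fun X => K1S.logDet huniv X.2

theorem K1S.logDetHom_of (huniv : IsUniversalLocalization Sig i) {n : ℕ}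
    (X : Matrix (Fin n) (Fin n) L) :
    K1S.logDetHom huniv (FreeAbelianGroup.of ⟨n, X⟩) = K1S.logDet huniv X :=
  FreeAbelianGroup.lift_apply_of _ _

/-- The homomorphism `K₁(R_Σ) → K₁(R, Σ)` induced by the determinant. -/
noncomputable def K1S.ofK1 (huniv : IsUniversalLocalization Sig i) : K1 L →+ K1S i :=
  QuotientAddGroup.lift (K1Rel L) (K1S.logDetHom huniv) (by
    rw [K1Rel, AddSubgroup.closure_le]
    rintro x ((⟨n, A, B, hA, hB, rfl⟩ | ⟨n, A, rfl⟩) | ⟨n, A, hA, rfl⟩)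
    · change K1S.logDetHom huniv (_ - _ - _) = 0
      rw [map_sub, map_sub, sub_sub, sub_eq_zero, logDetHom_of, logDetHom_of, logDetHom_of]
      exact K1S.logDet_mul huniv hA hB
    · change K1S.logDetHom huniv (_ - _) = 0
      rw [map_sub, sub_eq_zero, logDetHom_of, logDetHom_of]
      exact K1S.logDet_stabMat huniv A
    · change K1S.logDetHom huniv _ = 0
      rw [logDetHom_of]
      exact K1S.logDet_of_not_isUnit huniv hA)

theorem K1S.ofK1_mk (huniv : IsUniversalLocalization Sig i) {n : ℕ}
    (X : Matrix (Fin n) (Fin n) L) : K1S.ofK1 huniv (K1mk L X) = K1S.logDet huniv X :=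
  K1S.logDetHom_of huniv X

theorem K1S.log_val {ι : Type} [Fintype ι] {A : Matrix ι ι R} (h : Inverts i (vecMulREnd A)) :
    WithZero.log (K1S.val i A) = K1S.mk i _ h := by
  rw [K1S.val_of_inverts h]
  exact WithZero.log_exp _

theorem K1S.logDet_map (huniv : IsUniversalLocalization Sig i) {ι : Type} [Fintype ι]
    [DecidableEq ι] {A : Matrix ι ι R} (h : Inverts i (vecMulREnd A)) :
    K1S.logDet huniv (A.map i) = K1S.mk i _ h := by
  rw [logDet, DetLike.det_map]
  exact K1S.log_val h

theorem K1S.mk_retractExtend {P Q : Type} [AddCommGroup P] [Module R P] [AddCommGroup Q]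
    [Module R Q] (s : P →ₗ[R] Q) (r : Q →ₗ[R] P) (hrs : ∀ x, r (s x) = x) {f : P →ₗ[R] P}
    {h1 h2 h3 h4} (h : Inverts i ⟨Q, retractExtend s r f, h1, h2⟩)
    (hf : Inverts i ⟨P, f, h3, h4⟩) : K1S.mk i _ h = K1S.mk i _ hf := by
  let p : Q →ₗ[R] LinearMap.ker r := (LinearMap.id - s ∘ₗ r).codRestrict _ fun x => by
    simp [hrs]
  have hp : ∀ x, ((p x : LinearMap.ker r) : Q) = x - s (r x) := fun x => rfl
  have hpk : ∀ x : LinearMap.ker r, p x = x := fun x => Subtype.ext (by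
    rw [hp, LinearMap.mem_ker.1 x.2, map_zero, sub_zero])
  have hsurj : Function.Surjective p := fun x => ⟨x, hpk x⟩
  have h5 : Module.Finite R (LinearMap.ker r) := Module.Finite.of_surjective p hsurj
  have h6 : Module.Projective R (LinearMap.ker r) :=
    Module.Projective.of_split (LinearMap.ker r).subtype p (LinearMap.ext hpk)
  have h7 := K1S.mk_of_exact (i := i) s p (Function.LeftInverse.injective hrs) hsurj
    (by
      ext x
      rw [LinearMap.mem_ker, ← Subtype.coe_inj, hp, ZeroMemClass.coe_zero, sub_eq_zero]
      exact ⟨fun ⟨y, hy⟩ => by rw [← hy, hrs], fun hx => ⟨r x, hx.symm⟩⟩)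
    (f₂ := LinearMap.id) (a₂ := h5) (b₂ := h6)
    (LinearMap.ext fun x => by simp [retractExtend, hrs])
    (LinearMap.ext fun x => Subtype.ext (by simp [retractExtend, hrs, hp])) hf h inverts_id
  rwa [K1S.mk_id, add_zero] at h7

theorem K1S.ofK1_toK1 (huniv : IsUniversalLocalization Sig i) (x : K1S i) :
    K1S.ofK1 huniv (K1S.toK1 i x) = x := by
  suffices h : (K1S.ofK1 huniv).comp (K1S.toK1 i) = AddMonoidHom.id _ from DFunLike.congr_fun h x
  refine QuotientAddGroup.addMonoidHom_ext _ (FreeAbelianGroup.lift_ext _ _ fun ⟨σ, h⟩ => ?_)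
  change K1S.ofK1 huniv (K1S.toK1 i (K1S.mk i σ h)) = K1S.mk i σ h
  obtain ⟨n, s, r, hrs⟩ := σ.exists_retract
  have h' : Inverts i (vecMulREnd (retractMatrix s r σ.f)) := by
    rwa [vecMulREnd_retractMatrix, inverts_retractExtend_iff i s r hrs σ.f _ _ σ.fin σ.proj]
  have h'' := h'
  rw [vecMulREnd_retractMatrix] at h''
  rw [K1S.toK1_mk]
  refine (congrArg _ (extendCls_eq s r hrs h)).trans ?_
  rw [cls_fin, K1S.ofK1_mk, K1S.logDet_map huniv h', ← K1S.mk_retractExtend s r hrs h'' h]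
  congr 1
  exact vecMulREnd_retractMatrix s r σ.f

theorem K1S.toK1_logDet (huniv : IsUniversalLocalization Sig i) {ν : Type} [Fintype ν]
    [DecidableEq ν] {X : Matrix ν ν L} (hX : IsUnit X) :
    K1S.toK1 i (K1S.logDet huniv X) = cls X := by
  obtain ⟨ι, _, _, F, t, Y, h⟩ := hasRep_of_isUniversalLocalization huniv X
  have hnum := DetLike.num_eq_det_mul K1S.detLike_detects huniv h
  have hN := (DetLike.num_ne_zero_iff K1S.detLike_detects h).2 hX
  obtain ⟨ht, Z, hZ, hXZ⟩ := h
  have ht' := (inverts_vecMulREnd_iff i t).2 ht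
  have hN' : Inverts i (vecMulREnd (fromBlocks t Y (-F) 0)) := (K1S.val_ne_zero_iff _).1 hN
  have hlog : K1S.mk i _ hN' = K1S.logDet huniv X + K1S.mk i _ ht' := by
    rw [← K1S.log_val hN', ← K1S.log_val ht']
    refine (congrArg WithZero.log hnum).trans ?_
    exact WithZero.log_mul ((DetLike.det_ne_zero_iff _ huniv X).2 hX)
      ((K1S.val_ne_zero_iff t).2 ht')
  have hcls := congrArg (K1S.toK1 i) hlog
  have hfac : fromBlocks (t.map i) (Y.map i) (-F.map i) 0 =
      fromBlocks (t.map i) 0 (-F.map i) X * fromBlocks 1 Z 0 1 := by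
    simp [fromBlocks_multiply, hZ, hXZ]
  rw [map_add, K1S.toK1_mk, K1S.toK1_mk, extendCls_vecMulREnd _ hN', extendCls_vecMulREnd _ ht',
    fromBlocks_map, map_neg_ringHom, map_zero_ringHom, hfac,
    cls_mul (isUnit_fromBlocks_lower ht hX _) (isUnit_fromBlocks_one_one _),
    cls_fromBlocks_lower ht hX, cls_elementary, add_zero, add_comm] at hcls
  exact (add_right_cancel hcls).symm

theorem K1S.toK1_ofK1 (huniv : IsUniversalLocalization Sig i) (x : K1 L) :
    K1S.toK1 i (K1S.ofK1 huniv x) = x := by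
  suffices h : (K1S.toK1 i).comp (K1S.ofK1 huniv) = AddMonoidHom.id _ from DFunLike.congr_fun h x
  refine QuotientAddGroup.addMonoidHom_ext _ (FreeAbelianGroup.lift_ext _ _ fun ⟨n, X⟩ => ?_)
  change K1S.toK1 i (K1S.ofK1 huniv (K1mk L X)) = K1mk L X
  rw [K1S.ofK1_mk]
  by_cases hX : IsUnit X
  · rw [K1S.toK1_logDet huniv hX, cls_fin]
  · rw [K1S.logDet_of_not_isUnit huniv hX, map_zero, mk_of_not_isUnit hX]

end Inverse

/-- for a saturated set `Σ` of endomorphisms of finitely generated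
projective `R`-modules whose universal localization `i : R → R_Σ` is injective,
the canonical homomorphism `α : K₁(R,Σ) → K₁(R_Σ)`, `[f] ↦ [id_{R_Σ} ⊗ f]`, is
bijective.  (The isomorphism is pinned down by its effect on endomorphisms of
free modules, where `id_{R_Σ} ⊗ (matEndo A) = matEndo (A.map i)`.) -/
theorem stmt15 {R L : Type} [Ring R] [Ring L] (Sig : Set (REnd R)) (i : R →+* L)
    (huniv : IsUniversalLocalization Sig i) (hsat : Saturated Sig i)
    (hinj : Function.Injective i) :
    ∃ φ : K1S i ≃+ K1 L,
      ∀ (n : ℕ) (A : Matrix (Fin n) (Fin n) R) (hA : Inverts i (matREnd A)),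
        φ (QuotientAddGroup.mk (FreeAbelianGroup.of ⟨matREnd A, hA⟩)) =
          K1mk L (A.map i) := by
  refine ⟨{ K1S.toK1 i with
      invFun := K1S.ofK1 huniv
      left_inv := K1S.ofK1_toK1 huniv
      right_inv := K1S.toK1_ofK1 huniv }, fun n A hA => ?_⟩
  refine (K1S.toK1_mk (matREnd A) hA).trans ?_
  rw [matREnd_eq_vecMulREnd] at hA ⊢
  rw [extendCls_vecMulREnd A hA, K1.cls_fin]
end
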